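/- arXiv:2009.05278 — 2 statements merged into one kernel-verified Lean document; each statement's English description precedes it below -/
import Mathlib

section
/- 487 divides the class number of the compositum ℚ(3^4)·ℚ(487), where ℚ(3^4) is the unique subfield of degree 81 of ℚ(ζ_{3^5}) (the 4-th layer of the cyclotomic ℤ_3-extension of ℚ, equal to the maximal real subfield of ℚ(ζ_{243})); equivalently, the 487-class group of ℚ(3^4)·ℚ(487) is nontrivial. -/
open NumberField

section CyclotomicNorm

open Polynomial

theorem algebraMap_norm_aeval_eq_prod_primitiveRoots {n : ℕ} [NeZero n] {k E : Type*}
    [Field k] [Field E] [Algebra k E] [IsCyclotomicExtension {n} k E]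
    (hirr : Irreducible (cyclotomic n k)) {ξ : E} (hξ : IsPrimitiveRoot ξ n) (f : k[X]) :
    algebraMap k E (Algebra.norm k (aeval ξ f)) =
      ∏ μ ∈ primitiveRoots n E, aeval μ f := by
  classical
  have : FiniteDimensional k E := IsCyclotomicExtension.finiteDimensional {n} k E
  have : IsGalois k E := IsCyclotomicExtension.isGalois {n} k E
  rw [Algebra.norm_eq_prod_automorphisms]
  have hinj : Function.Injective (fun σ : Gal(E/k) ↦ σ ξ) := by
    intro σ τ h
    have : σ.toAlgHom = τ.toAlgHom := (hξ.powerBasis k).algHom_ext (by simpa using h)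
    exact AlgEquiv.coe_toAlgHom_injective this
  have himg : Finset.univ.image (fun σ : Gal(E/k) ↦ σ ξ) = primitiveRoots n E := by
    apply Finset.eq_of_subset_of_card_le
    · intro μ hμ
      obtain ⟨σ, -, rfl⟩ := Finset.mem_image.mp hμ
      exact (mem_primitiveRoots (NeZero.pos n)).mpr (hξ.map_of_injective σ.injective)
    · rw [Finset.card_image_of_injective _ hinj, hξ.card_primitiveRoots, Finset.card_univ,
        ← Nat.card_eq_fintype_card, IsGalois.card_aut_eq_finrank,
        IsCyclotomicExtension.finrank E hirr]
  rw [← himg, Finset.prod_image fun _ _ _ _ h ↦ hinj h]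
  exact Finset.prod_congr rfl fun σ _ ↦ (aeval_algHom_apply σ.toAlgHom ξ f).symm

theorem algebraMap_resultant_cyclotomic {n N : ℕ} [NeZero n] {A k E : Type*} [CommRing A]
    [Field k] [Field E] [Algebra A k] [Algebra k E] [Algebra A E] [IsScalarTower A k E]
    [IsCyclotomicExtension {n} k E]
    (hirr : Irreducible (cyclotomic n k)) {ξ : E} (hξ : IsPrimitiveRoot ξ n) (f : A[X])
    (hf : f.natDegree ≤ N) :
    algebraMap A k (resultant (cyclotomic n A) f n.totient N) =
      Algebra.norm k (aeval ξ f) := by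
  apply (algebraMap k E).injective
  have hprod := cyclotomic_eq_prod_X_sub_primitiveRoots hξ
  have hsplits : (cyclotomic n E).Splits := by
    rw [hprod]
    exact Splits.prod fun μ _ ↦ Splits.X_sub_C μ
  have hroots : (cyclotomic n E).roots = (primitiveRoots n E).val := by
    rw [hprod, roots_prod_X_sub_C]
  rw [← aeval_map_algebraMap k, algebraMap_norm_aeval_eq_prod_primitiveRoots hirr hξ,
    ← IsScalarTower.algebraMap_apply, ← resultant_map_map, map_cyclotomic,
    ← natDegree_cyclotomic n E, resultant_eq_prod_eval _ _ _ (natDegree_map_le.trans hf) hsplits,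
    (cyclotomic.monic n E).leadingCoeff, one_pow, one_mul, hroots]
  exact Finset.prod_congr rfl fun μ _ ↦ by
    rw [aeval_map_algebraMap, eval_map_algebraMap]

end CyclotomicNorm

theorem Ideal.natCast_absNorm_eq_one {K : Type*} [Field K] [NumberField K] {p k : ℕ}
    [Fact p.Prime] [NeZero (p ^ k)]
    {ζ : 𝓞 K} (hζ : IsPrimitiveRoot ζ (p ^ k)) (I : Ideal (𝓞 K)) (hI : I.absNorm.Coprime p) :
    (I.absNorm : ZMod (p ^ k)) = 1 := by
  induction I using UniqueFactorizationMonoid.induction_on_prime with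
  | h₁ =>
    simp at hI
    exact absurd hI (Fact.out : p.Prime).ne_one
  | h₂ I hu =>
    rw [Ideal.isUnit_iff] at hu
    simp [hu]
  | h₃ I P hI0 hP ih =>
    rw [map_mul] at hI ⊢
    obtain ⟨hPp, hIp⟩ := Nat.coprime_mul_iff_left.mp hI
    rw [Nat.cast_mul, ih hIp, mul_one]
    have hc : (absNorm P).Coprime (p ^ k) := hPp.pow_right k
    have hP₁ : P.IsPrime := Ideal.isPrime_of_prime hP
    have : P.IsMaximal := Ring.DimensionLEOne.maximalOfPrime hP.ne_zero hP₁
    let _ := Ideal.Quotient.field P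
    have hP₃ : absNorm P ≠ 1 := absNorm_eq_one_iff.not.mpr <| IsPrime.ne_top hP₁
    have h := (hζ.idealQuotient_mk hP₃ hc).isUnit_unit (NeZero.ne _)
    have h2 : p ^ k ∣ absNorm P - 1 := by
      have := orderOf_dvd_natCard ((hζ.idealQuotient_mk hP₃ hc).isUnit (NeZero.ne _)).unit
      rw [← h.eq_orderOf, Nat.card_units] at this
      exact this
    have hpos : 1 ≤ absNorm P := Nat.pos_of_ne_zero fun h0 ↦ by
      exact hP.ne_zero (Ideal.absNorm_eq_zero_iff.mp h0)
    have := (ZMod.natCast_eq_zero_iff _ _).mpr h2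
    rw [Nat.cast_sub hpos, Nat.cast_one, sub_eq_zero] at this
    exact this

theorem sq_norm_int_eq_one {K : Type*} [Field K] [NumberField K] {p k : ℕ}
    [Fact p.Prime] [NeZero (p ^ k)] (hk : k ≠ 0)
    {ζ : 𝓞 K} (hζ : IsPrimitiveRoot ζ (p ^ k)) (z : 𝓞 K)
    (hz : IsUnit ((Algebra.norm ℤ z : ℤ) : ZMod (p ^ k))) :
    ((Algebra.norm ℤ z : ℤ) : ZMod (p ^ k)) ^ 2 = 1 := by
  have h := Ideal.natCast_absNorm_eq_one hζ (Ideal.span {z}) (by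
    rw [Ideal.absNorm_span_singleton]
    rw [ZMod.coe_int_isUnit_iff_isCoprime, Int.isCoprime_iff_nat_coprime] at hz
    exact (hz.coprime_dvd_left (by simpa using dvd_pow_self p hk)).symm)
  rw [Ideal.absNorm_span_singleton] at h
  rw [← Int.cast_pow, ← Int.natAbs_sq, Int.cast_pow, Int.cast_natCast, h, one_pow]

/-- A norm from a ring generated by a root of unity of prime power order `p ^ k`, reduced along a
ring homomorphism to `ℤ / p ^ k` where it becomes a unit, becomes `±1`. -/
theorem map_sq_eq_one_of_eq_norm {p k : ℕ} [Fact p.Prime] [NeZero (p ^ k)] (hk : k ≠ 0)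
    {A F E : Type*} [CommRing A] [Field F] [Field E] [Algebra A F] [Algebra F E] [Algebra A E]
    [IsScalarTower A F E] [IsCyclotomicExtension {p ^ k} F E]
    (hinj : Function.Injective (algebraMap A F))
    (hirr : Irreducible (Polynomial.cyclotomic (p ^ k) F)) {ξ : E}
    (hξ : IsPrimitiveRoot ξ (p ^ k)) {y : E} (hy : y ∈ Algebra.adjoin A {ξ}) {w : A}
    (hw : algebraMap A F w = Algebra.norm F y) (ρ : A →+* ZMod (p ^ k)) (hu : IsUnit (ρ w)) :
    ρ w ^ 2 = 1 := by
  classical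
  obtain ⟨f, rfl⟩ := (Algebra.adjoin_singleton_eq_range_aeval A ξ ▸ hy :)
  obtain ⟨g, hg⟩ := Polynomial.map_surjective (Int.castRingHom (ZMod (p ^ k)))
    (ZMod.ringHom_surjective _) (f.map ρ)
  let N := max f.natDegree g.natDegree
  let E' := CyclotomicField (p ^ k) ℚ
  have : IsCyclotomicExtension {p ^ k} ℚ E' := CyclotomicField.isCyclotomicExtension (p ^ k) ℚ
  have : NeZero ((p ^ k : ℕ) : ℚ) := ⟨Nat.cast_ne_zero.mpr (NeZero.ne (p ^ k))⟩
  have hξ' : IsPrimitiveRoot (IsCyclotomicExtension.zeta (p ^ k) ℚ E') (p ^ k) :=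
    IsCyclotomicExtension.zeta_spec _ _ _
  have h1 := algebraMap_resultant_cyclotomic hirr hξ f (le_max_left f.natDegree g.natDegree)
  have h2 := algebraMap_resultant_cyclotomic (A := ℤ)
    (Polynomial.cyclotomic.irreducible_rat (NeZero.pos (p ^ k))) hξ' g
    (le_max_right f.natDegree g.natDegree)
  have hw' : w = Polynomial.resultant (Polynomial.cyclotomic (p ^ k) A) f (p ^ k).totient N :=
    hinj (hw.trans h1.symm)
  have h3 : ρ w = ((Algebra.norm ℤ (Polynomial.aeval hξ'.toInteger g) : ℤ) : ZMod (p ^ k)) := by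
    have h4 : Polynomial.resultant (Polynomial.cyclotomic (p ^ k) ℤ) g (p ^ k).totient N =
        Algebra.norm ℤ (Polynomial.aeval hξ'.toInteger g) := by
      apply Int.cast_injective (α := ℚ)
      rw [Algebra.coe_norm_int]
      refine h2.trans (congrArg _ ?_)
      exact (Polynomial.aeval_algebraMap_apply E' hξ'.toInteger g)
    rw [← h4, hw', ← Polynomial.resultant_map_map, Polynomial.map_cyclotomic, ← hg,
      ← Polynomial.map_cyclotomic (p ^ k) (Int.castRingHom (ZMod (p ^ k))),
      Polynomial.resultant_map_map]
    rfl
  rw [h3] at hu ⊢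
  exact sq_norm_int_eq_one hk hξ'.toInteger_isPrimitiveRoot _ hu

section WeightedProduct

/-- The product of the characters `ρ m, ρ (m + 1), …` with exponents the entries of a list. -/
def weightedProd {A R : Type*} [Monoid A] [CommMonoid R] (ρ : ℕ → A →* R) : List ℕ → ℕ → A →* R
  | [], _ => 1
  | a :: as, m => (powMonoidHom a).comp (ρ m) * weightedProd ρ as (m + 1)

/-- Modular evaluation of `weightedProd` along `r, r ^ 2, r ^ 4, …`. -/
def weightedProdMod (M B : ℕ) (f : ℕ → ℕ) : List ℕ → ℕ → ℕ
  | [], _ => 1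
  | a :: as, r => (f r ^ B % M) ^ a % M * weightedProdMod M B f as (r ^ 2 % M) % M

theorem weightedProd_eq_natCast {A : Type*} [Monoid A] {M : ℕ} (B : ℕ) (ρ : ℕ → A →* ZMod M)
    (r : ZMod M) (v : A) (f : ℕ → ℕ) (i : ℕ)
    (hv : ∀ k (n : ℕ), (n : ZMod M) = r ^ 2 ^ (k + i) → ρ k v = f n) (as : List ℕ) :
    ∀ m (n : ℕ), (n : ZMod M) = r ^ 2 ^ (m + i) →
      weightedProd ρ (as.map (B * ·)) m v = (weightedProdMod M B f as n : ZMod M) := by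
  induction as with
  | nil => intro m n _; simp [weightedProd, weightedProdMod]
  | cons a as ih =>
    intro m n h
    have h2 : ((n ^ 2 % M : ℕ) : ZMod M) = r ^ 2 ^ (m + 1 + i) := by
      rw [ZMod.natCast_mod, Nat.cast_pow, h, ← pow_mul, add_right_comm, pow_succ]
    simp [weightedProd, weightedProdMod, ← ih _ _ h2, hv _ _ h, pow_mul]

theorem weightedProd_eq_one {A R : Type*} [Monoid A] [CommMonoid R] (ρ : ℕ → A →* R) (B : ℕ)
    (v : A) (hv : ∀ k, ρ k v ^ B = 1) (as : List ℕ) (m : ℕ) :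
    weightedProd ρ (as.map (B * ·)) m v = 1 := by
  induction as generalizing m with
  | nil => rfl
  | cons a as ih => simp [weightedProd, ih, pow_mul, hv]

theorem natCast_iterate_sq_mod (M r k : ℕ) :
    (((fun n ↦ n ^ 2 % M)^[k] r : ℕ) : ZMod M) = (r : ZMod M) ^ 2 ^ k := by
  induction k with
  | zero => simp
  | succ k ih => rw [Function.iterate_succ_apply', ZMod.natCast_mod, Nat.cast_pow, ih,
      ← pow_mul, pow_succ]

end WeightedProduct

theorem IsPrimitiveRoot.exists_ringHom_of_pow_add_pow_add_one_eq_zero {F : Type*} [Field F]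
    [NumberField F]
    [IsCyclotomicExtension {3 ^ 5} ℚ F] {ζ : F} (hζ : IsPrimitiveRoot ζ (3 ^ 5))
    {R : Type*} [CommRing R] (r : R) (hr : r ^ 162 + r ^ 81 + 1 = 0) :
    ∃ ρ : 𝓞 F →+* R, ρ hζ.toInteger = r := by
  have hmin : Polynomial.aeval r (minpoly ℤ hζ.integralPowerBasis.gen) = 0 := by
    rw [hζ.integralPowerBasis_gen]
    have h1 : minpoly ℤ hζ.toInteger = Polynomial.cyclotomic (3 ^ 5) ℤ := by
      rw [Polynomial.cyclotomic_eq_minpoly hζ (by norm_num),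
        ← minpoly.algebraMap_eq RingOfIntegers.coe_injective]
      rfl
    rw [h1, Polynomial.cyclotomic_prime_pow_eq_geom_sum Nat.prime_three]
    simp only [Finset.sum_range_succ, Finset.sum_range_zero, map_add, map_zero, map_pow,
      Polynomial.aeval_X]
    linear_combination hr
  refine ⟨(hζ.integralPowerBasis.lift r hmin : 𝓞 F →ₐ[ℤ] R), ?_⟩
  have := hζ.integralPowerBasis.lift_gen r hmin
  rwa [hζ.integralPowerBasis_gen] at this

/-- More than `rank K` units satisfy a nontrivial multiplicative relation modulo `p`-th powers and
torsion. -/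
theorem NumberField.Units.exists_prod_pow_eq_pow_mul_torsion (K : Type*) [Field K] [NumberField K]
    (p : ℕ) [Fact p.Prime] {ι : Type*} [Fintype ι] (hι : rank K < Fintype.card ι)
    (c : ι → (𝓞 K)ˣ) :
    ∃ n : ι → ℕ, (∃ i, ¬ p ∣ n i) ∧ ∃ w, ∃ t ∈ torsion K, ∏ i, c i ^ n i = w ^ p * t := by
  choose te hte _ using fun i ↦ exist_unique_eq_mul_prod K (c i)
  let v : ι → Fin (rank K) → ZMod p := fun i j ↦ ((te i).2 j : ZMod p)
  have hdep : ¬ LinearIndependent (ZMod p) v := fun h ↦ by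
    have := h.fintype_card_le_finrank
    simp at this
    omega
  obtain ⟨g, hg, i₀, hi₀⟩ := Fintype.not_linearIndependent_iff.mp hdep
  refine ⟨fun i ↦ (g i).val, ⟨i₀, fun h ↦ hi₀ ?_⟩, ?_⟩
  · rwa [← ZMod.natCast_eq_zero_iff, ZMod.natCast_zmod_val] at h
  · have hdvd : ∀ j, (p : ℤ) ∣ ∑ i, ((g i).val : ℤ) * (te i).2 j := fun j ↦ by
      rw [← ZMod.intCast_zmod_eq_zero_iff_dvd]
      have h := congrFun hg j
      simp only [Finset.sum_apply, Pi.smul_apply, smul_eq_mul, Pi.zero_apply, v] at h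
      simpa using h
    choose e he using hdvd
    refine ⟨∏ j, fundSystem K j ^ e j, ∏ i, ((te i).1 : (𝓞 K)ˣ) ^ (g i).val,
      prod_mem fun i _ ↦ pow_mem (te i).1.2 _, ?_⟩
    have h1 : ∀ i, c i ^ (g i).val = ((te i).1 : (𝓞 K)ˣ) ^ (g i).val *
        ∏ j, fundSystem K j ^ (((g i).val : ℤ) * (te i).2 j) := fun i ↦ by
      conv_lhs => rw [hte i, mul_pow, ← Finset.prod_pow]
      simp_rw [mul_comm ((g i).val : ℤ), zpow_mul, zpow_natCast]
    simp_rw [h1, Finset.prod_mul_distrib]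
    rw [Finset.prod_comm, mul_comm, ← Finset.prod_pow]
    congr 1
    refine Finset.prod_congr rfl fun j _ ↦ ?_
    rw [← zpow_natCast, ← zpow_mul, mul_comm (e j), ← he]
    exact (map_sum (zpowersHom _ (fundSystem K j)).toAdditiveRight _ _).symm

section CyclotomicUnits

variable {F : Type*} [Field F] [NumberField F] [IsCyclotomicExtension {3 ^ 5} ℚ F] {ζ : F}

theorem IsPrimitiveRoot.exists_ringHom_sq_pow (hζ : IsPrimitiveRoot ζ (3 ^ 5))
    {R : Type*} [CommRing R] (r : R) (hr : r ^ 162 + r ^ 81 + 1 = 0) :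
    ∃ ρ : ℕ → 𝓞 F →+* R, ∀ k, ρ k hζ.toInteger = r ^ 2 ^ k := by
  have h : ∀ k, (r ^ 2 ^ k) ^ 162 + (r ^ 2 ^ k) ^ 81 + 1 = 0 := fun k ↦ by
    induction k with
    | zero => simpa using hr
    | succ k ih =>
      rw [pow_succ 2 k, pow_mul]
      linear_combination ((r ^ 2 ^ k) ^ 162 - (r ^ 2 ^ k) ^ 81 + 1) * ih
  choose ρ hρ using fun k ↦ hζ.exists_ringHom_of_pow_add_pow_add_one_eq_zero _ (h k)
  exact ⟨ρ, hρ⟩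

theorem IsPrimitiveRoot.isUnit_one_add {R : Type*} [CommRing R] [IsDomain R] {η : R} {n : ℕ}
    (hη : IsPrimitiveRoot η n) (hn : Odd n) (h1 : n ≠ 1) : IsUnit (1 + η) := by
  obtain ⟨k, hk⟩ := hn
  refine IsUnit.of_mul_eq_one (∑ i ∈ Finset.range (k + 1), (η ^ 2) ^ i) ?_
  have hne : η - 1 ≠ 0 := hη.sub_one_ne_zero (by omega)
  apply mul_left_cancel₀ hne
  have := mul_neg_geom_sum (η ^ 2) (k + 1)
  rw [← pow_mul, show 2 * (k + 1) = n + 1 by omega, pow_succ η n, hη.pow_eq_one] at this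
  linear_combination -this

theorem pow_845743_add_pow_add_one :
    ((845743 : ℕ) : ZMod 1183411) ^ 162 + ((845743 : ℕ) : ZMod 1183411) ^ 81 + 1 = 0 := by
  decide +kernel

theorem natCast_525903_eq_mul : ((525903 : ℕ) : ZMod 1183411) = (1063361 : ℕ) * (1054991 : ℕ) := by
  decide +kernel

theorem natCast_1054991_pow : ((1054991 : ℕ) : ZMod 1183411) ^ 487 = 1 := by decide +kernel

theorem natCast_1054991_ne_one : ((1054991 : ℕ) : ZMod 1183411) ≠ 1 := by decide +kernel

/-- Exponents of the relation, given by powers of `431` modulo `487`, that makes the weighted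
product trivial on cyclotomic units modulo `487 ^ 2`. -/
def logExponents : List ℕ := (List.range 81).map (431 ^ · % 487)

/-- Exponents whose weighted products modulo `1183411` separate the units `1 + ζ ^ 2 ^ i`. -/
def dualExponents : List ℕ :=
  [261, 82, 236, 412, 393, 125, 93, 362, 450, 414, 80, 273, 303, 56, 254, 273, 421, 347, 338, 180,
    206, 365, 361, 123, 321, 56, 51, 221, 131, 296, 187, 259, 239, 456, 448, 3, 141, 247, 368, 129,
    38, 310, 259, 245, 222, 369, 273, 478, 69, 89, 83, 412, 172, 67, 429, 196, 318, 91, 133, 284,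
    348, 336, 101, 475, 345, 315, 393, 120, 397, 142, 207, 321, 122, 389, 181, 314, 428, 186, 31,
    433, 0]

theorem weightedProdMod_cyclotomicUnit : ∀ i < 80,
    weightedProdMod (487 ^ 2) 486 (1 + ·) logExponents
      ((fun n ↦ n ^ 2 % 487 ^ 2)^[i] 93995) = 1 := by
  decide +kernel

theorem weightedProdMod_dual : ∀ l < 161, 0 < l →
    weightedProdMod 1183411 2430 (1 + ·) dualExponents
      ((fun n ↦ n ^ 2 % 1183411)^[l] 845743) = if l = 81 then 525903 else 1063361 := by
  decide +kernel

omit [NumberField F] [IsCyclotomicExtension {3 ^ 5} ℚ F] in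
theorem IsPrimitiveRoot.exists_unit_one_add_sq_pow (hζ : IsPrimitiveRoot ζ (3 ^ 5)) :
    ∃ c : ℕ → (𝓞 F)ˣ, ∀ i, (c i : 𝓞 F) = 1 + hζ.toInteger ^ 2 ^ i := by
  have h : ∀ i, IsUnit (1 + hζ.toInteger ^ 2 ^ i) := fun i ↦
    (hζ.toInteger_isPrimitiveRoot.pow_of_coprime _
      (Nat.Coprime.pow_left _ (by norm_num))).isUnit_one_add (by decide) (by norm_num)
  choose c hc using h
  exact ⟨c, hc⟩

theorem rank_units_eq_eighty : Units.rank F = 80 := by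
  have h := IsCyclotomicExtension.Rat.nrComplexPlaces_eq_totient_div_two (3 ^ 5) F
  have h2 := IsCyclotomicExtension.Rat.nrRealPlaces_eq_zero (n := 3 ^ 5) F (by norm_num)
  rw [Units.rank, InfinitePlace.card_eq_nrRealPlaces_add_nrComplexPlaces, h, h2,
    Nat.totient_prime_pow Nat.prime_three (by norm_num)]
  norm_num

theorem pow_eq_one_of_mem_torsion {t : (𝓞 F)ˣ} (ht : t ∈ Units.torsion F) : t ^ 486 = 1 := by
  have h := IsCyclotomicExtension.Rat.torsionOrder_eq (n := 3 ^ 5) (K := F)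
  rw [if_neg (by decide)] at h
  have := congrArg Subtype.val (pow_card_eq_one' (x := (⟨t, ht⟩ : Units.torsion F)))
  rw [← Units.torsionOrder, h] at this
  exact this

theorem prod_weightedProd_pow_eq_one {M : ℕ} {B : ℕ} (hB : 486 ∣ B)
    (hM : ∀ x : (ZMod M)ˣ, x ^ (487 * B) = 1) (ρ : ℕ → 𝓞 F →+* ZMod M) (as : List ℕ) (m : ℕ)
    {ι : Type*} [Fintype ι] {v : ι → (𝓞 F)ˣ} {n : ι → ℕ} {w t : (𝓞 F)ˣ}
    (ht : t ∈ Units.torsion F) (hv : ∏ i, v i ^ n i = w ^ 487 * t) :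
    ∏ i, weightedProd (fun k ↦ (ρ k : 𝓞 F →* ZMod M)) (as.map (B * ·)) m (v i) ^ n i = 1 := by
  have h := weightedProd_eq_one (fun k ↦ (ρ k : 𝓞 F →* ZMod M)) B ((w ^ 487 * t : (𝓞 F)ˣ) : 𝓞 F)
    (fun k ↦ ?_) as m
  · rw [← h, ← hv, Units.coe_prod, map_prod]
    simp
  have h : Units.map (ρ k : 𝓞 F →* ZMod M) (w ^ 487 * t) ^ B = 1 := by
    obtain ⟨b, rfl⟩ := hB
    rw [map_mul, mul_pow, map_pow, ← pow_mul, hM, one_mul, ← map_pow, pow_mul,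
      pow_eq_one_of_mem_torsion ht, one_pow, map_one]
  exact congrArg Units.val h

omit [NumberField F] [IsCyclotomicExtension {3 ^ 5} ℚ F] in
theorem weightedProd_one_add_sq_pow {M B : ℕ} (hζ : IsPrimitiveRoot ζ (3 ^ 5)) (r : ℕ)
    (ρ : ℕ → 𝓞 F →+* ZMod M) (hρ : ∀ k, ρ k hζ.toInteger = (r : ZMod M) ^ 2 ^ k) (as : List ℕ)
    (m i : ℕ) :
    weightedProd (fun k ↦ (ρ k : 𝓞 F →* ZMod M)) (as.map (B * ·)) m (1 + hζ.toInteger ^ 2 ^ i) =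
      weightedProdMod M B (1 + ·) as ((fun n ↦ n ^ 2 % M)^[m + i] r) := by
  refine weightedProd_eq_natCast B _ r _ _ i (fun k n hn ↦ ?_) _ _ _ (natCast_iterate_sq_mod _ _ _)
  simp [hρ, hn, pow_add, pow_mul]

/-- In a multiplicative relation, modulo `487`-th powers and torsion, between the units
`1 + ζ ^ 2 ^ i` for `i < 80`, all exponents are divisible by `487`. -/
theorem dvd_exponent_of_prod_one_add_sq_pow (hζ : IsPrimitiveRoot ζ (3 ^ 5)) (n : Fin 80 → ℕ)
    {c : ℕ → (𝓞 F)ˣ} (hc : ∀ i, (c i : 𝓞 F) = 1 + hζ.toInteger ^ 2 ^ i) {w t : (𝓞 F)ˣ}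
    (ht : t ∈ Units.torsion F) (h : ∏ i : Fin 80, c i ^ n i = w ^ 487 * t) (i : Fin 80) :
    487 ∣ n i := by
  have hprime : Nat.Prime 1183411 := by norm_num
  have : Fact (Nat.Prime 1183411) := ⟨hprime⟩
  obtain ⟨ρ, hρ⟩ := hζ.exists_ringHom_sq_pow ((845743 : ℕ) : ZMod 1183411)
    pow_845743_add_pow_add_one
  have hΨ : ∀ m : ℕ, 0 < m → m ≤ 81 → ((1063361 : ℕ) : ZMod 1183411) ^ (∑ j, n j) *
      ∏ j : Fin 80, (if m + j = 81 then ((1054991 : ℕ) : ZMod 1183411) else 1) ^ n j = 1 := by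
    intro m hm0 hm
    have h1 := prod_weightedProd_pow_eq_one (B := 2430) (by norm_num)
      (fun x ↦ by
        rw [show 487 * 2430 = 1183411 - 1 by norm_num]
        exact ZMod.units_pow_card_sub_one_eq_one 1183411 x) ρ dualExponents m ht h
    refine Eq.trans ?_ h1
    rw [← Finset.prod_pow_eq_pow_sum, ← Finset.prod_mul_distrib]
    refine Finset.prod_congr rfl fun j _ ↦ ?_
    rw [hc, weightedProd_one_add_sq_pow hζ _ ρ hρ,
      weightedProdMod_dual _ (by omega) (by omega), ← mul_pow]
    split_ifs
    · rw [natCast_525903_eq_mul]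
    · rw [mul_one]
  have h1 := hΨ 1 one_pos (by norm_num)
  rw [Finset.prod_eq_one fun j _ ↦ by rw [if_neg (by omega), one_pow], mul_one] at h1
  have h2 := hΨ (81 - i) (by omega) (by omega)
  rw [h1, one_mul, Finset.prod_eq_single i (fun j _ hj ↦ by
    rw [if_neg (fun h ↦ hj (Fin.ext (by omega))), one_pow]) (by simp), if_pos (by omega)] at h2
  have : Fact (Nat.Prime 487) := ⟨by norm_num⟩
  rw [← orderOf_eq_prime natCast_1054991_pow natCast_1054991_ne_one]
  exact orderOf_dvd_of_pow_eq_one h2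

theorem weightedProd_logExponents_unit (hζ : IsPrimitiveRoot ζ (3 ^ 5))
    (ρ : ℕ → 𝓞 F →+* ZMod (487 ^ 2))
    (hρ : ∀ k, ρ k hζ.toInteger = ((93995 : ℕ) : ZMod (487 ^ 2)) ^ 2 ^ k) (u : (𝓞 F)ˣ) :
    weightedProd (fun k ↦ (ρ k : 𝓞 F →* ZMod (487 ^ 2))) (logExponents.map (486 * ·)) 0 u = 1 := by
  have hp : Nat.Prime 487 := by norm_num
  have : Fact (Nat.Prime 487) := ⟨hp⟩
  have htot (x : (ZMod (487 ^ 2))ˣ) : x ^ (487 * 486) = 1 := by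
    rw [show 487 * 486 = (487 ^ 2).totient by
      rw [Nat.totient_prime_pow hp (by norm_num)]; norm_num]
    exact ZMod.pow_totient x
  obtain ⟨c, hc⟩ := hζ.exists_unit_one_add_sq_pow
  obtain ⟨n, ⟨i₀, hi₀⟩, w, t, ht, h⟩ := Units.exists_prod_pow_eq_pow_mul_torsion F 487
    (ι := Option (Fin 80)) (by simp [rank_units_eq_eighty]) (fun i ↦ i.elim u (fun j ↦ c j))
  have h1 := prod_weightedProd_pow_eq_one dvd_rfl htot ρ logExponents 0 ht h
  rw [Fintype.prod_option] at h h1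
  simp only [Option.elim_none, Option.elim_some] at h h1
  have hnone : ¬ 487 ∣ n none := by
    rintro ⟨d, hd⟩
    have hall := dvd_exponent_of_prod_one_add_sq_pow hζ (fun j ↦ n (some j)) hc
      (w := w * (u ^ d)⁻¹) ht (by
        rw [mul_pow, mul_right_comm, ← h, hd]
        rw [inv_pow, ← pow_mul, mul_comm d]
        simp)
    rcases i₀ with _ | j
    · exact hi₀ ⟨d, hd⟩
    · exact hi₀ (hall j)
  rw [Finset.prod_eq_one, mul_one] at h1
  · have h2 := prod_weightedProd_pow_eq_one dvd_rfl htot ρ logExponents 0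
      (v := fun _ : Unit ↦ u) (n := fun _ ↦ 487) (w := u) (one_mem _) (by simp)
    rw [Fintype.prod_unique] at h2
    have h3 := Nat.dvd_gcd (orderOf_dvd_of_pow_eq_one h1) (orderOf_dvd_of_pow_eq_one h2)
    rw [((Nat.Prime.coprime_iff_not_dvd hp).mpr hnone).symm] at h3
    exact orderOf_eq_one_iff.mp (Nat.dvd_one.mp h3)
  · intro j _
    rw [hc, weightedProd_one_add_sq_pow hζ _ ρ hρ, zero_add,
      weightedProdMod_cyclotomicUnit _ j.2, Nat.cast_one, one_pow]

end CyclotomicUnits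

section ListPolynomial

/-- Value at `z` of the polynomial with a given list of coefficients, constant term first. -/
def listEval {R : Type*} [CommRing R] (z : R) : List ℤ → R
  | [] => 0
  | a :: as => a + z * listEval z as

/-- Addition of polynomials. -/
def listAdd : List ℤ → List ℤ → List ℤ
  | [], l => l
  | a :: as, [] => a :: as
  | a :: as, b :: bs => (a + b) :: listAdd as bs

/-- Multiplication by `X ^ n`. -/
def listShift (n : ℕ) (l : List ℤ) : List ℤ := List.replicate n 0 ++ l

variable {R : Type*} [CommRing R] (z : R)

theorem listEval_add (l l' : List ℤ) :
    listEval z (listAdd l l') = listEval z l + listEval z l' := by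
  induction l generalizing l' with
  | nil => simp [listAdd, listEval]
  | cons a as ih =>
    cases l' with
    | nil => simp [listAdd, listEval]
    | cons b bs => simp [listAdd, listEval, ih]; ring

theorem listEval_map_neg (l : List ℤ) : listEval z (l.map (- ·)) = -listEval z l := by
  induction l with
  | nil => simp [listEval]
  | cons a as ih => simp [listEval, ih]; ring

theorem listEval_shift (n : ℕ) (l : List ℤ) :
    listEval z (listShift n l) = z ^ n * listEval z l := by
  induction n with
  | zero => simp [listShift]
  | succ n ih =>
    rw [listShift, List.replicate_succ, List.cons_append, listEval, ← listShift, ih]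
    push_cast
    ring

theorem listEval_eq_zero_of_all {l : List ℤ} (h : l.all (· = 0)) : listEval z l = 0 := by
  induction l with
  | nil => rfl
  | cons a as ih => simp_all [listEval]

/-- Divisibility by `X ^ 162 + X ^ 81 + 1` of polynomials with quotient of degree below `243`; the
opposite of the quotient is found as a truncated power series. -/
def cyclotomicListDvd (l : List ℤ) : Bool :=
  let c := (listAdd (l.map (- ·)) (listShift 81 l)).take 243
  (listAdd l (listAdd c (listAdd (listShift 81 c) (listShift 162 c)))).all (· = 0)

theorem listEval_eq_zero_of_cyclotomicListDvd (hz : z ^ 162 + z ^ 81 + 1 = 0) {l : List ℤ}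
    (h : cyclotomicListDvd l) : listEval z l = 0 := by
  have h1 := listEval_eq_zero_of_all z h
  simp only [listEval_add, listEval_shift] at h1
  linear_combination h1 - hz *
    listEval z ((listAdd (l.map (- ·)) (listShift 81 l)).take 243)

end ListPolynomial

section SpecialElement

/-- The polynomial of degree less than `162` that represents
`a₀ + ∑ aᵢ (ζ ^ i + ζ ^ (-i))` for a root `ζ` of `X ^ 162 + X ^ 81 + 1`. -/
def realElementList (a₀ : ℤ) (t : List ℤ) : List ℤ :=
  a₀ :: List.zipWith (· - ·) t t.reverse ++ 0 :: t.reverse.map (- ·)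

/-- The element `-1 + (z + z⁻¹) + (z ^ 63 + z ^ (-63)) + (z ^ 65 + z ^ (-65))` for `z` of order
`243`, of norm `± 6206456197` from the maximal real subfield. -/
def primeElement {R : Type*} [CommRing R] (z : R) : R :=
  -1 + z + z ^ 242 + z ^ 63 + z ^ 180 + z ^ 65 + z ^ 178

/-- Multiplication by `primeElement`. -/
def primeElementMul (l : List ℤ) : List ℤ :=
  listAdd (l.map (- ·)) <| listAdd (listShift 1 l) <| listAdd (listShift 242 l) <|
    listAdd (listShift 63 l) <| listAdd (listShift 180 l) <|
    listAdd (listShift 65 l) (listShift 178 l)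

theorem listEval_primeElementMul {R : Type*} [CommRing R] (z : R) (l : List ℤ) :
    listEval z (primeElementMul l) = primeElement z * listEval z l := by
  simp only [primeElementMul, primeElement, listEval_add, listEval_map_neg, listEval_shift]
  ring

/-- The quotient of `6206456197` by `primeElement`. -/
def normCofactor : List ℤ :=
  realElementList (-3269388790)
    [5804590486, -4740242662, 1559596928, -2896461589, 1564834366, 2074487194, -4770019034,
    6926535488, -5093298640, 4728646398, -3161818643, -1636575780, 4785526246, -2099402936,
    6197377900, -7501958044, 2762092173, -3326338267, 2336902098, 3500740918, -5026986021,
    7271741752, -7142833758, 6016518940, -2650662931, -917331278, 5537429770, -5076420474,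
    6979119644, -8451388441, 3804421382, -2439487439, 1057172151, 5463727330, -6137779473,
    6721064552, -8602273679, 5772010233, -1536749983, -1073127713, 6573371467, -9325509004,
    7605759473, -6865481249, 3320439913, 1066950221, -2557721523, 7442830941, -7882725749,
    6438478795, -8332756973, 3119065093, 1505977786, -1852241189, 5858791571, -10279074671,
    6174184545, -3321157611, 3742300245, 2623001660, -4635251441, 5113825695, -5576140753,
    6507715932, -3742196761, 783958650, 2023561530, -2014568749, 3620979453, -7070286318,
    5030468311, -2894019805, 4825596397, 1163621978, -5200353825, 3832214271, -4760959286,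
    5915287829, -2996740954, 863734848]

/-- The quotient by `primeElement` of the difference between `ζ + ζ⁻¹` and its integer residue. -/
def residueCofactor : List ℤ :=
  realElementList (-77654068)
    [137869828, -112589586, 37043329, -68796354, 37167729, 49272932, -113296830, 164518110,
    -120975322, 112314153, -75099078, -38871721, 113665156, -49864726, 147199260, -178185467,
    65604829, -79006725, 55505775, 83149113, -119400274, 172717401, -169655596, 142903523,
    -62958178, -21788325, 131524264, -120574434, 165767081, -200736206, 90362088, -57942367,
    25109807, 129773694, -145783686, 159637792, -204320011, 137095986, -36500672, -25488780,
    156129807, -221498196, 180650943, -163067958, 78866628, 25342054, -60750646, 176781088,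
    -187229408, 152925854, -197918488, 74083601, 35769776, -43994175, 139157204, -244147156,
    146648374, -78883674, 88886597, 62301172, -110095849, 121462878, -132443721, 154570366,
    -88884138, 18620477, 48063353, -47849757, 86005001, -167932460, 119482985, -68738356,
    114616897, 27638188, -123518083, 91022221, -113081644, 140499096, -71178175, 20515310]

variable {R : Type*} [CommRing R] (z : R)

theorem primeElement_dvd_norm (hz : z ^ 162 + z ^ 81 + 1 = 0) :
    primeElement z ∣ (6206456197 : R) := by
  have h := listEval_eq_zero_of_cyclotomicListDvd z hz
    (l := listAdd (primeElementMul normCofactor) [-6206456197]) (by decide +kernel)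
  rw [listEval_add, listEval_primeElementMul] at h
  refine ⟨listEval z normCofactor, ?_⟩
  simp only [listEval, Int.cast_neg, Int.cast_ofNat, mul_zero, add_zero] at h
  linear_combination -h

theorem primeElement_dvd_add_sub (hz : z ^ 162 + z ^ 81 + 1 = 0) :
    primeElement z ∣ z + z ^ 242 - ((-147414888 : ℤ) : R) := by
  have h := listEval_eq_zero_of_cyclotomicListDvd z hz
    (l := listAdd (primeElementMul residueCofactor)
      (listAdd [-147414888, -1] (listShift 242 [-1]))) (by decide +kernel)
  rw [listEval_add, listEval_primeElementMul] at h
  refine ⟨listEval z residueCofactor, ?_⟩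
  simp only [listEval, listEval_add, listEval_shift, mul_zero, add_zero] at h
  push_cast at h ⊢
  linear_combination -h

end SpecialElement

theorem prime_6206456197 : Nat.Prime 6206456197 := by
  refine lucas_primality _ 2 (by norm_num only; reduce_mod_char) fun r hr hdvd ↦ ?_
  have h : r = 139 ∨ r = 71 ∨ r = 3 ∨ r = 2 ∨ r = 647 := by
    have h := (Nat.mem_primeFactors_of_ne_zero (by norm_num)).mpr ⟨hr, hdvd⟩
    rw [show 6206456197 - 1 = 2 ^ 2 * (3 ^ 5 * (71 * (139 * 647))) by norm_num,
      Nat.primeFactors_mul (by norm_num) (by norm_num),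
      Nat.primeFactors_mul (by norm_num) (by norm_num),
      Nat.primeFactors_mul (by norm_num) (by norm_num),
      Nat.primeFactors_mul (by norm_num) (by norm_num),
      Nat.primeFactors_prime_pow (by norm_num) (by norm_num),
      Nat.primeFactors_prime_pow (by norm_num) (by norm_num),
      Nat.Prime.primeFactors (by norm_num), Nat.Prime.primeFactors (by norm_num),
      Nat.Prime.primeFactors (by norm_num)] at h
    simpa using h
  rcases h with rfl | rfl | rfl | rfl | rfl
  all_goals
    norm_num only
    reduce_mod_char
    decide +kernel

section RealSubfield

variable {K F : Type*} [Field K] [NumberField K] [Field F] [NumberField F] [Algebra K F]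
  [IsCyclotomicExtension {3 ^ 5} ℚ F] {ζ : F}

theorem IsPrimitiveRoot.exists_algEquiv_apply_eq_inv (hζ : IsPrimitiveRoot ζ (3 ^ 5))
    (hKF : Module.finrank K F = 2) :
    ∃ τ : Gal(F/K), τ ζ = ζ ^ 242 ∧ ∀ g : Gal(F/K), g = 1 ∨ g = τ := by
  have : IsGalois ℚ F := IsCyclotomicExtension.isGalois {3 ^ 5} ℚ F
  have : IsGalois K F := IsGalois.tower_top_of_isGalois ℚ K F
  have hcard : Nat.card Gal(F/K) = 2 := by rw [IsGalois.card_aut_eq_finrank, hKF]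
  obtain ⟨τ, hτ⟩ : ∃ τ : Gal(F/K), τ ≠ 1 := by
    by_contra! h
    have : Subsingleton Gal(F/K) := ⟨fun a b ↦ by rw [h a, h b]⟩
    rw [Nat.card_of_subsingleton 1] at hcard
    omega
  have hall : ∀ g : Gal(F/K), g = 1 ∨ g = τ := by
    have h2 := (Nat.card_eq_two_iff' (1 : Gal(F/K))).mp hcard
    intro g
    by_contra! hg
    exact hg.2 (h2.unique hg.1 hτ)
  have hττ : τ * τ = 1 := (hall _).resolve_right (by simpa using hτ)
  obtain ⟨a, ha, hτa⟩ := hζ.eq_pow_of_pow_eq_one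
    (show τ ζ ^ (3 ^ 5) = 1 by rw [← map_pow, hζ.pow_eq_one, map_one])
  have haa : ζ ^ (a * a) = ζ ^ 1 := by
    have := DFunLike.congr_fun hττ ζ
    rw [AlgEquiv.mul_apply, ← hτa, map_pow, ← hτa, ← pow_mul] at this
    simpa using this
  rw [← pow_mod_orderOf, ← hζ.eq_orderOf] at haa
  replace haa := hζ.pow_inj (Nat.mod_lt _ (by norm_num)) (by norm_num) haa
  have key : ∀ a < 3 ^ 5, a * a % 3 ^ 5 = 1 → a = 1 ∨ a = 242 := by decide +kernel
  refine ⟨τ, ?_, hall⟩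
  rcases key a ha haa with rfl | rfl
  · refine absurd ?_ hτ
    have := IsCyclotomicExtension.algEquiv_eq_of_apply_eq {3 ^ 5} ℚ F
      (f := τ.restrictScalars ℚ) (g := AlgEquiv.refl) (by
        rintro n rfl -
        exact ⟨ζ, hζ, by simpa using hτa.symm⟩)
    exact AlgEquiv.ext fun x ↦ DFunLike.congr_fun this x
  · exact hτa.symm

omit [NumberField F] [IsCyclotomicExtension {3 ^ 5} ℚ F] in
theorem IsPrimitiveRoot.toInteger_pow_add_pow_add_one (hζ : IsPrimitiveRoot ζ (3 ^ 5)) :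
    hζ.toInteger ^ 162 + hζ.toInteger ^ 81 + 1 = 0 := by
  have h := (hζ.toInteger_isPrimitiveRoot.pow_of_dvd (p := 81) (by norm_num)
    (by norm_num)).geom_sum_eq_zero (by norm_num)
  rw [show 3 ^ 5 / 81 = 3 by norm_num, Finset.sum_range_succ, Finset.sum_range_succ,
    Finset.sum_range_one] at h
  linear_combination h

omit [NumberField K] [NumberField F] [IsCyclotomicExtension {3 ^ 5} ℚ F] in
theorem IsPrimitiveRoot.mapRingHom_toInteger (hζ : IsPrimitiveRoot ζ (3 ^ 5)) {τ : Gal(F/K)}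
    (hτ : τ ζ = ζ ^ 242) :
    RingOfIntegers.mapRingHom (τ : F →+* F) hζ.toInteger = hζ.toInteger ^ 242 := by
  ext
  exact hτ.trans (map_pow (algebraMap (𝓞 F) F) hζ.toInteger 242).symm

theorem primeElement_pow_242 {R : Type*} [CommRing R] {z : R} (hz : z ^ 162 + z ^ 81 + 1 = 0) :
    primeElement (z ^ 242) = primeElement z := by
  have h : z ^ 243 = 1 := by linear_combination (z ^ 81 - 1) * hz
  have h' (a b c : ℕ) (hab : a = 243 * c + b := by norm_num) : z ^ a = z ^ b := by
    rw [hab, pow_add, pow_mul, h, one_pow, one_mul]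
  simp only [primeElement, ← pow_mul]
  rw [h' (242 * 242) 1 241, h' (242 * 63) 180 62, h' (242 * 180) 63 179, h' (242 * 65) 178 64,
    h' (242 * 178) 65 177]
  ring

theorem IsPrimitiveRoot.exists_algebraMap_eq_primeElement (hζ : IsPrimitiveRoot ζ (3 ^ 5))
    (hKF : Module.finrank K F = 2) :
    ∃ x : 𝓞 K, algebraMap (𝓞 K) (𝓞 F) x = primeElement hζ.toInteger := by
  have : IsGalois ℚ F := IsCyclotomicExtension.isGalois {3 ^ 5} ℚ F
  have : IsGalois K F := IsGalois.tower_top_of_isGalois ℚ K F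
  obtain ⟨τ, hτ, hall⟩ := hζ.exists_algEquiv_apply_eq_inv hKF
  have hfix : RingOfIntegers.mapRingHom (τ : F →+* F) (primeElement hζ.toInteger) =
      primeElement hζ.toInteger := by
    nth_rw 2 [← primeElement_pow_242 hζ.toInteger_pow_add_pow_add_one]
    rw [← hζ.mapRingHom_toInteger hτ]
    simp [primeElement]
  obtain ⟨x, hx⟩ := (IsGalois.mem_range_algebraMap_iff_fixed (F := K)
    (algebraMap (𝓞 F) F (primeElement hζ.toInteger))).mpr fun g ↦ by
      rcases hall g with rfl | rfl
      · rfl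
      · exact congrArg (algebraMap (𝓞 F) F) hfix
  have hint : IsIntegral ℤ x := by
    rw [← isIntegral_algebraMap_iff (algebraMap K F).injective, hx]
    exact RingOfIntegers.isIntegral_coe _
  refine ⟨⟨x, hint⟩, ?_⟩
  ext
  exact hx

/-- Modulo the prime element, the trace from `ℚ(ζ)` to its real subfield of every algebraic integer
is a rational integer. -/
theorem IsPrimitiveRoot.exists_int_primeElement_dvd_add_sub (hζ : IsPrimitiveRoot ζ (3 ^ 5))
    {τ : 𝓞 F →+* 𝓞 F} (hτ : τ hζ.toInteger = hζ.toInteger ^ 242) (y : 𝓞 F) :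
    ∃ a : ℤ, primeElement hζ.toInteger ∣ y + τ y - a := by
  have hz := hζ.toInteger_pow_add_pow_add_one
  have h1 : hζ.toInteger * hζ.toInteger ^ 242 = 1 := by
    linear_combination (hζ.toInteger ^ 81 - 1) * hz
  have hpow : ∀ j : ℕ, ∃ a : ℤ, primeElement hζ.toInteger ∣
      hζ.toInteger ^ j + (hζ.toInteger ^ 242) ^ j - a := by
    intro j
    induction j using Nat.twoStepInduction with
    | zero => exact ⟨2, by simp [one_add_one_eq_two]⟩
    | one => exact ⟨-147414888, by simpa using primeElement_dvd_add_sub _ hz⟩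
    | more j ih ih' =>
      obtain ⟨a, c, ha⟩ := ih
      obtain ⟨b, d, hb⟩ := ih'
      obtain ⟨e, he⟩ := primeElement_dvd_add_sub _ hz
      refine ⟨-147414888 * b - a, e * (hζ.toInteger ^ (j + 1) + (hζ.toInteger ^ 242) ^ (j + 1))
        + ((-147414888 : ℤ) : 𝓞 F) * d - c, ?_⟩
      set w := hζ.toInteger ^ 242
      push_cast at he ⊢
      linear_combination (hζ.toInteger ^ (j + 1) + w ^ (j + 1)) * he - 147414888 * hb - ha -
        (hζ.toInteger ^ j + w ^ j) * h1
  obtain ⟨f, rfl⟩ := hζ.integralPowerBasis.exists_eq_aeval' y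
  rw [hζ.integralPowerBasis_gen]
  induction f using Polynomial.induction_on' with
  | add p q hp hq =>
    obtain ⟨a, c, ha⟩ := hp
    obtain ⟨b, d, hb⟩ := hq
    refine ⟨a + b, c + d, ?_⟩
    rw [map_add, map_add]
    push_cast
    linear_combination ha + hb
  | monomial n m =>
    obtain ⟨a, c, ha⟩ := hpow n
    refine ⟨m * a, m * c, ?_⟩
    rw [Polynomial.aeval_monomial, map_mul, map_pow, hτ]
    simp only [algebraMap_int_eq, eq_intCast, map_intCast]
    push_cast
    linear_combination (m : 𝓞 F) * ha

/-- A proper ideal containing the prime element contracts to an ideal of the real subfield that is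
generated by the prime element. -/
theorem IsPrimitiveRoot.map_comap_eq_span_primeElement (hζ : IsPrimitiveRoot ζ (3 ^ 5))
    (hKF : Module.finrank K F = 2) {I : Ideal (𝓞 F)} (hI : I ≠ ⊤)
    (hx : primeElement hζ.toInteger ∈ I) :
    (I.comap (algebraMap (𝓞 K) (𝓞 F))).map (algebraMap (𝓞 K) (𝓞 F)) =
      Ideal.span {primeElement hζ.toInteger} := by
  obtain ⟨x, hxx⟩ := hζ.exists_algebraMap_eq_primeElement hKF
  obtain ⟨τ, hτ, -⟩ := hζ.exists_algEquiv_apply_eq_inv hKF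
  have hq : (6206456197 : 𝓞 F) ∈ I :=
    I.mem_of_dvd (primeElement_dvd_norm _ hζ.toInteger_pow_add_pow_add_one) hx
  apply le_antisymm
  · rw [Ideal.map_le_iff_le_comap]
    intro y hy
    rw [Ideal.mem_comap] at hy
    rw [Ideal.mem_comap, Ideal.mem_span_singleton]
    obtain ⟨a, ha⟩ := hζ.exists_int_primeElement_dvd_add_sub (hζ.mapRingHom_toInteger hτ)
      (algebraMap (𝓞 K) (𝓞 F) y)
    have hty : RingOfIntegers.mapRingHom (τ : F →+* F) (algebraMap (𝓞 K) (𝓞 F) y) =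
        algebraMap (𝓞 K) (𝓞 F) y := by
      ext
      exact τ.commutes (y : K)
    rw [hty] at ha
    set Y := algebraMap (𝓞 K) (𝓞 F) y
    have haI : (a : 𝓞 F) ∈ I := by
      have := I.sub_mem (I.add_mem hy hy) (I.mem_of_dvd ha hx)
      rwa [sub_sub_cancel] at this
    have hprime : Prime (6206456197 : ℤ) := by
      rw [Int.prime_iff_natAbs_prime]
      exact prime_6206456197
    have hqa : (6206456197 : ℤ) ∣ a := by
      by_contra hn
      obtain ⟨u, v, huv⟩ := (hprime.coprime_iff_not_dvd).mpr hn
      refine hI (I.eq_top_iff_one.mpr ?_)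
      have := congrArg (Int.cast : ℤ → 𝓞 F) huv
      push_cast at this
      rw [← this]
      exact I.add_mem (I.mul_mem_left _ hq) (I.mul_mem_left _ haI)
    obtain ⟨b, rfl⟩ := hqa
    have hdq := primeElement_dvd_norm _ hζ.toInteger_pow_add_pow_add_one
    have h2 : primeElement hζ.toInteger ∣ Y + Y := by
      have := dvd_add ha (hdq.mul_right (b : 𝓞 F))
      push_cast at this
      rwa [sub_add_cancel] at this
    have := dvd_sub (hdq.mul_right Y) (h2.mul_left 3103228098)
    ring_nf at this
    exact this
  · rw [Ideal.span_singleton_le_iff_mem, ← hxx]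
    exact Ideal.mem_map_of_mem _ (by rwa [Ideal.mem_comap, hxx])

end RealSubfield

section ResidueField

variable {L Ω : Type*} [Field L] [NumberField L] [Field Ω] [NumberField Ω] [Algebra L Ω]

omit [NumberField L] in
/-- If the Frobenius automorphism `η ↦ η ^ q` of a cyclotomic field is trivial on `L`, then the
residue fields of `L` at the primes above `q` are prime fields. -/
theorem IsPrimitiveRoot.exists_int_sub_mem_comap {N q : ℕ} [NeZero N] [Fact q.Prime]
    [IsCyclotomicExtension {N} ℚ Ω] {η : Ω} (hη : IsPrimitiveRoot η N) {σ : Gal(Ω/L)}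
    (hσ : σ η = η ^ q) {I : Ideal (𝓞 Ω)} [I.IsMaximal] (hq : (q : 𝓞 Ω) ∈ I) (y : 𝓞 L) :
    ∃ n : ℤ, y - n ∈ I.comap (algebraMap (𝓞 L) (𝓞 Ω)) := by
  let _ := Ideal.Quotient.field I
  have hchar : CharP (𝓞 Ω ⧸ I) q := by
    refine (CharP.charP_iff_prime_eq_zero Fact.out).mpr ?_
    rw [← map_natCast (Ideal.Quotient.mk I), Ideal.Quotient.eq_zero_iff_mem]
    exact hq
  let φ : 𝓞 Ω →ₐ[ℤ] 𝓞 Ω ⧸ I := ((frobenius _ q).comp (Ideal.Quotient.mk I)).toIntAlgHom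
  let ψ : 𝓞 Ω →ₐ[ℤ] 𝓞 Ω ⧸ I :=
    ((Ideal.Quotient.mk I).comp (RingOfIntegers.mapRingHom (σ : Ω →+* Ω))).toIntAlgHom
  have hσ' : RingOfIntegers.mapRingHom (σ : Ω →+* Ω) hη.toInteger = hη.toInteger ^ q := by
    ext
    exact hσ.trans (map_pow (algebraMap (𝓞 Ω) Ω) hη.toInteger q).symm
  have hφψ : φ = ψ := by
    apply hη.integralPowerBasis.algHom_ext
    rw [hη.integralPowerBasis_gen]
    change Ideal.Quotient.mk I hη.toInteger ^ q = Ideal.Quotient.mk I _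
    rw [hσ', map_pow]
  have hy : RingOfIntegers.mapRingHom (σ : Ω →+* Ω) (algebraMap (𝓞 L) (𝓞 Ω) y) =
      algebraMap (𝓞 L) (𝓞 Ω) y := by
    ext
    exact σ.commutes (y : L)
  have h1 : Ideal.Quotient.mk I (algebraMap (𝓞 L) (𝓞 Ω) y) ^ q =
      Ideal.Quotient.mk I (algebraMap (𝓞 L) (𝓞 Ω) y) := by
    have := DFunLike.congr_fun hφψ (algebraMap (𝓞 L) (𝓞 Ω) y)
    change Ideal.Quotient.mk I _ ^ q = Ideal.Quotient.mk I _ at this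
    rwa [hy] at this
  rw [← Subfield.mem_bot_iff_pow_eq_self (𝓞 Ω ⧸ I) q, ← ZMod.fieldRange_castHom_eq_bot q] at h1
  obtain ⟨c, hc⟩ := h1
  obtain ⟨n, rfl⟩ := ZMod.intCast_surjective c
  refine ⟨n, ?_⟩
  rw [Ideal.mem_comap, map_sub, map_intCast, ← Ideal.Quotient.mk_eq_mk_iff_sub_mem, ← hc]
  simp

theorem Ideal.relNorm_eq_comap_of_exists_int {K L : Type*} [Field K] [NumberField K] [Field L]
    [NumberField L] [Algebra K L] (Q : Ideal (𝓞 L)) [Q.IsMaximal]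
    (hQ : ∀ y : 𝓞 L, ∃ n : ℤ, y - n ∈ Q) :
    Ideal.relNorm (𝓞 K) Q = Q.comap (algebraMap (𝓞 K) (𝓞 L)) := by
  have : Q.LiesOver (Q.comap (algebraMap (𝓞 K) (𝓞 L))) := ⟨rfl⟩
  have : (Q.comap (algebraMap (𝓞 K) (𝓞 L))).IsMaximal :=
    Ideal.isMaximal_comap_of_isIntegral_of_isMaximal Q
  rw [Ideal.relNorm_eq_pow_of_isMaximal Q (Q.comap (algebraMap (𝓞 K) (𝓞 L))),
    Ideal.inertiaDeg_eq_of_isMaximal (Q.comap (algebraMap (𝓞 K) (𝓞 L))) Q,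
    finrank_eq_one (1 : 𝓞 L ⧸ Q) one_ne_zero, pow_one]
  intro w
  obtain ⟨y, rfl⟩ := Ideal.Quotient.mk_surjective w
  obtain ⟨n, hn⟩ := hQ y
  refine ⟨(n : _), ?_⟩
  rw [← Ideal.Quotient.mk_eq_mk_iff_sub_mem] at hn
  rw [hn, Algebra.smul_def, mul_one, map_intCast, map_intCast]

end ResidueField

/-- The value of `primeElement` at a natural number, modulo `487 ^ 2`. -/
def primeElementMod (n : ℕ) : ℕ :=
  (487 ^ 2 - 1 + n + n ^ 242 + n ^ 63 + n ^ 180 + n ^ 65 + n ^ 178) % 487 ^ 2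

theorem natCast_primeElementMod (n : ℕ) :
    (primeElementMod n : ZMod (487 ^ 2)) = primeElement (n : ZMod (487 ^ 2)) := by
  have hneg : ((487 ^ 2 - 1 : ℕ) : ZMod (487 ^ 2)) = -1 := by decide +kernel
  rw [primeElementMod, ZMod.natCast_mod, primeElement, ← hneg]
  simp only [Nat.cast_add, Nat.cast_pow]

theorem weightedProdMod_primeElementMod :
    weightedProdMod (487 ^ 2) 486 primeElementMod logExponents 93995 = 3897 := by
  decide +kernel

theorem weightedProd_logExponents_primeElement {F : Type*} [Field F] {ζ : F}
    (hζ : IsPrimitiveRoot ζ (3 ^ 5)) (ρ : ℕ → 𝓞 F →+* ZMod (487 ^ 2))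
    (hρ : ∀ k, ρ k hζ.toInteger = ((93995 : ℕ) : ZMod (487 ^ 2)) ^ 2 ^ k) :
    weightedProd (fun k ↦ (ρ k : 𝓞 F →* ZMod (487 ^ 2))) (logExponents.map (486 * ·)) 0
      (primeElement hζ.toInteger) = ((3897 : ℕ) : ZMod (487 ^ 2)) := by
  refine (weightedProd_eq_natCast 486 (fun k ↦ (ρ k : 𝓞 F →* ZMod (487 ^ 2)))
    ((93995 : ℕ) : ZMod (487 ^ 2)) _ primeElementMod 0 (fun k n hn ↦ ?_) logExponents 0 93995
    ?_).trans (congrArg Nat.cast weightedProdMod_primeElementMod)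
  · rw [add_zero, ← hρ] at hn
    rw [natCast_primeElementMod, hn]
    simp only [MonoidHom.coe_coe, primeElement, map_add, map_neg, map_one, map_pow]
  · rw [add_zero, pow_zero, pow_one]

section NormRelation

variable {K F L Ω : Type*} [Field K] [NumberField K] [Field F] [NumberField F] [Field L]
  [NumberField L] [Field Ω] [NumberField Ω] [Algebra K F] [Algebra K L] [Algebra F Ω] [Algebra L Ω]
  [Algebra K Ω] [IsScalarTower K F Ω] [IsScalarTower K L Ω]

omit [NumberField F] in
theorem Ideal.exists_intNorm_eq_unit_mul_pow {x : 𝓞 F} (Q : Ideal (𝓞 L)) (hQ : Q ≠ ⊥)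
    (hx : (Ideal.relNorm (𝓞 K) Q).map (algebraMap (𝓞 K) (𝓞 F)) = Ideal.span {x}) :
    ∃ (y : 𝓞 L) (u : (𝓞 F)ˣ), algebraMap (𝓞 K) (𝓞 F) (Algebra.intNorm (𝓞 K) (𝓞 L) y) =
      u * x ^ Nat.card (ClassGroup (𝓞 L)) := by
  have h1 : ClassGroup.mk0 ⟨Q ^ Nat.card (ClassGroup (𝓞 L)),
      mem_nonZeroDivisors_of_ne_zero (pow_ne_zero _ hQ)⟩ = 1 := by
    rw [show (⟨Q ^ Nat.card (ClassGroup (𝓞 L)), mem_nonZeroDivisors_of_ne_zero (pow_ne_zero _ hQ)⟩ :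
      nonZeroDivisors (Ideal (𝓞 L))) = ⟨Q, mem_nonZeroDivisors_of_ne_zero hQ⟩ ^
        Nat.card (ClassGroup (𝓞 L)) from rfl, map_pow, pow_card_eq_one']
  rw [ClassGroup.mk0_eq_one_iff] at h1
  obtain ⟨y, hy⟩ := h1
  have h2 := congrArg (Ideal.relNorm (𝓞 K)) hy
  rw [map_pow, Ideal.submodule_span_eq, Ideal.relNorm_singleton] at h2
  have h3 := congrArg (Ideal.map (algebraMap (𝓞 K) (𝓞 F))) h2
  rw [Ideal.map_pow, hx, Ideal.span_singleton_pow, Ideal.map_span, Set.image_singleton,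
    Ideal.span_singleton_eq_span_singleton] at h3
  obtain ⟨u, hu⟩ := h3
  exact ⟨y, u, by rw [← hu, mul_comm]⟩

theorem IsPrimitiveRoot.map_intNorm_pow_eq_one {p k : ℕ} [Fact p.Prime] [NeZero (p ^ k)]
    (hk : k ≠ 0) [IsCyclotomicExtension {p ^ k} F Ω]
    (hirr : Irreducible (Polynomial.cyclotomic (p ^ k) F)) {ξ : Ω} (hξ : IsPrimitiveRoot ξ (p ^ k))
    (hadj : ∀ y : 𝓞 Ω, (y : Ω) ∈ Algebra.adjoin (𝓞 F) {ξ})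
    {τ : Gal(F/K)} (hτ : ∀ g : Gal(F/K), g = 1 ∨ g = τ) (hτ1 : τ ≠ 1) [IsGalois K F] (y : 𝓞 L)
    (ρ : 𝓞 F →+* ZMod (p ^ k))
    (hρ : IsUnit (ρ (algebraMap (𝓞 K) (𝓞 F) (Algebra.intNorm (𝓞 K) (𝓞 L) y)))) :
    ρ (algebraMap (𝓞 K) (𝓞 F) (Algebra.intNorm (𝓞 K) (𝓞 L) y)) ^ (2 * Module.finrank L Ω) = 1 := by
  classical
  set n := Algebra.intNorm (𝓞 K) (𝓞 L) y with hn
  set w := Algebra.intNorm (𝓞 F) (𝓞 Ω) (algebraMap (𝓞 L) (𝓞 Ω) y) with hw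
  have hw' : algebraMap (𝓞 F) F w = Algebra.norm F (algebraMap L Ω y) := by
    rw [hw, Algebra.algebraMap_intNorm (L := Ω)]
    rfl
  have hprod : w * RingOfIntegers.mapRingHom (τ : F →+* F) w =
      algebraMap (𝓞 K) (𝓞 F) n ^ Module.finrank L Ω := by
    have h1 : Algebra.norm K (algebraMap L Ω y) = algebraMap (𝓞 K) K n ^ Module.finrank L Ω := by
      rw [← Algebra.norm_norm (S := L), Algebra.norm_algebraMap, map_pow, hn,
        Algebra.algebraMap_intNorm (L := L)]
    have h2 : algebraMap K F (Algebra.norm K (algebraMap L Ω y)) =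
        algebraMap (𝓞 F) F w * τ (algebraMap (𝓞 F) F w) := by
      rw [← Algebra.norm_norm (S := F), Algebra.norm_eq_prod_automorphisms, ← hw']
      rw [show (Finset.univ : Finset Gal(F/K)) = {1, τ} by ext g; simpa using hτ g,
        Finset.prod_pair hτ1.symm]
      rfl
    ext
    rw [h1] at h2
    simp only [map_mul, map_pow] at h2 ⊢
    exact h2.symm
  have hunit : IsUnit (ρ w * ρ (RingOfIntegers.mapRingHom (τ : F →+* F) w)) := by
    rw [← map_mul, hprod, map_pow]
    exact hρ.pow _
  have h1 := map_sq_eq_one_of_eq_norm hk (RingOfIntegers.coe_injective) hirr hξ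
    (hadj (algebraMap (𝓞 L) (𝓞 Ω) y)) hw' ρ (isUnit_of_mul_isUnit_left hunit)
  have h2 := map_sq_eq_one_of_eq_norm hk (RingOfIntegers.coe_injective) hirr hξ
    (hadj (algebraMap (𝓞 L) (𝓞 Ω) y)) hw' (ρ.comp (RingOfIntegers.mapRingHom (τ : F →+* F)))
    (isUnit_of_mul_isUnit_right hunit)
  rw [mul_comm, pow_mul, ← map_pow, ← hprod, map_mul, mul_pow, h1, one_mul]
  exact h2

end NormRelation

section CoprimeCyclotomic

variable {F Ω : Type*} [Field F] [NumberField F] [Field Ω] [NumberField Ω] [Algebra F Ω]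
  {a b : ℕ} [NeZero a] [NeZero b] [IsCyclotomicExtension {a} ℚ F]
  [IsCyclotomicExtension {a * b} ℚ Ω] {ζ : F} {ξ : Ω}

theorem IsPrimitiveRoot.algebraMap_mul_of_coprime {F Ω : Type*} [Field F] [Field Ω] [Algebra F Ω]
    {a b : ℕ} {ζ : F} {ξ : Ω} (hζ : IsPrimitiveRoot ζ a) (hξ : IsPrimitiveRoot ξ b)
    (hab : a.Coprime b) : IsPrimitiveRoot (algebraMap F Ω ζ * ξ) (a * b) := by
  have hζ' := hζ.map_of_injective (algebraMap F Ω).injective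
  rw [hζ'.eq_orderOf, hξ.eq_orderOf, ← (Commute.all _ _).orderOf_mul_eq_mul_orderOf_of_coprime]
  · exact IsPrimitiveRoot.orderOf _
  · rwa [← hζ'.eq_orderOf, ← hξ.eq_orderOf]

omit [IsCyclotomicExtension {a} ℚ F] in
theorem IsPrimitiveRoot.isCyclotomicExtension_of_coprime (hζ : IsPrimitiveRoot ζ a)
    (hξ : IsPrimitiveRoot ξ b) (hab : a.Coprime b) : IsCyclotomicExtension {b} F Ω := by
  refine (IsCyclotomicExtension.iff_singleton b F Ω).mpr ⟨⟨ξ, hξ⟩, fun x ↦ ?_⟩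
  have hx : x ∈ Algebra.adjoin ℚ {algebraMap F Ω ζ * ξ} := by
    rw [IsCyclotomicExtension.adjoin_primitive_root_eq_top
      (hζ.algebraMap_mul_of_coprime hξ hab)]
    trivial
  induction hx using Algebra.adjoin_induction with
  | mem x hx =>
    rw [Set.mem_singleton_iff.mp hx]
    exact mul_mem (Subalgebra.algebraMap_mem _ _)
      (Algebra.subset_adjoin (by simpa using hξ.pow_eq_one))
  | algebraMap r =>
    rw [IsScalarTower.algebraMap_apply ℚ F Ω]
    exact Subalgebra.algebraMap_mem _ _
  | add x y _ _ hx hy => exact add_mem hx hy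
  | mul x y _ _ hx hy => exact mul_mem hx hy

omit [NumberField F] [IsCyclotomicExtension {a} ℚ F] in
theorem IsPrimitiveRoot.mem_adjoin_of_coprime (hζ : IsPrimitiveRoot ζ a)
    (hξ : IsPrimitiveRoot ξ b) (hab : a.Coprime b) (y : 𝓞 Ω) :
    (y : Ω) ∈ Algebra.adjoin (𝓞 F) {ξ} := by
  have hη := hζ.algebraMap_mul_of_coprime hξ hab
  obtain ⟨f, rfl⟩ := hη.integralPowerBasis.exists_eq_aeval' y
  rw [hη.integralPowerBasis_gen]
  have hmem : algebraMap F Ω ζ * ξ ∈ Algebra.adjoin (𝓞 F) {ξ} :=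
    mul_mem (Subalgebra.algebraMap_mem (Algebra.adjoin (𝓞 F) {ξ}) hζ.toInteger)
      (Algebra.subset_adjoin rfl)
  have h := Polynomial.aeval_algebraMap_apply Ω hη.toInteger f
  change _ = ((Polynomial.aeval hη.toInteger f : 𝓞 Ω) : Ω) at h
  rw [← h]
  rw [Polynomial.aeval_eq_sum_range]
  exact sum_mem fun i _ ↦ zsmul_mem (pow_mem hmem i) _

theorem IsCyclotomicExtension.irreducible_cyclotomic_of_coprime (hζ : IsPrimitiveRoot ζ a)
    (hξ : IsPrimitiveRoot ξ b) (hab : a.Coprime b) :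
    Irreducible (Polynomial.cyclotomic b F) := by
  have := hζ.isCyclotomicExtension_of_coprime hξ hab
  have hfin : Module.finrank F Ω = b.totient := by
    have h1 := IsCyclotomicExtension.finrank F
      (Polynomial.cyclotomic.irreducible_rat (NeZero.pos a))
    have h2 := IsCyclotomicExtension.finrank Ω
      (Polynomial.cyclotomic.irreducible_rat (NeZero.pos (a * b)))
    rw [Nat.totient_mul hab, ← Module.finrank_mul_finrank ℚ F Ω, h1] at h2
    exact Nat.eq_of_mul_eq_mul_left (Nat.totient_pos.mpr (NeZero.pos a)) h2
  have hint : IsIntegral F ξ := Algebra.IsIntegral.isIntegral ξ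
  have hdeg : (minpoly F ξ).natDegree = b.totient := by
    have := (hξ.powerBasis F).natDegree_minpoly
    rwa [← PowerBasis.finrank, hfin, hξ.powerBasis_gen F] at this
  have heq : minpoly F ξ = Polynomial.cyclotomic b F := by
    refine (Polynomial.eq_of_monic_of_dvd_of_natDegree_le (minpoly.monic hint)
      (Polynomial.cyclotomic.monic b F) (minpoly.dvd _ _ ?_) ?_).symm
    · have := hξ.isRoot_cyclotomic (NeZero.pos b)
      rwa [← Polynomial.map_cyclotomic b (algebraMap F Ω), Polynomial.IsRoot,
        Polynomial.eval_map_algebraMap] at this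
    · rw [hdeg, Polynomial.natDegree_cyclotomic]
  rw [← heq]
  exact minpoly.irreducible hint

end CoprimeCyclotomic

theorem pow_93995_add_pow_add_one : ((93995 : ℕ) : ZMod (487 ^ 2)) ^ 162 +
    ((93995 : ℕ) : ZMod (487 ^ 2)) ^ 81 + 1 = 0 := by
  decide +kernel

theorem isUnit_6206456197 : IsUnit (6206456197 : ZMod (487 ^ 2)) := by
  refine IsUnit.of_mul_eq_one (6206456197 ^ 485) ?_
  decide +kernel

theorem orderOf_3897 : orderOf ((3897 : ℕ) : ZMod (487 ^ 2)) = 487 := by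
  have : Fact (Nat.Prime 487) := ⟨by norm_num⟩
  exact orderOf_eq_prime (by decide +kernel) (by decide +kernel)

section ClassNumber

variable {K F L Ω : Type*} [Field K] [NumberField K] [Field F] [NumberField F] [Field L]
  [NumberField L] [Field Ω] [NumberField Ω] [Algebra K F] [Algebra K L] [Algebra F Ω] [Algebra L Ω]
  [Algebra K Ω] [IsScalarTower K F Ω] [IsScalarTower K L Ω]
  [IsCyclotomicExtension {3 ^ 5} ℚ F] [IsCyclotomicExtension {3 ^ 5 * 487 ^ 2} ℚ Ω]

variable (L Ω) in
theorem not_dvd_finrank_of_dvd_finrank (hL : 487 ∣ Module.finrank ℚ L) :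
    ¬ 487 ∣ 2 * Module.finrank L Ω := by
  intro hm
  have h := IsCyclotomicExtension.finrank Ω
    (Polynomial.cyclotomic.irreducible_rat (n := 3 ^ 5 * 487 ^ 2) (by norm_num))
  rw [Nat.totient_mul (by norm_num), Nat.totient_prime_pow Nat.prime_three (by norm_num),
    Nat.totient_prime_pow (by norm_num) (by norm_num),
    ← Module.finrank_mul_finrank ℚ L Ω] at h
  have := mul_dvd_mul hL hm
  rw [mul_left_comm, h] at this
  norm_num at this

theorem dvd_card_classGroup_of_algEquiv {ζ : F} {ξ : Ω} (hζ : IsPrimitiveRoot ζ (3 ^ 5))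
    (hξ : IsPrimitiveRoot ξ (487 ^ 2)) (hKF : Module.finrank K F = 2)
    (hL : 487 ∣ Module.finrank ℚ L) {σ : Gal(Ω/L)}
    (hσ : σ (algebraMap F Ω ζ * ξ) = (algebraMap F Ω ζ * ξ) ^ 6206456197) :
    487 ∣ Nat.card (ClassGroup (𝓞 L)) := by
  have hp : Nat.Prime 487 := by norm_num
  have : Fact (Nat.Prime 487) := ⟨hp⟩
  have : Fact (Nat.Prime 6206456197) := ⟨prime_6206456197⟩
  have hcop : Nat.Coprime (3 ^ 5) (487 ^ 2) := by norm_num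
  have : IsCyclotomicExtension {487 ^ 2} F Ω := hζ.isCyclotomicExtension_of_coprime hξ hcop
  have hirr := IsCyclotomicExtension.irreducible_cyclotomic_of_coprime hζ hξ hcop
  have : IsGalois ℚ F := IsCyclotomicExtension.isGalois {3 ^ 5} ℚ F
  have : IsGalois K F := IsGalois.tower_top_of_isGalois ℚ K F
  obtain ⟨τ, hτ, hall⟩ := hζ.exists_algEquiv_apply_eq_inv hKF
  have hτ1 : τ ≠ 1 := by
    rintro rfl
    have := hζ.pow_inj (i := 1) (j := 242) (by norm_num) (by norm_num) (by simpa using hτ)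
    omega
  obtain ⟨ρ, hρ⟩ := hζ.exists_ringHom_sq_pow _ pow_93995_add_pow_add_one
  have hΦx := weightedProd_logExponents_primeElement hζ ρ hρ
  set Φ := weightedProd (fun k ↦ (ρ k : 𝓞 F →* ZMod (487 ^ 2))) (logExponents.map (486 * ·)) 0
    with hΦ
  set x := primeElement hζ.toInteger with hx
  have hxq : x ∣ 6206456197 := primeElement_dvd_norm _ hζ.toInteger_pow_add_pow_add_one
  have hxunit : ¬ IsUnit x := by
    rintro ⟨u, hu⟩
    have h1 : Φ u = 1 := weightedProd_logExponents_unit hζ ρ hρ u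
    rw [hu, hΦx, ← orderOf_eq_one_iff, orderOf_3897] at h1
    omega
  have hxunit' : ¬ IsUnit (algebraMap (𝓞 F) (𝓞 Ω) x) := by
    rwa [isUnit_map_iff]
  obtain ⟨I, hI, hxI⟩ := exists_max_ideal_of_mem_nonunits hxunit'
  have hq : ((6206456197 : ℕ) : 𝓞 Ω) ∈ I := by
    have h := map_dvd (algebraMap (𝓞 F) (𝓞 Ω)) hxq
    rw [map_ofNat] at h
    exact I.mem_of_dvd (mod_cast h) hxI
  have hη := hζ.algebraMap_mul_of_coprime hξ hcop
  have : NeZero (3 ^ 5 * 487 ^ 2) := ⟨by norm_num⟩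
  have hres := hη.exists_int_sub_mem_comap hσ hq
  have hQmax : (I.comap (algebraMap (𝓞 L) (𝓞 Ω))).IsMaximal :=
    Ideal.isMaximal_comap_of_isIntegral_of_isMaximal I
  have hrel := Ideal.relNorm_eq_comap_of_exists_int (K := K) _ hres
  have hQ0 : I.comap (algebraMap (𝓞 L) (𝓞 Ω)) ≠ ⊥ := by
    intro h
    have : ((6206456197 : ℕ) : 𝓞 L) ∈ I.comap (algebraMap (𝓞 L) (𝓞 Ω)) := by
      rwa [Ideal.mem_comap, map_natCast]
    rw [h, Ideal.mem_bot, Nat.cast_eq_zero] at this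
    omega
  have hmap : (Ideal.relNorm (𝓞 K) (I.comap (algebraMap (𝓞 L) (𝓞 Ω)))).map
      (algebraMap (𝓞 K) (𝓞 F)) = Ideal.span {x} := by
    rw [hrel, Ideal.comap_comap, ← IsScalarTower.algebraMap_eq,
      IsScalarTower.algebraMap_eq (𝓞 K) (𝓞 F) (𝓞 Ω), ← Ideal.comap_comap]
    exact hζ.map_comap_eq_span_primeElement hKF (Ideal.comap_ne_top _ hI.ne_top) hxI
  obtain ⟨y, u, hyu⟩ := Ideal.exists_intNorm_eq_unit_mul_pow _ hQ0 hmap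
  set h := Nat.card (ClassGroup (𝓞 L))
  have hpow (k : ℕ) : ρ k (u * x ^ h) ^ (2 * Module.finrank L Ω) = 1 := by
    rw [← hyu]
    refine hξ.map_intNorm_pow_eq_one two_ne_zero hirr (hζ.mem_adjoin_of_coprime hξ hcop) hall hτ1 y
      (ρ k) ?_
    rw [hyu, map_mul, map_pow]
    refine (u.isUnit.map (ρ k)).mul ((isUnit_of_dvd_unit (map_dvd (ρ k) hxq) ?_).pow h)
    rw [map_ofNat]
    exact isUnit_6206456197
  have hfinal : Φ ((u * x ^ h) ^ (2 * Module.finrank L Ω)) = 1 :=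
    weightedProd_eq_one _ 486 _ (fun k ↦ by
      rw [MonoidHom.coe_coe, map_pow, hpow, one_pow]) _ _
  have hΦu : Φ u = 1 := weightedProd_logExponents_unit hζ ρ hρ u
  rw [map_pow, map_mul, hΦu, one_mul, map_pow, hΦx, ← pow_mul] at hfinal
  have := orderOf_dvd_of_pow_eq_one hfinal
  rw [orderOf_3897] at this
  exact (hp.dvd_mul.mp this).resolve_right (not_dvd_finrank_of_dvd_finrank L Ω hL)

end ClassNumber

theorem IsPrimitiveRoot.adjoin_simple_isCyclotomicExtension {k L : Type*} [Field k] [Field L]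
    [Algebra k L] {n : ℕ} [NeZero n] {ζ : L} (hζ : IsPrimitiveRoot ζ n) :
    IsCyclotomicExtension {n} k (IntermediateField.adjoin k {ζ}) := by
  change IsCyclotomicExtension {n} k (IntermediateField.adjoin k {ζ}).toSubalgebra
  rw [IntermediateField.adjoin_simple_toSubalgebra_of_isAlgebraic
    (hζ.isIntegral (NeZero.pos n)).tower_top.isAlgebraic]
  exact hζ.adjoin_isCyclotomicExtension k

theorem IsPrimitiveRoot.exists_algEquiv_apply_eq_pow {k Ω : Type*} [Field k] [Field Ω]
    [Algebra k Ω] {n : ℕ} [NeZero n] [IsCyclotomicExtension {n} k Ω] {η : Ω}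
    (hη : IsPrimitiveRoot η n) (hirr : Irreducible (Polynomial.cyclotomic n k)) {q : ℕ}
    (hq : q.Coprime n) : ∃ σ : Gal(Ω/k), σ η = η ^ q := by
  have : NeZero (n : k) := IsCyclotomicExtension.neZero' n k Ω
  have hmin : minpoly k (hη.powerBasis k).gen =
      minpoly k ((hη.pow_of_coprime q hq).powerBasis k).gen := by
    simp_rw [IsPrimitiveRoot.powerBasis_gen]
    rw [← hη.minpoly_eq_cyclotomic_of_irreducible hirr,
      ← (hη.pow_of_coprime q hq).minpoly_eq_cyclotomic_of_irreducible hirr]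
  refine ⟨(hη.powerBasis k).equivOfMinpoly ((hη.pow_of_coprime q hq).powerBasis k) hmin, ?_⟩
  simpa only [IsPrimitiveRoot.powerBasis_gen] using (hη.powerBasis k).equivOfMinpoly_gen _ hmin

theorem IntermediateField.pow_finrank_apply_of_isAbelianGalois {k Ω : Type*} [Field k] [Field Ω]
    [Algebra k Ω] [FiniteDimensional k Ω] [IsAbelianGalois k Ω] (E : IntermediateField k Ω)
    (σ : Gal(Ω/k)) {z : Ω} (hz : z ∈ E) : (σ ^ Module.finrank k E) z = z := by
  have h : AlgEquiv.restrictNormalHom E (σ ^ Module.finrank k E) = 1 := by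
    rw [map_pow, ← IsGalois.card_aut_eq_finrank, pow_card_eq_one']
  have := AlgEquiv.restrictNormal_commutes (σ ^ Module.finrank k E) E ⟨z, hz⟩
  change algebraMap E Ω (AlgEquiv.restrictNormalHom E (σ ^ Module.finrank k E) ⟨z, hz⟩) = _ at this
  rw [h] at this
  exact this.symm

theorem AlgEquiv.pow_apply_eq_pow_pow {k Ω : Type*} [Field k] [Field Ω]
    [Algebra k Ω] {σ : Ω ≃ₐ[k] Ω} {η : Ω} {q : ℕ} (h : σ η = η ^ q) (m : ℕ) :
    (σ ^ m) η = η ^ q ^ m := by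
  induction m with
  | zero => simp
  | succ m ih => rw [pow_succ', AlgEquiv.mul_apply, ih, map_pow, h, ← pow_mul, ← pow_succ']

theorem IntermediateField.mem_fixedField_zpowers {k Ω : Type*} [Field k] [Field Ω] [Algebra k Ω]
    {σ : Gal(Ω/k)} {z : Ω} :
    z ∈ IntermediateField.fixedField (Subgroup.zpowers σ) ↔ σ z = z := by
  rw [IntermediateField.mem_fixedField_iff]
  refine ⟨fun h ↦ h σ (Subgroup.mem_zpowers σ), fun h f hf ↦ ?_⟩
  have : Subgroup.zpowers σ ≤ MulAction.stabilizer Gal(Ω/k) z := by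
    rwa [Subgroup.zpowers_le, MulAction.mem_stabilizer_iff]
  exact this hf

theorem IntermediateField.adjoin_simple_le_lift_fixedField {k E : Type*} [Field k] [Field E]
    [Algebra k E] {Ω : IntermediateField k E} {ζ : Ω} {σ : Gal(Ω/k)} (hζ : σ ζ = ζ) :
    IntermediateField.adjoin k {(ζ : E)} ≤
      IntermediateField.lift (IntermediateField.fixedField (Subgroup.zpowers σ)) := by
  rw [IntermediateField.adjoin_simple_le_iff, IntermediateField.mem_lift]
  exact IntermediateField.mem_fixedField_zpowers.mpr hζ

theorem IntermediateField.le_lift_fixedField_of_pow_apply_eq {k E : Type*} [Field k] [Field E]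
    [Algebra k E] {Ω : IntermediateField k E} [FiniteDimensional k Ω] [IsAbelianGalois k Ω]
    {M : IntermediateField k E} {ξ : Ω} {σ : Gal(Ω/k)} {m : ℕ} (hξ : (σ ^ m) ξ = ξ)
    (hM : M ≤ IntermediateField.adjoin k {(ξ : E)}) (hm : Module.finrank k M = m + 1) :
    M ≤ IntermediateField.lift (IntermediateField.fixedField (Subgroup.zpowers σ)) := by
  have hle := hM.trans (IntermediateField.adjoin_simple_le_lift_fixedField hξ)
  have hMΩ : M ≤ Ω := hle.trans (IntermediateField.lift_le _)
  intro z hz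
  have h₁ : (σ ^ m) ⟨z, hMΩ hz⟩ = ⟨z, hMΩ hz⟩ :=
    IntermediateField.mem_fixedField_zpowers.mp
      ((IntermediateField.mem_lift ⟨z, hMΩ hz⟩).mp (hle hz))
  have h₂ := (IntermediateField.restrict hMΩ).pow_finrank_apply_of_isAbelianGalois σ
    ((IntermediateField.mem_restrict hMΩ ⟨z, hMΩ hz⟩).mpr hz)
  rw [← (IntermediateField.restrictAlgEquiv hMΩ).toLinearEquiv.finrank_eq, hm, pow_succ',
    AlgEquiv.mul_apply, h₁] at h₂
  exact (IntermediateField.mem_lift ⟨z, hMΩ hz⟩).mpr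
    (IntermediateField.mem_fixedField_zpowers.mpr h₂)

theorem IsPrimitiveRoot.algEquiv_pow_apply_eq_self {k Ω : Type*} [Field k] [Field Ω]
    [Algebra k Ω] {n : ℕ} [NeZero n] {η θ : Ω} (hη : IsPrimitiveRoot η n)
    {σ : Gal(Ω/k)} {q b m : ℕ} (hσ : σ η = η ^ q) (hbn : b ∣ n) (hθ : θ ^ b = 1)
    (hq : (q : ZMod b) ^ m = 1) : (σ ^ m) θ = θ := by
  obtain ⟨i, -, rfl⟩ := hη.eq_pow_of_pow_eq_one
    (ξ := θ) (by obtain ⟨c, rfl⟩ := hbn; rw [pow_mul, hθ, one_pow])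
  rw [map_pow, AlgEquiv.pow_apply_eq_pow_pow hσ, pow_right_comm]
  conv_rhs => rw [← pow_one (η ^ i)]
  refine pow_eq_pow_of_modEq (Nat.ModEq.of_dvd (orderOf_dvd_of_pow_eq_one hθ) ?_)
    (pow_orderOf_eq_one _)
  rw [← ZMod.natCast_eq_natCast_iff]
  push_cast
  exact hq

theorem IsPrimitiveRoot.exists_ringEquiv_apply_eq_pow {k E : Type*} [Field k] [Field E]
    [Algebra k E] {Ω K₁ K₂ : IntermediateField k E} {n a b q m : ℕ} [NeZero n]
    (hΩ : IsCyclotomicExtension {n} k Ω) (hirr : Irreducible (Polynomial.cyclotomic n k))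
    {η ζ ξ : Ω} (hη : IsPrimitiveRoot η n) (hq : q.Coprime n) (han : a ∣ n) (hζ : ζ ^ a = 1)
    (hqa : (q : ZMod a) = 1) (hbn : b ∣ n) (hξ : ξ ^ b = 1) (hqb : (q : ZMod b) ^ m = 1)
    (hK₁ : K₁ ≤ IntermediateField.adjoin k {(ζ : E)})
    (hK₂ : K₂ ≤ IntermediateField.adjoin k {(ξ : E)}) (hm : Module.finrank k K₂ = m + 1) :
    ∃ σ : Ω ≃+* Ω, σ η = η ^ q ∧ ∃ h : K₁ ⊔ K₂ ≤ Ω,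
      ∀ z, σ (IntermediateField.inclusion h z) = IntermediateField.inclusion h z := by
  have : IsAbelianGalois k Ω := IsCyclotomicExtension.isAbelianGalois {n} k Ω
  have : FiniteDimensional k Ω := IsCyclotomicExtension.finiteDimensional {n} k Ω
  obtain ⟨σ, hσ⟩ := hη.exists_algEquiv_apply_eq_pow hirr hq
  have hσζ : σ ζ = ζ := by
    have h := hη.algEquiv_pow_apply_eq_self hσ han hζ (m := 1) (by rw [pow_one, hqa])
    rwa [pow_one] at h
  have hle : K₁ ⊔ K₂ ≤ IntermediateField.lift
      (IntermediateField.fixedField (Subgroup.zpowers σ)) :=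
    sup_le (hK₁.trans (IntermediateField.adjoin_simple_le_lift_fixedField hσζ))
      (IntermediateField.le_lift_fixedField_of_pow_apply_eq
        (hη.algEquiv_pow_apply_eq_self hσ hbn hξ hqb) hK₂ hm)
  have h := hle.trans (IntermediateField.lift_le _)
  exact ⟨σ.toRingEquiv, hσ, h, fun z ↦ IntermediateField.mem_fixedField_zpowers.mp
    ((IntermediateField.mem_lift (IntermediateField.inclusion h z)).mp (hle z.2))⟩

theorem IntermediateField.dvd_card_classGroup_of_ringEquiv
    {K F L Ω : IntermediateField ℚ ℂ} [IsCyclotomicExtension {3 ^ 5} ℚ F]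
    [IsCyclotomicExtension {3 ^ 5 * 487 ^ 2} ℚ Ω] (hFΩ : F ≤ Ω) {ζ : F} {ξ : Ω}
    (hζ : IsPrimitiveRoot ζ (3 ^ 5)) (hξ : IsPrimitiveRoot ξ (487 ^ 2)) (hK : K ≤ F)
    (hKdeg : Module.finrank ℚ K = 3 ^ 4) (hKL : K ≤ L) (hL : 487 ∣ Module.finrank ℚ L)
    (hLΩ : L ≤ Ω) {σ : Ω ≃+* Ω}
    (hσ : σ (IntermediateField.inclusion hFΩ ζ * ξ) =
      (IntermediateField.inclusion hFΩ ζ * ξ) ^ 6206456197)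
    (hLσ : ∀ z, σ (IntermediateField.inclusion hLΩ z) = IntermediateField.inclusion hLΩ z) :
    487 ∣ Nat.card (ClassGroup (𝓞 L)) := by
  have : NumberField F := IsCyclotomicExtension.numberField {3 ^ 5} ℚ F
  have : NumberField Ω := IsCyclotomicExtension.numberField {3 ^ 5 * 487 ^ 2} ℚ Ω
  let : Algebra K F := (IntermediateField.inclusion hK).toRingHom.toAlgebra
  let : Algebra K L := (IntermediateField.inclusion hKL).toRingHom.toAlgebra
  let : Algebra F Ω := (IntermediateField.inclusion hFΩ).toRingHom.toAlgebra
  let : Algebra L Ω := (IntermediateField.inclusion hLΩ).toRingHom.toAlgebra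
  let : Algebra K Ω := (IntermediateField.inclusion (hKL.trans hLΩ)).toRingHom.toAlgebra
  have : IsScalarTower K F Ω := .of_algebraMap_eq fun _ ↦ rfl
  have : IsScalarTower K L Ω := .of_algebraMap_eq fun _ ↦ rfl
  have : NumberField L := .of_tower ℚ Ω L
  have : NumberField K := .of_tower ℚ Ω K
  have hKF : Module.finrank K F = 2 := by
    have h := Module.finrank_mul_finrank ℚ K F
    rw [IsCyclotomicExtension.finrank F
      (Polynomial.cyclotomic.irreducible_rat (n := 3 ^ 5) (by norm_num)),
      Nat.totient_prime_pow Nat.prime_three (by norm_num), hKdeg] at h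
    omega
  exact dvd_card_classGroup_of_algEquiv (σ := AlgEquiv.ofRingEquiv (f := σ) hLσ) hζ hξ hKF hL hσ

theorem natCast_6206456197_eq_one : ((6206456197 : ℕ) : ZMod (3 ^ 5)) = 1 := by
  decide +kernel

theorem natCast_6206456197_pow : ((6206456197 : ℕ) : ZMod (487 ^ 2)) ^ 486 = 1 := by
  decide +kernel

/-- `487` divides the class number of the compositum `ℚ(3⁴)·ℚ(487)`, where `ℚ(3⁴)` is the
unique subfield of degree `81` of `ℚ(ζ_{3⁵})` (the `4`-th layer of the cyclotomic
`ℤ₃`-extension of `ℚ`) and `ℚ(487)` is the unique degree-`487` subfield of `ℚ(ζ_{487²})`,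
the compositum being taken inside `ℂ`. -/
theorem p487_dvd_classNumber
    (K₁ K₂ : IntermediateField ℚ ℂ)
    (ζ : ℂ) (hζ : IsPrimitiveRoot ζ (3 ^ 5))
    (hK₁sub : K₁ ≤ IntermediateField.adjoin ℚ {ζ})
    (hK₁deg : Module.finrank ℚ K₁ = 3 ^ 4)
    (ξ : ℂ) (hξ : IsPrimitiveRoot ξ (487 ^ 2))
    (hK₂sub : K₂ ≤ IntermediateField.adjoin ℚ {ξ})
    (hK₂deg : Module.finrank ℚ K₂ = 487) :
    487 ∣ Nat.card (ClassGroup (𝓞 ↥(K₁ ⊔ K₂))) := by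
  have hcop : Nat.Coprime (3 ^ 5) (487 ^ 2) := by norm_num
  have : NeZero (3 ^ 5 * 487 ^ 2) := ⟨by norm_num⟩
  have hη : IsPrimitiveRoot (ζ * ξ) (3 ^ 5 * 487 ^ 2) := hζ.algebraMap_mul_of_coprime hξ hcop
  have : IsCyclotomicExtension {3 ^ 5} ℚ (IntermediateField.adjoin ℚ {ζ}) :=
    hζ.adjoin_simple_isCyclotomicExtension
  have : IsCyclotomicExtension {3 ^ 5 * 487 ^ 2} ℚ (IntermediateField.adjoin ℚ {ζ * ξ}) :=
    hη.adjoin_simple_isCyclotomicExtension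
  have hmem {θ : ℂ} (hθ : θ ^ (3 ^ 5 * 487 ^ 2) = 1) :
      θ ∈ IntermediateField.adjoin ℚ {ζ * ξ} := by
    obtain ⟨i, -, rfl⟩ := hη.eq_pow_of_pow_eq_one hθ
    exact pow_mem (IntermediateField.mem_adjoin_simple_self ℚ _) i
  have hζΩ := hmem (by rw [pow_mul, hζ.pow_eq_one, one_pow])
  have hξΩ := hmem (by rw [mul_comm, pow_mul, hξ.pow_eq_one, one_pow])
  have hζF : IsPrimitiveRoot (IntermediateField.AdjoinSimple.gen ℚ ζ) (3 ^ 5) :=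
    IsPrimitiveRoot.coe_submonoidClass_iff.mp hζ
  have hζΩ' : IsPrimitiveRoot (⟨ζ, hζΩ⟩ : IntermediateField.adjoin ℚ {ζ * ξ}) (3 ^ 5) :=
    IsPrimitiveRoot.coe_submonoidClass_iff.mp hζ
  have hξΩ' : IsPrimitiveRoot (⟨ξ, hξΩ⟩ : IntermediateField.adjoin ℚ {ζ * ξ}) (487 ^ 2) :=
    IsPrimitiveRoot.coe_submonoidClass_iff.mp hξ
  obtain ⟨σ, hσ, hLΩ, hLσ⟩ := IsPrimitiveRoot.exists_ringEquiv_apply_eq_pow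
    hη.adjoin_simple_isCyclotomicExtension (Polynomial.cyclotomic.irreducible_rat (NeZero.pos _))
    (hζΩ'.algebraMap_mul_of_coprime hξΩ' hcop) (q := 6206456197) (by norm_num)
    (dvd_mul_right _ _) hζΩ'.pow_eq_one natCast_6206456197_eq_one (dvd_mul_left _ _)
    hξΩ'.pow_eq_one natCast_6206456197_pow hK₁sub hK₂sub hK₂deg
  refine IntermediateField.dvd_card_classGroup_of_ringEquiv
    (IntermediateField.adjoin_simple_le_iff.mpr hζΩ) hζF hξΩ' hK₁sub hK₁deg le_sup_left ?_ hLΩ hσ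
    hLσ
  rw [← hK₂deg]
  exact IntermediateField.finrank_dvd_of_le_right le_sup_right
end

section
/- 238627 divides the class number of the compositum ℚ(3^4)·ℚ(238627), where ℚ(3^4) is the unique subfield of degree 81 of ℚ(ζ_{3^5}) (the 4-th layer of the cyclotomic ℤ_3-extension of ℚ); equivalently, the 238627-class group of ℚ(3^4)·ℚ(238627) is nontrivial. -/
open NumberField

/-- Let `S` be an endomorphism with `S ^ n = 1` of a space of dimension less than `n`.  If all the
nontrivial eigencomponents of `D` are detected by the functional `e`, then an eigenvector for a
nontrivial eigenvalue on which `e` vanishes is zero. -/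
theorem eq_zero_of_eigenvector {k W : Type*} [Field k] [AddCommGroup W] [Module k W]
    [FiniteDimensional k W] {n : ℕ} (S : Module.End k W) (hS : S ^ n = 1) {w : k}
    (hw : IsPrimitiveRoot w n) (hdim : Module.finrank k W < n) (e : W →ₗ[k] k) (D lam : W)
    (hD : ∀ i ∈ Finset.Ico 1 n, ∑ j ∈ Finset.range n, (w ^ i) ^ j * e ((S ^ j) D) ≠ 0)
    {i₀ : ℕ} (hi₀ : i₀ ∈ Finset.Ico 1 n) (hlam : w ^ i₀ • S lam = lam) (he : e lam = 0) :
    lam = 0 := by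
  have hn : 0 < n := by simp at hi₀; omega
  have hw0 : w ≠ 0 := hw.ne_zero hn.ne'
  set v : ℕ → W := fun i => ∑ j ∈ Finset.range n, (w ^ i) ^ j • (S ^ j) D with hv
  have hev : ∀ i, e (v i) = ∑ j ∈ Finset.range n, (w ^ i) ^ j * e ((S ^ j) D) := by
    intro i; simp [hv]
  have hSv : ∀ i, w ^ i • S (v i) = v i := by
    intro i
    have h1 : w ^ i • S (v i) = ∑ j ∈ Finset.range n, (w ^ i) ^ (j + 1) • (S ^ (j + 1)) D := by
      simp only [hv, map_sum, map_smul, Finset.smul_sum, smul_smul]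
      refine Finset.sum_congr rfl fun j _ => ?_
      rw [pow_succ' S, Module.End.mul_apply, pow_succ' (w ^ i)]
    have h2 := Finset.sum_range_succ' (fun j => (w ^ i) ^ j • (S ^ j) D) n
    have h3 := Finset.sum_range_succ (fun j => (w ^ i) ^ j • (S ^ j) D) n
    have h4 : (w ^ i) ^ n = 1 := by rw [← pow_mul, mul_comm, pow_mul, hw.pow_eq_one, one_pow]
    rw [h1]
    simp only [hS, h4, pow_zero] at h2 h3
    rw [h2] at h3
    simpa [hv] using h3
  have hSv' : ∀ i, S (v i) = (w⁻¹) ^ i • v i := by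
    intro i
    conv_rhs => rw [← hSv i]
    rw [smul_smul, ← mul_pow, inv_mul_cancel₀ hw0, one_pow, one_smul]
  have hinj : Function.Injective fun i : Fin (n - 1) => (w⁻¹) ^ (i.1 + 1) := by
    intro a b hab
    have := hw.inv.pow_inj (by omega) (by omega) hab
    ext; omega
  have hli : LinearIndependent k fun i : Fin (n - 1) => v (i.1 + 1) := by
    refine Module.End.eigenvectors_linearIndependent' S _ hinj _ fun i => ⟨?_, ?_⟩
    · rw [Module.End.mem_eigenspace_iff, hSv']
    · intro h0
      refine hD (i.1 + 1) (by simp; omega) ?_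
      rw [← hev, h0, map_zero]
  have hcard : Fintype.card (Fin (n - 1)) = Module.finrank k W := by
    have := hli.fintype_card_le_finrank
    simp only [Fintype.card_fin] at this ⊢
    omega
  rcases Nat.eq_zero_or_pos (n - 1) with h0 | h0
  · simp at hi₀; omega
  have : Nonempty (Fin (n - 1)) := ⟨⟨0, h0⟩⟩
  have hspan := hli.span_eq_top_of_card_eq_finrank hcard
  have hmem : lam ∈ Submodule.span k (Set.range fun i : Fin (n - 1) => v (i.1 + 1)) := by
    rw [hspan]; trivial
  obtain ⟨c, hc⟩ := (Submodule.mem_span_range_iff_exists_fun k).1 hmem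
  have hz : ∑ i, (c i * (w ^ i₀ * (w⁻¹) ^ (i.1 + 1) - 1)) • v (i.1 + 1) = 0 := by
    have h1 : w ^ i₀ • S lam - lam = 0 := by rw [hlam, sub_self]
    rw [← hc] at h1
    simp only [map_sum, map_smul, hSv', Finset.smul_sum, ← Finset.sum_sub_distrib] at h1
    rw [← h1]
    refine Finset.sum_congr rfl fun i _ => ?_
    module
  have hcz := Fintype.linearIndependent_iff.1 hli _ hz
  have hi₀' := Finset.mem_Ico.1 hi₀
  have hne : ∀ i : Fin (n - 1), i.1 + 1 ≠ i₀ → c i = 0 := by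
    intro i hi
    rcases mul_eq_zero.1 (hcz i) with h | h
    · exact h
    · exfalso
      apply hi
      rw [inv_pow, sub_eq_zero, mul_inv_eq_one₀ (pow_ne_zero _ hw0)] at h
      exact (hw.pow_inj (by omega) (by omega) h).symm
  have hlam' : lam = c ⟨i₀ - 1, by omega⟩ • v i₀ := by
    rw [← hc, Finset.sum_eq_single ⟨i₀ - 1, by omega⟩]
    · simp only; congr 2; omega
    · intro i _ hi
      rw [hne i, zero_smul]
      intro h; apply hi; ext; simp; omega
    · simp
  rw [hlam', map_smul, smul_eq_mul, hev] at he
  rcases mul_eq_zero.1 he with h | h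
  · rw [hlam', h, zero_smul]
  · exact absurd h (hD i₀ hi₀)

/-- The space of homomorphisms from the units of a number field of odd degree to `ZMod p`, `p` odd,
has dimension at most the unit rank. -/
theorem finrank_unitsHom_lt (F : Type*) [Field F] [NumberField F] (p : ℕ) [Fact p.Prime]
    (hp : p ≠ 2) (hodd : Odd (Module.finrank ℚ F)) :
    FiniteDimensional (ZMod p) (Additive (𝓞 F)ˣ →+ ZMod p) ∧
      Module.finrank (ZMod p) (Additive (𝓞 F)ˣ →+ ZMod p) < Module.finrank ℚ F := by
  let ev : (Additive (𝓞 F)ˣ →+ ZMod p) →ₗ[ZMod p] (Fin (Units.rank F) → ZMod p) :=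
    { toFun := fun f i => f (Additive.ofMul (Units.fundSystem F i))
      map_add' := fun f g => by ext; simp
      map_smul' := fun c f => by ext; simp }
  have hinj : Function.Injective ev := by
    rw [← LinearMap.ker_eq_bot, LinearMap.ker_eq_bot']
    intro f hf
    have hf' : ∀ i, f (Additive.ofMul (Units.fundSystem F i)) = 0 := fun i => congrFun hf i
    have htor : ∀ z : Units.torsion F, f (Additive.ofMul (z : (𝓞 F)ˣ)) = 0 := by
      intro z
      have h2 : (z : (𝓞 F)ˣ) ^ 2 = 1 := by
        rcases Units.torsion_eq_one_or_neg_one_of_odd_finrank hodd z with h | h <;> simp [h]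
      have h3 : (2 : ZMod p) * f (Additive.ofMul (z : (𝓞 F)ˣ)) = 0 := by
        have := congrArg (fun x => f (Additive.ofMul x)) h2
        simpa using this
      rcases mul_eq_zero.1 h3 with h | h
      · exfalso
        have h4 : ((2 : ℕ) : ZMod p) = 0 := by exact_mod_cast h
        rw [ZMod.natCast_eq_zero_iff] at h4
        exact hp ((Nat.prime_dvd_prime_iff_eq (Fact.out) Nat.prime_two).1 h4)
      · exact h
    refine AddMonoidHom.ext fun x => ?_
    obtain ⟨⟨z, m⟩, hx, -⟩ := Units.exist_unique_eq_mul_prod F x.toMul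
    have : x = Additive.ofMul ((z : (𝓞 F)ˣ) * ∏ i, Units.fundSystem F i ^ m i) := by
      rw [← hx]; rfl
    rw [this, ofMul_mul, map_add, htor, ofMul_prod, map_sum]
    simp [hf']
  have hle := LinearMap.finrank_le_finrank_of_injective hinj
  have hpos : 0 < Module.finrank ℚ F := Module.finrank_pos
  refine ⟨FiniteDimensional.of_injective ev hinj, lt_of_le_of_lt hle ?_⟩
  rw [Module.finrank_fin_fun, Units.rank]
  have : Fintype.card (InfinitePlace F) ≤ Module.finrank ℚ F := by
    rw [← InfinitePlace.sum_mult_eq, Fintype.card_eq_sum_ones]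
    exact Finset.sum_le_sum fun w _ => InfinitePlace.mult_pos
  omega

/-- A discrete logarithm on the `p`-torsion of a finite cyclic group. -/
theorem exists_discreteLog {A : Type*} [CommGroup A] [Finite A] [IsCyclic A] {p : ℕ}
    [Fact p.Prime] {g : A} (hg : orderOf g = p) :
    ∃ L : A → ZMod p, (∀ x y, x ^ p = 1 → y ^ p = 1 → L (x * y) = L x + L y) ∧
      ∀ n : ℕ, L (g ^ n) = n := by
  classical
  have hp0 : 0 < p := (Fact.out : p.Prime).pos
  have hmem : ∀ x : A, x ^ p = 1 → ∃ n : ℕ, x = g ^ n := by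
    intro x hx
    have _ := Fintype.ofFinite A
    have hsub : (Subgroup.zpowers g : Set A).toFinset ⊆ {a : A | a ^ p = 1}.toFinset := by
      intro y hy
      simp only [Set.mem_toFinset, SetLike.mem_coe, Set.mem_ofPred_eq] at hy ⊢
      obtain ⟨k, rfl⟩ := hy
      simp only
      rw [← zpow_natCast, zpow_comm, zpow_natCast, ← hg, pow_orderOf_eq_one, one_zpow]
    have hcard : (Subgroup.zpowers g : Set A).toFinset.card = p := by
      rw [Set.toFinset_card, ← hg, ← Fintype.card_zpowers]
      rfl
    have hle : {a : A | a ^ p = 1}.toFinset.card ≤ p := by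
      have := IsCyclic.card_pow_eq_one_le (α := A) hp0
      convert this using 2
      ext; simp
    have heq := Finset.eq_of_subset_of_card_le hsub (by rw [hcard]; exact hle)
    have hx' : x ∈ {a : A | a ^ p = 1}.toFinset := by simpa using hx
    rw [← heq] at hx'
    simp only [Set.mem_toFinset, SetLike.mem_coe] at hx'
    rw [← mem_powers_iff_mem_zpowers] at hx'
    obtain ⟨n, hn⟩ := hx'
    exact ⟨n, hn.symm⟩
  have hinj : ∀ n m : ℕ, g ^ n = g ^ m → (n : ZMod p) = m := by
    intro n m h
    rw [pow_eq_pow_iff_modEq, hg] at h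
    exact (ZMod.natCast_eq_natCast_iff _ _ _).2 h
  let L : A → ZMod p := fun x => if h : ∃ n : ℕ, x = g ^ n then (h.choose : ZMod p) else 0
  have hL : ∀ n : ℕ, L (g ^ n) = n := by
    intro n
    have h : ∃ m : ℕ, g ^ n = g ^ m := ⟨n, rfl⟩
    simp only [L, dif_pos h]
    exact hinj _ _ h.choose_spec.symm
  refine ⟨L, fun x y hx hy => ?_, hL⟩
  obtain ⟨n, rfl⟩ := hmem x hx
  obtain ⟨m, rfl⟩ := hmem y hy
  rw [← pow_add, hL, hL, hL, Nat.cast_add]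

theorem one_add_pow_modEq_sq (p a : ℕ) : (1 + p) ^ a ≡ 1 + p * a [MOD p ^ 2] := by
  induction a with
  | zero => simp [Nat.ModEq]
  | succ n ih =>
    rw [pow_succ]
    refine (ih.mul_right _).trans ?_
    have : (1 + p * n) * (1 + p) = 1 + p * (n + 1) + p ^ 2 * n := by ring
    rw [this]
    simp [Nat.ModEq]

/-- The Fermat quotient, extended to all nonzero `p`-adic integers by killing `p`. -/
theorem exists_fermatQuotient (p : ℕ) [hp : Fact p.Prime] (hp2 : p ≠ 2) :
    ∃ q : ℤ_[p] → ZMod p, (∀ x y, x ≠ 0 → y ≠ 0 → q (x * y) = q x + q y) ∧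
      ∀ (x : ℤ_[p]) (e m a : ℕ), ¬ p ∣ m → m ^ (p - 1) ≡ 1 + p * a [MOD p ^ 2] →
        (p : ℤ_[p]) ^ (e + 2) ∣ x - p ^ e * m → q x = a := by
  have hpp := hp.out
  have : IsCyclic (ZMod (p ^ 2))ˣ := ZMod.isCyclic_units_of_prime_pow p hpp hp2 2
  have : NeZero (p ^ 2) := ⟨pow_ne_zero _ hpp.ne_zero⟩
  have hcop : Nat.Coprime (1 + p) (p ^ 2) := by
    apply Nat.Coprime.pow_right
    simp
  set g : (ZMod (p ^ 2))ˣ := ZMod.unitOfCoprime (1 + p) hcop with hgdef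
  have hgpow : ∀ a : ℕ, ((g ^ a : (ZMod (p ^ 2))ˣ) : ZMod (p ^ 2)) = ((1 + p * a : ℕ) : ZMod _) := by
    intro a
    rw [Units.val_pow_eq_pow_val, hgdef, ZMod.coe_unitOfCoprime, ← Nat.cast_pow]
    exact (ZMod.natCast_eq_natCast_iff _ _ _).2 (one_add_pow_modEq_sq p a)
  have hg : orderOf g = p := by
    apply orderOf_eq_prime
    · ext
      rw [hgpow]
      have : 1 + p * p = 1 + p ^ 2 := by ring
      rw [this]; simp
    · intro h
      have := congrArg (fun u : (ZMod (p ^ 2))ˣ => (u : ZMod (p ^ 2))) (pow_one g)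
      rw [hgpow, h, Units.val_one, mul_one] at this
      have h2 : ((p : ℕ) : ZMod (p ^ 2)) = 0 := by push_cast at this ⊢; simpa using this
      rw [ZMod.natCast_eq_zero_iff] at h2
      have := Nat.le_of_dvd hpp.pos h2
      nlinarith [hpp.two_le]
  obtain ⟨L, hLmul, hLg⟩ := exists_discreteLog hg
  let r : ℤ_[p]ˣ →* (ZMod (p ^ 2))ˣ := Units.map (PadicInt.toZModPow 2 : ℤ_[p] →+* ZMod (p ^ 2))
  have hr : ∀ u : ℤ_[p]ˣ, (r u ^ (p - 1)) ^ p = 1 := by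
    intro u
    rw [← pow_mul]
    have := ZMod.pow_totient (r u)
    rwa [Nat.totient_prime_pow hpp two_pos, show 2 - 1 = 1 from rfl, pow_one,
      mul_comm] at this
  have hp0 : (p : ℤ_[p]) ≠ 0 := by exact_mod_cast hpp.ne_zero
  classical
  let q : ℤ_[p] → ZMod p := fun x => if h : x ≠ 0 then L (r (PadicInt.unitCoeff h) ^ (p - 1)) else 0
  have hq : ∀ (u : ℤ_[p]ˣ) (e : ℕ), q (u * p ^ e) = L (r u ^ (p - 1)) := by
    intro u e
    have hx : (u * p ^ e : ℤ_[p]) ≠ 0 := mul_ne_zero u.ne_zero (pow_ne_zero _ hp0)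
    have hval : (u * p ^ e : ℤ_[p]).valuation = e := by
      rw [PadicInt.valuation_mul u.ne_zero (pow_ne_zero _ hp0), PadicInt.valuation_pow, PadicInt.valuation_p, mul_one]
      have : (u : ℤ_[p]).valuation = 0 := by
        have := PadicInt.norm_eq_zpow_neg_valuation u.ne_zero
        rw [PadicInt.norm_units] at this
        have h1 : (1 : ℝ) < p := by exact_mod_cast hpp.one_lt
        have := (zpow_eq_one_iff_right₀ (by positivity) h1.ne').1 this.symm
        simpa using this
      rw [this, zero_add]
    have hspec := PadicInt.unitCoeff_spec hx
    rw [hval] at hspec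
    have := mul_right_cancel₀ (pow_ne_zero _ hp0) hspec
    simp only [q, dif_pos hx]
    rw [← Units.ext this]
  refine ⟨q, fun x y hx hy => ?_, fun x e m a hm hma hx => ?_⟩
  · rw [PadicInt.unitCoeff_spec hx, PadicInt.unitCoeff_spec hy, hq, hq]
    have : ∀ (u v : ℤ_[p]ˣ) (a b : ℕ), (u * p ^ a * (v * p ^ b) : ℤ_[p]) = (u * v : ℤ_[p]ˣ) * p ^ (a + b) := by
      intros; push_cast; ring
    rw [this, hq, map_mul, mul_pow, hLmul _ _ (hr _) (hr _)]
  · obtain ⟨c, hc⟩ := hx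
    have hu : IsUnit ((m : ℤ_[p]) + p ^ 2 * c) := by
      rw [PadicInt.isUnit_iff]
      by_contra hne
      have hlt := lt_of_le_of_ne (PadicInt.norm_le_one _) hne
      rw [PadicInt.norm_lt_one_iff_dvd] at hlt
      have h2 : (p : ℤ_[p]) ∣ (m : ℤ_[p]) := (dvd_add_left ⟨p * c, by ring⟩).1 hlt
      rw [← PadicInt.norm_lt_one_iff_dvd] at h2
      have h3 := PadicInt.norm_int_lt_one_iff_dvd (p := p) (m : ℤ)
      push_cast at h3
      exact hm (by exact_mod_cast h3.1 h2)
    obtain ⟨u, hu⟩ := hu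
    have hxu : x = u * p ^ e := by
      rw [hu]; linear_combination hc
    have hru : r u ^ (p - 1) = g ^ a := by
      ext
      rw [hgpow, Units.val_pow_eq_pow_val]
      have h1 : ((r u : (ZMod (p ^ 2))ˣ) : ZMod (p ^ 2)) = (m : ZMod (p ^ 2)) := by
        change PadicInt.toZModPow 2 (u : ℤ_[p]) = _
        rw [hu, map_add, map_mul, map_pow, map_natCast, map_natCast, ← Nat.cast_pow, ZMod.natCast_self]
        simp
      rw [h1, ← Nat.cast_pow]
      exact (ZMod.natCast_eq_natCast_iff _ _ _).2 hma
    rw [hxu, hq, hru, hLg]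

theorem exists_pow_dvd_sub_pow_mul (p : ℕ) [hp : Fact p.Prime] {x : ℤ_[p]} (hx : x ≠ 0) :
    ∃ e m a : ℕ, ¬ p ∣ m ∧ m ^ (p - 1) ≡ 1 + p * a [MOD p ^ 2] ∧
      (p : ℤ_[p]) ^ (e + 2) ∣ x - p ^ e * m := by
  have hpp := hp.out
  have hp0 : (p : ℤ_[p]) ≠ 0 := by exact_mod_cast hpp.ne_zero
  have : NeZero (p ^ 2) := ⟨pow_ne_zero _ hpp.ne_zero⟩
  set u := PadicInt.unitCoeff hx
  set m := (PadicInt.toZModPow 2 (u : ℤ_[p])).val with hm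
  have hdvd : (p : ℤ_[p]) ^ 2 ∣ (u : ℤ_[p]) - m := by
    rw [← Ideal.mem_span_singleton, ← PadicInt.ker_toZModPow, RingHom.mem_ker, map_sub,
      map_natCast, hm, ZMod.natCast_zmod_val, sub_self]
  have hndvd : ¬ p ∣ m := by
    intro h
    have h1 : (p : ℤ_[p]) ∣ (m : ℤ_[p]) := by exact_mod_cast Nat.cast_dvd_cast h
    have h2 : (p : ℤ_[p]) ∣ u := by
      have := dvd_add ((dvd_pow_self _ two_ne_zero).trans hdvd) h1
      simpa using this
    exact PadicInt.prime_p.not_isUnit (isUnit_of_dvd_unit h2 u.isUnit)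
  have hmpos : 0 < m := Nat.pos_of_ne_zero fun h => hndvd (h ▸ dvd_zero _)
  have hfermat : p ∣ m ^ (p - 1) - 1 := by
    rw [← Nat.modEq_iff_dvd' (Nat.one_le_pow _ _ hmpos)]
    exact (Nat.ModEq.pow_card_sub_one_eq_one hpp
      ((hpp.coprime_iff_not_dvd.2 hndvd).symm)).symm
  obtain ⟨a, ha⟩ := hfermat
  refine ⟨x.valuation, m, a, hndvd, ?_, ?_⟩
  · have := Nat.one_le_pow (p - 1) m hmpos
    rw [← ha, Nat.add_sub_cancel' this]
  · obtain ⟨c, hc⟩ := hdvd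
    exact ⟨c, by linear_combination (p : ℤ_[p]) ^ x.valuation * hc + PadicInt.unitCoeff_spec hx⟩

/-- The relative norm preserves congruences modulo elements of the base. -/
theorem dvd_norm_sub_norm {F L : Type*} [Field F] [NumberField F] [Field L] [NumberField L]
    [Algebra F L] [IsGalois F L] (c : 𝓞 F) (a b : 𝓞 L)
    (h : algebraMap (𝓞 F) (𝓞 L) c ∣ a - b) :
    c ∣ RingOfIntegers.norm F a - RingOfIntegers.norm F b := by
  rcases eq_or_ne c 0 with rfl | hc
  · rw [map_zero, zero_dvd_iff, sub_eq_zero] at h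
    rw [h, sub_self]
  have key : algebraMap (𝓞 F) (𝓞 L) c ∣
      algebraMap (𝓞 F) (𝓞 L) (RingOfIntegers.norm F a - RingOfIntegers.norm F b) := by
    have hprod : ∀ x : 𝓞 L, algebraMap (𝓞 F) (𝓞 L) (RingOfIntegers.norm F x) =
        ∏ g : L ≃ₐ[F] L, galRestrict (𝓞 F) F L (𝓞 L) g x := by
      intro x
      apply RingOfIntegers.ext
      rw [RingOfIntegers.coe_algebraMap_norm, Algebra.norm_eq_prod_automorphisms,
        RingOfIntegers.coe_eq_algebraMap (∏ g, _), map_prod]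
      refine Finset.prod_congr rfl fun g _ => ?_
      exact (algebraMap_galRestrict_apply (𝓞 F) g x).symm
    rw [map_sub, hprod, hprod, ← Ideal.mem_span_singleton, ← Ideal.Quotient.eq, map_prod, map_prod]
    refine Finset.prod_congr rfl fun g _ => ?_
    rw [Ideal.Quotient.eq, Ideal.mem_span_singleton, ← map_sub]
    have := map_dvd (galRestrict (𝓞 F) F L (𝓞 L) g) h
    simpa using this
  obtain ⟨t, ht⟩ := key
  set d := RingOfIntegers.norm F a - RingOfIntegers.norm F b
  have hcF : (c : F) ≠ 0 := by simpa using hc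
  have htF : algebraMap F L ((d : F) / c) = (t : L) := by
    rw [map_div₀, div_eq_iff (by simpa using hcF)]
    have := congrArg (algebraMap (𝓞 L) L) ht
    rw [map_mul, ← IsScalarTower.algebraMap_apply, ← IsScalarTower.algebraMap_apply] at this
    rw [mul_comm]
    rw [IsScalarTower.algebraMap_apply (𝓞 F) F L, IsScalarTower.algebraMap_apply (𝓞 F) F L] at this
    exact this
  have hint : IsIntegral ℤ ((d : F) / c) := by
    rw [← isIntegral_algebraMap_iff (algebraMap F L).injective, htF]
    exact t.2
  obtain ⟨z, hz⟩ : ∃ z : 𝓞 F, (z : F) = d / c := ⟨⟨_, hint⟩, rfl⟩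
  refine ⟨z, RingOfIntegers.ext ?_⟩
  have h1 : ((c * z : 𝓞 F) : F) = c * z := map_mul (algebraMap (𝓞 F) F) c z
  rw [h1, hz, mul_div_cancel₀ _ hcF]

/-- A family of `p`-adic embeddings separated modulo `p` by one element admits approximate
idempotents. -/
theorem exists_approx_idempotent {R : Type*} [CommRing R] (p : ℕ) [hp : Fact p.Prime] {n : ℕ}
    (τ : ℕ → R →+* ℤ_[p]) (θ : R)
    (hθ : ∀ j < n, ∀ k < n, j ≠ k → ¬ (p : ℤ_[p]) ∣ τ j θ - τ k θ) {k₀ : ℕ} (hk₀ : k₀ < n) (M : ℕ) :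
    ∃ e : R, PadicInt.toZModPow M (τ k₀ e) = 1 ∧
      ∀ k < n, k ≠ k₀ → PadicInt.toZModPow M (τ k e) = 0 := by
  have : NeZero (p ^ M) := ⟨pow_ne_zero _ hp.out.ne_zero⟩
  let a : ℕ → ℕ := fun k => (PadicInt.toZModPow M (τ k θ)).val
  have ha : ∀ k, ((a k : ℕ) : ZMod (p ^ M)) = PadicInt.toZModPow M (τ k θ) := fun k =>
    ZMod.natCast_zmod_val _
  let e₀ : R := ∏ k ∈ (Finset.range n).erase k₀, (θ - a k)
  have he₀ : ∀ k < n, k ≠ k₀ → PadicInt.toZModPow M (τ k e₀) = 0 := by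
    intro k hk hne
    simp only [e₀, map_prod]
    refine Finset.prod_eq_zero (Finset.mem_erase.2 ⟨hne, Finset.mem_range.2 hk⟩) ?_
    rw [map_sub, map_sub, map_natCast, map_natCast, ha, sub_self]
  have hunit : IsUnit (PadicInt.toZModPow M (τ k₀ e₀)) := by
    simp only [e₀, map_prod]
    rw [IsUnit.prod_iff]
    intro k hk
    obtain ⟨hne, hk⟩ := Finset.mem_erase.1 hk
    have hu : IsUnit (τ k₀ θ - τ k θ) := by
      rw [PadicInt.isUnit_iff]
      by_contra h
      exact hθ k₀ hk₀ k (Finset.mem_range.1 hk) hne.symm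
        (PadicInt.norm_lt_one_iff_dvd _ |>.1 (lt_of_le_of_ne (PadicInt.norm_le_one _) h))
    have := hu.map (PadicInt.toZModPow M)
    rwa [map_sub, ← ha k, ← map_natCast (PadicInt.toZModPow M), ← map_natCast (τ k₀), ← map_sub,
      ← map_sub] at this
  obtain ⟨c, hc⟩ := hunit.exists_right_inv
  refine ⟨e₀ * (c.val : ℕ), ?_, fun k hk hne => ?_⟩
  · rw [map_mul, map_mul, map_natCast, map_natCast, ZMod.natCast_zmod_val, hc]
  · rw [map_mul, map_mul, he₀ k hk hne, zero_mul]

/-- If every global norm from `L` to `ℚ` is, up to sign and powers of `p`, a `(p-1)`-st root of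
unity modulo `p ^ 2`, then the relative norms to `F` have trivial Fermat quotients. -/
theorem fermatQuotient_norm_eq_zero {F L : Type*} [Field F] [NumberField F] [Field L]
    [NumberField L] [Algebra F L] [IsGalois F L] (p : ℕ) [hp : Fact p.Prime] (hp2 : p ≠ 2)
    (q : ℤ_[p] → ZMod p) (hqmul : ∀ x y, x ≠ 0 → y ≠ 0 → q (x * y) = q x + q y)
    (hq : ∀ (x : ℤ_[p]) (e m a : ℕ), ¬ p ∣ m → m ^ (p - 1) ≡ 1 + p * a [MOD p ^ 2] →
        (p : ℤ_[p]) ^ (e + 2) ∣ x - p ^ e * m → q x = a)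
    (hL : ∀ b : 𝓞 L, b ≠ 0 → ∃ j w : ℕ, (Algebra.norm ℤ b).natAbs = p ^ j * w ∧
      w ^ (p - 1) ≡ 1 [MOD p ^ 2])
    {n : ℕ} (τ : ℕ → 𝓞 F →+* ℤ_[p])
    (hτ : ∀ x : 𝓞 F, ((Algebra.norm ℤ x : ℤ) : ℤ_[p]) = ∏ k ∈ Finset.range n, τ k x)
    (θ : 𝓞 F) (hθ : ∀ j < n, ∀ k < n, j ≠ k → ¬ (p : ℤ_[p]) ∣ τ j θ - τ k θ)
    (b : 𝓞 L) (hb : b ≠ 0) {k₀ : ℕ} (hk₀ : k₀ < n) : q (τ k₀ (RingOfIntegers.norm F b)) = 0 := by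
  have hpp := hp.out
  set y := RingOfIntegers.norm F b with hy
  have hnormtower : ∀ x : 𝓞 L, Algebra.norm ℤ (RingOfIntegers.norm F x) = Algebra.norm ℤ x := by
    intro x
    have : ((Algebra.norm ℤ (RingOfIntegers.norm F x) : ℤ) : ℚ) = (Algebra.norm ℤ x : ℤ) := by
      rw [Algebra.coe_norm_int, Algebra.coe_norm_int]
      rw [RingOfIntegers.coe_norm, Algebra.norm_norm]
    exact_mod_cast this
  have hx0 : τ k₀ y ≠ 0 := by
    intro h0
    have h1 : ((Algebra.norm ℤ y : ℤ) : ℤ_[p]) = 0 := by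
      rw [hτ]; exact Finset.prod_eq_zero (Finset.mem_range.2 hk₀) h0
    rw [Int.cast_eq_zero, hy, hnormtower, Algebra.norm_eq_zero_iff] at h1
    exact hb h1
  obtain ⟨e₀, m, a, hm, hma, hxm⟩ := exists_pow_dvd_sub_pow_mul p hx0
  obtain ⟨e, he1, he0⟩ := exists_approx_idempotent p τ θ hθ hk₀ (e₀ + 2)
  set b' : 𝓞 L := 1 + algebraMap (𝓞 F) (𝓞 L) e * (b - 1) with hb'
  set y' := RingOfIntegers.norm F b' with hy'
  have hd1 : e ∣ y' - 1 := by
    have := dvd_norm_sub_norm e b' 1 ⟨b - 1, by rw [hb']; ring⟩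
    rwa [map_one] at this
  have hd2 : (e - 1) ∣ y' - y :=
    dvd_norm_sub_norm (e - 1) b' b ⟨b - 1, by rw [hb', map_sub, map_one]; ring⟩
  have hf1 : ∀ k < n, k ≠ k₀ → PadicInt.toZModPow (e₀ + 2) (τ k y') = 1 := by
    intro k hk hne
    obtain ⟨c, hc⟩ := hd1
    have : y' = 1 + e * c := by rw [← hc]; ring
    rw [this]
    simp [he0 k hk hne]
  have hf2 : PadicInt.toZModPow (e₀ + 2) (τ k₀ y') = PadicInt.toZModPow (e₀ + 2) (τ k₀ y) := by
    obtain ⟨c, hc⟩ := hd2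
    have : y' = y + (e - 1) * c := by rw [← hc]; ring
    rw [this]
    simp [he1]
  set N : ℤ := Algebra.norm ℤ b' with hN
  have hNy : PadicInt.toZModPow (e₀ + 2) ((N : ℤ) : ℤ_[p]) = PadicInt.toZModPow (e₀ + 2) (τ k₀ y) := by
    rw [hN, ← hnormtower, hτ, map_prod, ← hf2]
    refine Finset.prod_eq_single_of_mem k₀ (Finset.mem_range.2 hk₀) fun k hk hne => ?_
    exact hf1 k (Finset.mem_range.1 hk) hne
  have hNx : (p : ℤ_[p]) ^ (e₀ + 2) ∣ (N : ℤ_[p]) - τ k₀ y := by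
    rw [← Ideal.mem_span_singleton, ← PadicInt.ker_toZModPow, RingHom.mem_ker, map_sub, hNy,
      sub_self]
  have hNm : (p : ℤ_[p]) ^ (e₀ + 2) ∣ (N : ℤ_[p]) - p ^ e₀ * m := by
    have := dvd_add hNx hxm
    simpa using this
  have hqN : q (N : ℤ_[p]) = q (τ k₀ y) := by
    rw [hq _ e₀ m a hm hma hNm, hq _ e₀ m a hm hma hxm]
  have hN0 : N ≠ 0 := by
    intro h0
    rw [h0, Int.cast_zero, zero_sub, dvd_neg, pow_add] at hNm
    have hp0 : (p : ℤ_[p]) ^ e₀ ≠ 0 := pow_ne_zero _ (by exact_mod_cast hpp.ne_zero)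
    have h2 := (mul_dvd_mul_iff_left hp0).1 hNm
    have h3 : (p : ℤ_[p]) ∣ ((m : ℤ) : ℤ_[p]) := by
      simpa using (dvd_pow_self _ two_ne_zero).trans h2
    rw [← PadicInt.norm_lt_one_iff_dvd, PadicInt.norm_int_lt_one_iff_dvd] at h3
    exact hm (by exact_mod_cast h3)
  have hb'0 : b' ≠ 0 := by
    intro h0; apply hN0; rw [hN, h0, Algebra.norm_zero]
  obtain ⟨j, w, hjw, hw⟩ := hL b' hb'0
  have hwp : ¬ p ∣ w := by
    intro h
    have h1 : p ∣ w ^ (p - 1) := dvd_pow h (by have := hpp.two_le; omega)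
    have h2 := (hw.of_dvd (dvd_pow_self p two_ne_zero))
    have h3 := (h2.symm.trans ((Nat.modEq_zero_iff_dvd).2 h1))
    exact hpp.one_lt.ne' (Nat.dvd_one.1 ((Nat.modEq_zero_iff_dvd).1 h3))
  have hq0 : q ((p ^ j * w : ℕ) : ℤ_[p]) = 0 := by
    have := hq ((p ^ j * w : ℕ) : ℤ_[p]) j w 0 hwp (by simpa using hw) (by push_cast; simp)
    simpa using this
  have hqone : q 1 = 0 := by
    have := hqmul 1 1 one_ne_zero one_ne_zero
    simpa using this
  have hqneg : q (-1) = 0 := by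
    have h1 := hqmul (-1) (-1) (by simp) (by simp)
    rw [neg_mul_neg, one_mul, hqone] at h1
    have h2 : ((2 : ℕ) : ZMod p) * q (-1) = 0 := by push_cast; rw [two_mul, ← h1]
    rcases mul_eq_zero.1 h2 with h | h
    · rw [ZMod.natCast_eq_zero_iff] at h
      exact absurd ((Nat.prime_dvd_prime_iff_eq hpp Nat.prime_two).1 h) hp2
    · exact h
  rw [← hqN]
  rcases Int.natAbs_eq N with h | h
  · rw [h, hjw]
    exact_mod_cast hq0
  · have hcast : ((N : ℤ) : ℤ_[p]) = (-1) * ((p ^ j * w : ℕ) : ℤ_[p]) := by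
      rw [h, hjw]; push_cast; ring
    have hne : ((p ^ j * w : ℕ) : ℤ_[p]) ≠ 0 := by
      intro h0
      rw [h0, mul_zero, Int.cast_eq_zero] at hcast
      exact hN0 hcast
    rw [hcast, hqmul _ _ (by simp) hne, hqneg, hq0, add_zero]

theorem Ideal.exists_span_singleton_eq_pow {R : Type*} [CommRing R] [IsDedekindDomain R]
    {a a' P : R} {n : ℕ} (hcop : IsCoprime a a') (h : Associated (a * a') (P ^ n)) :
    ∃ Q : Ideal R, Ideal.span {a} = Q ^ n := by
  classical
  have h1 : Ideal.span {a} * Ideal.span {a'} = Ideal.span {P} ^ n := by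
    rw [Ideal.span_singleton_mul_span_singleton, Ideal.span_singleton_pow,
      Ideal.span_singleton_eq_span_singleton]
    exact h
  have h2 : IsCoprime (Ideal.span {a}) (Ideal.span {a'}) :=
    (Ideal.isCoprime_span_singleton_iff _ _).2 hcop
  have := UniqueFactorizationMonoid.toGCDMonoid (Ideal R)
  exact exists_eq_pow_of_mul_eq_pow (isUnit_of_dvd_one
    (by
      have h3 := Ideal.isCoprime_iff_add.1 h2
      have := dvd_add (gcd_dvd_left (Ideal.span {a}) (Ideal.span {a'})) (gcd_dvd_right _ _)
      rwa [h3] at this)) h1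

/-- If `α` generates an `n`-th power of an ideal in an extension of degree `n`, then the power of
`α` given by the class number is, up to a unit, a norm. -/
theorem exists_norm_eq_unit_mul_pow_card_classGroup {F L : Type*} [Field F] [NumberField F]
    [Field L] [NumberField L] [Algebra F L] [IsGalois F L] {n : ℕ} (hn : n ≠ 0)
    (hF : Module.finrank F L = n) {α : 𝓞 F} (hα : α ≠ 0) {Q : Ideal (𝓞 L)}
    (hQ : Ideal.span {algebraMap (𝓞 F) (𝓞 L) α} = Q ^ n) :
    ∃ β : 𝓞 L, β ≠ 0 ∧ ∃ u : (𝓞 F)ˣ,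
      RingOfIntegers.norm F β = u * α ^ Nat.card (ClassGroup (𝓞 L)) := by
  set h := Nat.card (ClassGroup (𝓞 L))
  have hα' : algebraMap (𝓞 F) (𝓞 L) α ≠ 0 := by
    rwa [Ne, FaithfulSMul.algebraMap_eq_zero_iff]
  have hQ0 : Q ≠ ⊥ := by
    rintro rfl
    rw [Ideal.bot_pow hn, Ideal.span_singleton_eq_bot] at hQ
    exact hα' hQ
  have hprin : (Q ^ h).IsPrincipal := by
    rw [← ClassGroup.mk0_eq_one_iff (I := Q ^ h) (mem_nonZeroDivisors_of_ne_zero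
      (pow_ne_zero _ hQ0))]
    have : (⟨Q ^ h, mem_nonZeroDivisors_of_ne_zero (pow_ne_zero _ hQ0)⟩ :
        nonZeroDivisors (Ideal (𝓞 L))) = ⟨Q, mem_nonZeroDivisors_of_ne_zero hQ0⟩ ^ h := rfl
    rw [this, map_pow, pow_card_eq_one']
  obtain ⟨β, hβ⟩ := hprin
  have hβ : Q ^ h = Ideal.span {β} := hβ
  have hβ0 : β ≠ 0 := by
    rintro rfl
    rw [Ideal.span_singleton_eq_bot.2 rfl] at hβ
    exact pow_ne_zero h hQ0 hβ
  have hassoc : Associated (β ^ n) (algebraMap (𝓞 F) (𝓞 L) α ^ h) := by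
    rw [← Ideal.span_singleton_eq_span_singleton, ← Ideal.span_singleton_pow,
      ← Ideal.span_singleton_pow, hQ, ← hβ, ← pow_mul, ← pow_mul, mul_comm]
  have hassoc2 := hassoc.map (RingOfIntegers.norm F : 𝓞 L →* 𝓞 F)
  rw [map_pow, map_pow, RingOfIntegers.norm_algebraMap, hF, ← pow_mul, mul_comm n h, pow_mul] at hassoc2
  have h1 := (IsIntegrallyClosed.pow_dvd_pow_iff hn).1 hassoc2.dvd
  have h2 := (IsIntegrallyClosed.pow_dvd_pow_iff hn).1 hassoc2.symm.dvd
  obtain ⟨u, hu⟩ := (associated_of_dvd_dvd h2 h1)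
  exact ⟨β, hβ0, u, by rw [← hu, mul_comm]⟩

/-- If `M / K` is a Galois extension of degree `m` containing a primitive `n`-th root of unity, then
norms of the primes of `K` not dividing `n` satisfy `N ^ m ≡ 1` modulo `n`. -/
theorem absNorm_pow_finrank_modEq_one {K M : Type*} [Field K] [NumberField K] [Field M]
    [NumberField M] [Algebra K M] [IsGalois K M] {n : ℕ} {ξ : M} (hξ : IsPrimitiveRoot ξ n)
    (Q : Ideal (𝓞 K)) [Q.IsMaximal] (hn : (n : 𝓞 K) ∉ Q) :
    Ideal.absNorm Q ^ Module.finrank K M ≡ 1 [MOD n] := by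
  have hn0 : n ≠ 0 := by rintro rfl; exact hn (by simp)
  have : NeZero n := ⟨hn0⟩
  obtain ⟨P, hP, hPQ⟩ := Ideal.exists_maximal_ideal_liesOver_of_isIntegral (S := 𝓞 M) Q
  have : Finite (𝓞 M ⧸ P) := P.finiteQuotientOfFreeOfNeBot (Ideal.IsMaximal.ne_bot_of_isIntegral_int P)
  obtain ⟨σ, hσ⟩ := IsArithFrobAt.exists_of_isInvariant (𝓞 K) Gal(M/K) P
  have hunder : P.under (𝓞 K) = Q := hPQ.over.symm
  have hnP : (n : 𝓞 M) ∉ P := by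
    intro h
    apply hn
    rw [← hunder, Ideal.under_def, Ideal.mem_comap, map_natCast]
    exact h
  have hz := hξ.toInteger_isPrimitiveRoot
  set z := hξ.toInteger
  have h1 : σ • z = z ^ Ideal.absNorm Q := by
    have := AlgHom.IsArithFrobAt.apply_of_pow_eq_one hσ hz.pow_eq_one hnP
    rw [hunder] at this
    exact this
  have h2 : ∀ j : ℕ, σ ^ j • z = z ^ Ideal.absNorm Q ^ j := by
    intro j
    induction j with
    | zero => simp
    | succ j ih => rw [pow_succ', mul_smul, ih, smul_pow', h1, ← pow_mul, ← pow_succ']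
  have h3 := h2 (Nat.card Gal(M/K))
  rw [pow_card_eq_one', one_smul, IsGalois.card_aut_eq_finrank] at h3
  have h4 : z ^ Ideal.absNorm Q ^ Module.finrank K M = z ^ 1 := by rw [← h3, pow_one]
  obtain ⟨u, hu⟩ := hz.isUnit hn0
  have hu' : IsPrimitiveRoot u n := by rwa [← IsPrimitiveRoot.coe_units_iff, hu]
  rw [← hu, ← Units.val_pow_eq_pow_val, ← Units.val_pow_eq_pow_val, Units.val_inj,
    pow_eq_pow_iff_modEq, ← hu'.eq_orderOf] at h4
  exact h4

theorem exists_natAbs_norm_eq {K M L : Type*} [Field K] [NumberField K] [Field M]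
    [NumberField M] [Algebra K M] [IsGalois K M] [Field L] [NumberField L] [Algebra K L]
    (p : ℕ) [hp : Fact p.Prime] {ξ : M} (hξ : IsPrimitiveRoot ξ (p ^ 2))
    (hdeg : Module.finrank K M = p - 1) (b : 𝓞 L) (hb : b ≠ 0) :
    ∃ j w : ℕ, (Algebra.norm ℤ b).natAbs = p ^ j * w ∧ w ^ (p - 1) ≡ 1 [MOD p ^ 2] := by
  have key : ∀ I : Ideal (𝓞 L), I ≠ 0 → ∃ j w : ℕ, Ideal.absNorm I = p ^ j * w ∧
      w ^ (p - 1) ≡ 1 [MOD p ^ 2] := by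
    intro I
    induction I using UniqueFactorizationMonoid.induction_on_prime with
    | h₁ => exact fun h => absurd rfl h
    | h₂ I hI =>
      rw [Ideal.isUnit_iff] at hI
      exact fun _ => ⟨0, 1, by simp [hI], by simp; rfl⟩
    | h₃ I P hI hP IH =>
      intro _
      obtain ⟨j, w, hI1, hw⟩ := IH hI
      have hPp : P.IsPrime := Ideal.isPrime_of_prime hP
      have hPm : P.IsMaximal := hPp.isMaximal hP.ne_zero
      rw [map_mul, hI1]
      by_cases hpP : (p : 𝓞 L) ∈ P
      · have : P.LiesOver (Ideal.span {(p : ℤ)}) := by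
          refine ⟨?_⟩
          have hmax : (Ideal.span {(p : ℤ)}).IsMaximal :=
            ((Ideal.span_singleton_prime (by exact_mod_cast hp.out.ne_zero)).2
              (Nat.prime_iff_prime_int.1 hp.out)).isMaximal
              (by simpa using hp.out.ne_zero)
          refine hmax.eq_of_le (Ideal.IsPrime.under ℤ P).ne_top ?_
          rw [Ideal.span_singleton_le_iff_mem, Ideal.under_def, Ideal.mem_comap]
          simpa using hpP
        refine ⟨P.inertiaDeg ℤ + j, w, ?_, hw⟩
        rw [← Ideal.pow_inertiaDeg p P, pow_add, mul_assoc]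
      · have hQ : (P.under (𝓞 K)).IsMaximal := inferInstance
        have hnQ : ((p ^ 2 : ℕ) : 𝓞 K) ∉ P.under (𝓞 K) := by
          intro h
          rw [Ideal.under_def, Ideal.mem_comap, map_natCast, Nat.cast_pow] at h
          exact hpP (hPp.mem_of_pow_mem _ h)
        have h1 := absNorm_pow_finrank_modEq_one hξ (P.under (𝓞 K)) hnQ
        rw [hdeg] at h1
        refine ⟨j, Ideal.absNorm P * w, by ring, ?_⟩
        rw [mul_pow, ← Ideal.absNorm_pow_inertiaDeg (P.under (𝓞 K)) P, ← pow_mul, mul_comm _ (p - 1),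
          pow_mul]
        simpa using (h1.pow _).mul hw
  obtain ⟨j, w, h1, h2⟩ := key (Ideal.span {b}) (by simpa using hb)
  rw [Ideal.absNorm_span_singleton] at h1
  exact ⟨j, w, h1, h2⟩

/-- A prime `p` is, up to a unit, a perfect power in the subfields of `ℚ(ζ_{p ^ (k + 1)})`: it is
totally ramified. -/
theorem exists_associated_pow_finrank {K M : Type*} [Field K] [NumberField K] [Field M]
    [NumberField M] [Algebra K M] [IsGalois K M] (p k : ℕ) [hp : Fact p.Prime]
    [IsCyclotomicExtension {p ^ (k + 1)} ℚ M] :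
    ∃ P : 𝓞 K, Associated (P ^ Module.finrank ℚ K) (p : 𝓞 K) := by
  have : NeZero (p ^ (k + 1)) := ⟨pow_ne_zero _ hp.out.ne_zero⟩
  have hξ := IsCyclotomicExtension.zeta_spec (p ^ (k + 1)) ℚ M
  have h1 := IsCyclotomicExtension.Rat.map_eq_span_zeta_sub_one_pow p k hξ
  rw [Ideal.map_span, Set.image_singleton, Ideal.span_singleton_pow,
    Ideal.span_singleton_eq_span_singleton, ← Module.finrank_mul_finrank ℚ K M] at h1
  have h2 := (h1.map (RingOfIntegers.norm K : 𝓞 M →* 𝓞 K)).symm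
  have h3 : algebraMap ℤ (𝓞 M) p = algebraMap (𝓞 K) (𝓞 M) (p : 𝓞 K) := by simp
  rw [h3, RingOfIntegers.norm_algebraMap, map_pow, pow_mul] at h2
  have h0 : Module.finrank K M ≠ 0 := Module.finrank_pos.ne'
  exact ⟨_, associated_of_dvd_dvd ((IsIntegrallyClosed.pow_dvd_pow_iff h0).1 h2.dvd)
    ((IsIntegrallyClosed.pow_dvd_pow_iff h0).1 h2.symm.dvd)⟩

/-- Let `F` be a number field of odd degree `n`, with an automorphism `σ` of order `n`, and let
`L / F` be a Galois extension of prime degree `p`.  Suppose that a twisted sum of Fermat quotients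
vanishes on one unit `η` whose images under the nontrivial characters are detected by a
homomorphism `D`, and does not vanish on an element `α` which becomes the `p`-th power of an ideal
in `L`.  If the norms from `L` are suitably restricted modulo `p ^ 2`, then `p` divides the class
number of `L`. -/
theorem dvd_card_classGroup {F L : Type*} [Field F] [NumberField F] [Field L] [NumberField L]
    [Algebra F L] [IsGalois F L] (p : ℕ) [hp : Fact p.Prime] (hp2 : p ≠ 2) {n : ℕ} (hn : Odd n)
    (hF : Module.finrank ℚ F = n) (hFL : Module.finrank F L = p)
    (hL : ∀ b : 𝓞 L, b ≠ 0 → ∃ j w : ℕ, (Algebra.norm ℤ b).natAbs = p ^ j * w ∧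
      w ^ (p - 1) ≡ 1 [MOD p ^ 2])
    (σ : 𝓞 F →+* 𝓞 F) (hσ : σ ^ n = 1)
    (hnorm : ∀ x : 𝓞 F, ((Algebra.norm ℤ x : ℤ) : 𝓞 F) = ∏ k ∈ Finset.range n, (σ ^ k) x)
    (τ : 𝓞 F →+* ℤ_[p]) (θ : 𝓞 F)
    (hθ : ∀ j < n, ∀ k < n, j ≠ k → ¬ (p : ℤ_[p]) ∣ τ ((σ ^ j) θ) - τ ((σ ^ k) θ))
    (q : ℤ_[p] → ZMod p) (hqmul : ∀ x y, x ≠ 0 → y ≠ 0 → q (x * y) = q x + q y)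
    (hq : ∀ (x : ℤ_[p]) (e m a : ℕ), ¬ p ∣ m → m ^ (p - 1) ≡ 1 + p * a [MOD p ^ 2] →
        (p : ℤ_[p]) ^ (e + 2) ∣ x - p ^ e * m → q x = a)
    {w : ZMod p} (hw : IsPrimitiveRoot w n) {i₀ : ℕ} (hi₀ : i₀ ∈ Finset.Ico 1 n)
    (D : Additive (𝓞 F)ˣ →+ ZMod p) (η : (𝓞 F)ˣ)
    (hD : ∀ i ∈ Finset.Ico 1 n,
      ∑ k ∈ Finset.range n, (w ^ i) ^ k * D (.ofMul (Units.map (σ ^ k) η)) ≠ 0)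
    (hη : ∑ k ∈ Finset.range n, (w ^ i₀) ^ k * q (τ ((σ ^ k) η)) = 0)
    (α : 𝓞 F) (hα₀ : ∀ k < n, τ ((σ ^ k) α) ≠ 0) {Q : Ideal (𝓞 L)}
    (hQ : Ideal.span {algebraMap (𝓞 F) (𝓞 L) α} = Q ^ p)
    (hα : ∑ k ∈ Finset.range n, (w ^ i₀) ^ k * q (τ ((σ ^ k) α)) ≠ 0) :
    p ∣ Nat.card (ClassGroup (𝓞 L)) := by
  have hpp := hp.out
  have hn0 : 0 < n := hn.pos
  obtain ⟨_, hdim⟩ := finrank_unitsHom_lt F p hp2 (hF ▸ hn)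
  rw [hF] at hdim
  have hτu : ∀ k (u : (𝓞 F)ˣ), τ ((σ ^ k) u) ≠ 0 := fun k u =>
    ((u.isUnit.map (σ ^ k)).map τ).ne_zero
  set lam : Additive (𝓞 F)ˣ →+ ZMod p :=
    { toFun := fun u => ∑ k ∈ Finset.range n, (w ^ i₀) ^ k * q (τ ((σ ^ k) u.toMul))
      map_zero' := by
        have := hqmul 1 1 one_ne_zero one_ne_zero
        rw [mul_one, left_eq_add] at this
        simp [this]
      map_add' := by
        intro u v
        simp only [toMul_add, Units.val_mul, map_mul]
        rw [← Finset.sum_add_distrib]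
        refine Finset.sum_congr rfl fun k _ => ?_
        rw [hqmul _ _ (hτu k _) (hτu k _), mul_add] } with hlam_def
  have hlam_apply : ∀ u : (𝓞 F)ˣ, lam (.ofMul u) =
      ∑ k ∈ Finset.range n, (w ^ i₀) ^ k * q (τ ((σ ^ k) u)) := fun u => rfl
  let S : Module.End (ZMod p) (Additive (𝓞 F)ˣ →+ ZMod p) :=
    { toFun := fun f => f.comp (Units.map (σ : 𝓞 F →* 𝓞 F)).toAdditive
      map_add' := fun f g => rfl
      map_smul' := fun c f => rfl }
  have hS_apply : ∀ (k : ℕ) f (u : (𝓞 F)ˣ),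
      (S ^ k) f (.ofMul u) = f (.ofMul (Units.map (σ ^ k) u)) := by
    intro k
    induction k with
    | zero =>
      intro f u
      congr 2
    | succ k ih =>
      intro f u
      rw [pow_succ, Module.End.mul_apply, ih]
      change f (.ofMul (Units.map (σ : 𝓞 F →* 𝓞 F) _)) = _
      congr 2
      ext
      simp [pow_succ']
  have hS : S ^ n = 1 := by
    refine LinearMap.ext fun f => AddMonoidHom.ext fun u => ?_
    obtain ⟨u, rfl⟩ := Additive.ofMul.surjective u
    rw [hS_apply, hσ]
    congr 2
  let e : (Additive (𝓞 F)ˣ →+ ZMod p) →ₗ[ZMod p] ZMod p :=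
    { toFun := fun f => f (.ofMul η)
      map_add' := fun f g => rfl
      map_smul' := fun c f => rfl }
  have hlam0 : lam = 0 := by
    refine eq_zero_of_eigenvector S hS hw hdim e D lam (fun i hi => ?_) hi₀ ?_ ?_
    · have := hD i hi
      simpa [e, hS_apply] using this
    · refine AddMonoidHom.ext fun u => ?_
      obtain ⟨u, rfl⟩ := Additive.ofMul.surjective u
      have h1 : (w ^ i₀ • S lam) (.ofMul u) = w ^ i₀ * S lam (.ofMul u) := rfl
      have h2 := hS_apply 1 lam u
      rw [pow_one] at h2
      rw [h1, h2, hlam_apply, hlam_apply, Finset.mul_sum]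
      have hmap : ((Units.map ((σ ^ 1 : 𝓞 F →+* 𝓞 F) : 𝓞 F →* 𝓞 F) u : (𝓞 F)ˣ) : 𝓞 F) = σ u := by
        simp
      have h3 : ∀ k, w ^ i₀ * ((w ^ i₀) ^ k * q (τ ((σ ^ k) (σ u)))) =
          (fun k => (w ^ i₀) ^ k * q (τ ((σ ^ k) u))) (k + 1) := by
        intro k
        have : (σ ^ (k + 1)) u = (σ ^ k) (σ u) := by rw [pow_succ]; rfl
        simp only [this]
        ring
      rw [hmap]
      rw [Finset.sum_congr rfl fun k _ => h3 k]
      have h4 := Finset.sum_range_succ' (fun k => (w ^ i₀) ^ k * q (τ ((σ ^ k) u))) n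
      rw [Finset.sum_range_succ, hσ, ← pow_mul, mul_comm i₀, pow_mul, hw.pow_eq_one, one_pow,
        pow_zero, pow_zero] at h4
      exact (add_right_cancel h4).symm
    · exact hη
  have hα0 : α ≠ 0 := by
    rintro rfl
    exact hα₀ 0 hn0 (by simp)
  obtain ⟨β, hβ, u, hu⟩ := exists_norm_eq_unit_mul_pow_card_classGroup hpp.ne_zero hFL hα0 hQ
  set h := Nat.card (ClassGroup (𝓞 L))
  have hN : ∀ k < n, q (τ ((σ ^ k) (RingOfIntegers.norm F β))) = 0 := by
    intro k hk
    refine fermatQuotient_norm_eq_zero p hp2 q hqmul hq hL (fun k => τ.comp (σ ^ k)) ?_ θ hθ β hβ hk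
    intro x
    have := congrArg τ (hnorm x)
    rw [map_intCast, map_prod] at this
    exact this
  have hqpow : ∀ (x : ℤ_[p]) (m : ℕ), x ≠ 0 → q (x ^ m) = m * q x := by
    intro x m hx
    induction m with
    | zero =>
      have := hqmul 1 1 one_ne_zero one_ne_zero
      rw [mul_one, left_eq_add] at this
      simp [this]
    | succ m ih => rw [pow_succ, hqmul _ _ (pow_ne_zero _ hx) hx, ih]; push_cast; ring
  have hsum : (0 : ZMod p) = lam (.ofMul u) +
      h * ∑ k ∈ Finset.range n, (w ^ i₀) ^ k * q (τ ((σ ^ k) α)) := by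
    rw [hlam_apply, Finset.mul_sum, ← Finset.sum_add_distrib]
    symm
    refine Finset.sum_eq_zero fun k hk => ?_
    have hk := Finset.mem_range.1 hk
    have h1 := hN k hk
    rw [hu, map_mul, map_mul, map_pow, map_pow, hqmul _ _ (hτu k u) (pow_ne_zero _ (hα₀ k hk)),
      hqpow _ _ (hα₀ k hk)] at h1
    linear_combination (w ^ i₀) ^ k * h1
  rw [hlam0, AddMonoidHom.zero_apply, zero_add, eq_comm, mul_eq_zero] at hsum
  exact (ZMod.natCast_eq_zero_iff _ _).1 (hsum.resolve_right hα)

theorem exists_ringHom_ringOfIntegers_cyclotomic {M : Type*} [Field M] [NumberField M] {n : ℕ}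
    [NeZero n] [IsCyclotomicExtension {n} ℚ M] {ζ : M} (hζ : IsPrimitiveRoot ζ n) {R : Type*}
    [CommRing R] {t : R} (ht : (Polynomial.cyclotomic n R).IsRoot t) :
    ∃ f : 𝓞 M →+* R, f hζ.toInteger = t := by
  have hmin : minpoly ℤ hζ.integralPowerBasis.gen = Polynomial.cyclotomic n ℤ := by
    rw [IsPrimitiveRoot.integralPowerBasis_gen]
    rw [Polynomial.cyclotomic_eq_minpoly hζ (NeZero.pos n),
      ← minpoly.algebraMap_eq (RingOfIntegers.coe_injective (K := M)) hζ.toInteger]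
    rfl
  have h : Polynomial.aeval t (minpoly ℤ hζ.integralPowerBasis.gen) = 0 := by
    rw [hmin, Polynomial.aeval_def, Polynomial.eval₂_eq_eval_map, Polynomial.map_cyclotomic]
    exact ht
  refine ⟨(hζ.integralPowerBasis.lift t h : 𝓞 M →ₐ[ℤ] R), ?_⟩
  have := hζ.integralPowerBasis.lift_gen t h
  rw [IsPrimitiveRoot.integralPowerBasis_gen] at this
  exact this

/-- The traces of the roots of unity generate the maximal real subfield, here seen as any subfield
of index two. -/
theorem exists_algebraMap_eq_pow_add_pow {F M : Type*} [Field F] [NumberField F] [Field M]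
    [NumberField M] [Algebra F M] {n : ℕ} [NeZero n] [IsCyclotomicExtension {n} ℚ M]
    (hn : ∀ a : (ZMod n)ˣ, a ^ 2 = 1 → a = 1 ∨ a = -1) (hFM : Module.finrank F M = 2) {ζ : M}
    (hζ : IsPrimitiveRoot ζ n) (j : ℕ) :
    ∃ x : 𝓞 F, algebraMap (𝓞 F) (𝓞 M) x = hζ.toInteger ^ j + hζ.toInteger ^ ((n - 1) * j) := by
  have : IsAbelianGalois ℚ M := IsCyclotomicExtension.isAbelianGalois {n} ℚ M
  have : IsGalois F M := .tower_top_of_isGalois ℚ F M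
  set y := hζ.toInteger ^ j + hζ.toInteger ^ ((n - 1) * j)
  have hy : (y : M) = ζ ^ j + (ζ ^ (n - 1)) ^ j := by
    simp only [y, map_add, map_pow, pow_mul]
    rfl
  have hinv : ζ ^ (n - 1) = ζ⁻¹ := by
    rw [← mul_eq_one_iff_eq_inv₀ (hζ.ne_zero (NeZero.ne n)), ← pow_succ,
      Nat.sub_add_cancel (NeZero.pos n), hζ.pow_eq_one]
  have hmem : (y : M) ∈ Set.range (algebraMap F M) := by
    rw [IsGalois.mem_range_algebraMap_iff_fixed]
    intro g
    have hg2 : g ^ 2 = 1 := by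
      rw [← hFM, ← IsGalois.card_aut_eq_finrank, pow_card_eq_one']
    set g' : Gal(M/ℚ) := g.restrictScalars ℚ
    have hg' : g' ^ 2 = 1 := by
      ext x
      exact DFunLike.congr_fun hg2 x
    set a := IsCyclotomicExtension.Rat.galEquivZMod n M g'
    have ha : a ^ 2 = 1 := by rw [← map_pow, hg', map_one]
    have hgζ : g ζ = ζ ^ a.val.val :=
      IsCyclotomicExtension.Rat.galEquivZMod_apply_of_pow_eq n M g' hζ.pow_eq_one
    have hcase : g ζ = ζ ∨ g ζ = ζ⁻¹ := by
      rcases hn a ha with h | h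
      · left
        have := IsCyclotomicExtension.Rat.galEquivZMod_apply_of_pow_eq n M 1 hζ.pow_eq_one
        rw [map_one, ← h, ← hgζ] at this
        exact this.symm
      · right
        rw [← mul_eq_one_iff_eq_inv₀ (hζ.ne_zero (NeZero.ne n)), hgζ, ← pow_succ,
          hζ.pow_eq_one_iff_dvd, ← ZMod.natCast_eq_zero_iff, h]
        simp
    rw [hy, hinv, map_add, map_pow, map_pow, map_inv₀]
    rcases hcase with h | h
    · rw [h]
    · rw [h, inv_inv, add_comm]
  obtain ⟨x, hx⟩ := hmem
  have hint : IsIntegral ℤ x := by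
    rw [← isIntegral_algebraMap_iff (algebraMap F M).injective, hx]
    exact y.2
  obtain ⟨z, hz⟩ : ∃ z : 𝓞 F, (z : F) = x := ⟨⟨_, hint⟩, rfl⟩
  refine ⟨z, RingOfIntegers.ext ?_⟩
  rw [← hx, ← hz]
  rfl

/-- A subfield of a cyclotomic field with cyclic Galois group has a distinguished generator of its
own Galois group. -/
theorem exists_galois_generator {F M : Type*} [Field F] [NumberField F] [Field M]
    [NumberField M] [Algebra F M] {n : ℕ} [NeZero n] [IsCyclotomicExtension {n} ℚ M]
    (u : (ZMod n)ˣ) (hu : ∀ a, a ∈ Subgroup.zpowers u) {ζ : M} (hζ : IsPrimitiveRoot ζ n) :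
    ∃ (s : 𝓞 M →+* 𝓞 M) (σ : 𝓞 F →+* 𝓞 F), s hζ.toInteger = hζ.toInteger ^ u.val.val ∧
      (∀ x, algebraMap (𝓞 F) (𝓞 M) (σ x) = s (algebraMap (𝓞 F) (𝓞 M) x)) ∧
      σ ^ Module.finrank ℚ F = 1 ∧
      ∀ x : 𝓞 F, ((Algebra.norm ℤ x : ℤ) : 𝓞 F) =
        ∏ k ∈ Finset.range (Module.finrank ℚ F), (σ ^ k) x := by
  classical
  have : IsAbelianGalois ℚ M := IsCyclotomicExtension.isAbelianGalois {n} ℚ M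
  have : IsAbelianGalois ℚ F := IsAbelianGalois.tower_bot ℚ F M
  obtain ⟨e, he⟩ : ∃ e : Gal(M/ℚ) ≃* (ZMod n)ˣ, ∀ g : Gal(M/ℚ), g ζ = ζ ^ (e g).val.val :=
    ⟨IsCyclotomicExtension.Rat.galEquivZMod n M, fun g =>
      IsCyclotomicExtension.Rat.galEquivZMod_apply_of_pow_eq n M g hζ.pow_eq_one⟩
  set g : Gal(M/ℚ) := e.symm u with hg_def
  set h : Gal(F/ℚ) := AlgEquiv.restrictNormalHom F g
  have hg : ∀ a : Gal(M/ℚ), a ∈ Subgroup.zpowers g := by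
    intro a
    obtain ⟨k, hk⟩ := hu (e a)
    exact ⟨k, e.injective (by rw [← hk]; simp [g])⟩
  have hh : ∀ a : Gal(F/ℚ), a ∈ Subgroup.zpowers h := by
    intro a
    obtain ⟨b, rfl⟩ := AlgEquiv.restrictNormalHom_surjective M a
    obtain ⟨k, rfl⟩ := hg b
    exact ⟨k, by simp [h]⟩
  have hord : orderOf h = Module.finrank ℚ F := by
    rw [orderOf_eq_card_of_forall_mem_zpowers hh, IsGalois.card_aut_eq_finrank]
  let s : 𝓞 M →+* 𝓞 M := RingOfIntegers.mapRingHom g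
  let σ : 𝓞 F →+* 𝓞 F := RingOfIntegers.mapRingHom h
  have hσ : ∀ (k : ℕ) x, (((σ ^ k) x : 𝓞 F) : F) = (h ^ k) x := by
    intro k
    induction k with
    | zero => intro x; rfl
    | succ k ih =>
      intro x
      rw [pow_succ', pow_succ', AlgEquiv.mul_apply, ← ih]
      rfl
  refine ⟨s, σ, ?_, ?_, ?_, ?_⟩
  · apply RingOfIntegers.ext
    have h1 := he g
    rw [hg_def, MulEquiv.apply_symm_apply, ← hg_def] at h1
    rw [RingOfIntegers.coe_eq_algebraMap (_ ^ _), map_pow]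
    exact h1
  · intro x
    apply RingOfIntegers.ext
    exact AlgEquiv.restrictNormal_commutes g F x
  · ext x
    rw [hσ, ← hord, pow_orderOf_eq_one]
    rfl
  · intro x
    apply RingOfIntegers.ext
    have h1 : (((Algebra.norm ℤ x : ℤ) : 𝓞 F) : F) = algebraMap ℚ F ((Algebra.norm ℤ x : ℤ) : ℚ) := by
      simp
    rw [h1, Algebra.coe_norm_int, Algebra.norm_eq_prod_automorphisms,
      RingOfIntegers.coe_eq_algebraMap (∏ k ∈ _, _), map_prod, ← IsCyclic.image_range_orderOf hh,
      Finset.prod_image (by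
        intro i hi j hj hij
        exact pow_injOn_Iio_orderOf (by simpa using hi) (by simpa using hj) hij), hord]
    exact Finset.prod_congr rfl fun k _ => (hσ k x).symm

theorem Polynomial.isRoot_cyclotomic_three_pow_five {R : Type*} [CommRing R] {t : R}  :
    (Polynomial.cyclotomic (3 ^ 5) R).IsRoot t ↔ 1 + t ^ 81 + t ^ 162 = 0 := by
  rw [Polynomial.cyclotomic_prime_pow_eq_geom_sum Nat.prime_three, Polynomial.IsRoot.def,
    Polynomial.eval_finsetSum]
  simp [Finset.sum_range_succ, ← pow_mul]

theorem ZMod.units_eq_one_or_neg_one_of_sq_eq_one (a : (ZMod (3 ^ 5))ˣ) (ha : a ^ 2 = 1) :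
    a = 1 ∨ a = -1 := by
  have key : ∀ b : ZMod 243, b ^ 2 = 1 → b = 1 ∨ b = -1 := by decide +kernel
  have h := key a.val (congrArg Units.val ha)
  exact h.imp (fun h => Units.ext h) fun h => Units.ext h

theorem ZMod.exists_units_val_eq_two :
    ∃ u : (ZMod (3 ^ 5))ˣ, u.val.val = 2 ∧ ∀ a, a ∈ Subgroup.zpowers u := by
  refine ⟨⟨2, 122, by decide +kernel, by decide +kernel⟩, rfl, fun a => ?_⟩
  have key : ∀ b : ZMod 243, b * b⁻¹ = 1 → ∃ k : Fin 162, b = 2 ^ k.val := by decide +kernel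
  obtain ⟨k, hk⟩ := key a.val (ZMod.mul_inv_of_unit _ a.isUnit)
  exact ⟨k.val, Units.ext (by push_cast; exact hk.symm)⟩

/-- The integers `ζ ^ j + ζ ^ (-j)` of the maximal real subfield of the `243`rd cyclotomic field
`M`, together with the Galois action on them and their images under ring homomorphisms. -/
theorem exists_real_cyclotomic_integers (F M : Type*) [Field F] [NumberField F] [Field M]
    [NumberField M] [Algebra F M] [IsCyclotomicExtension {3 ^ 5} ℚ M]
    (hFM : Module.finrank F M = 2) (hF : Module.finrank ℚ F = 81) :
    ∃ (z : 𝓞 M) (θ : ℕ → 𝓞 F) (σ : 𝓞 F →+* 𝓞 F), 1 + z ^ 81 + z ^ 162 = 0 ∧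
      (∀ j, algebraMap (𝓞 F) (𝓞 M) (θ j) = z ^ j + z ^ (242 * j)) ∧
      (∀ k j, (σ ^ k) (θ j) = θ (2 ^ k * j)) ∧ σ ^ 81 = 1 ∧
      (∀ x : 𝓞 F, ((Algebra.norm ℤ x : ℤ) : 𝓞 F) = ∏ k ∈ Finset.range 81, (σ ^ k) x) ∧
      ∀ (R : Type) [CommRing R] (t : R), 1 + t ^ 81 + t ^ 162 = 0 →
        ∃ f : 𝓞 F →+* R, ∀ j, f (θ j) = t ^ j + t ^ (242 * j) := by
  have : NeZero (3 ^ 5) := ⟨by norm_num⟩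
  have hζ := IsCyclotomicExtension.zeta_spec (3 ^ 5) ℚ M
  choose θ hθ using exists_algebraMap_eq_pow_add_pow (F := F)
    ZMod.units_eq_one_or_neg_one_of_sq_eq_one hFM hζ
  obtain ⟨u, hu2, hu⟩ := ZMod.exists_units_val_eq_two
  obtain ⟨s, σ, hs, hσ, hσ1, hnorm⟩ := exists_galois_generator (F := F) u hu hζ
  rw [hF] at hσ1 hnorm
  rw [hu2] at hs
  have hinj : Function.Injective (algebraMap (𝓞 F) (𝓞 M)) :=
    FaithfulSMul.algebraMap_injective _ _
  have hσθ : ∀ j, σ (θ j) = θ (2 * j) := fun j => hinj <| by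
    rw [hσ, hθ, hθ, map_add, map_pow, map_pow, hs]
    ring
  refine ⟨hζ.toInteger, θ, σ, ?_, hθ, fun k => ?_, hσ1, hnorm, fun R _ t ht => ?_⟩
  · rw [← Polynomial.isRoot_cyclotomic_three_pow_five]
    exact hζ.toInteger_isPrimitiveRoot.isRoot_cyclotomic (NeZero.pos _)
  · induction k with
    | zero => simp
    | succ k ih =>
      intro j
      rw [pow_succ, RingHom.mul_def, RingHom.comp_apply, hσθ, ih]
      ring_nf
  · obtain ⟨f, hf⟩ := exists_ringHom_ringOfIntegers_cyclotomic hζ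
      (Polynomial.isRoot_cyclotomic_three_pow_five.mpr ht)
    refine ⟨f.comp (algebraMap (𝓞 F) (𝓞 M)), fun j => ?_⟩
    rw [RingHom.comp_apply, hθ, map_add, map_pow, map_pow, hf]
    norm_num

namespace ListPoly

/-- The value at `z` of the polynomial with coefficient list `l`, lowest degree first. -/
def eval {R : Type*} [CommRing R] (z : R) (l : List ℤ) : R :=
  l.foldr (fun (a : ℤ) s => (a : R) + z * s) 0

/-- The sum of two coefficient lists. -/
def plus : List ℤ → List ℤ → List ℤ
  | [], m => m
  | a :: l, [] => a :: l
  | a :: l, b :: m => (a + b) :: plus l m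

/-- The product of a coefficient list by a constant. -/
def smul (c : ℤ) (l : List ℤ) : List ℤ := l.map (c * ·)

/-- The product of a coefficient list by a power of the variable. -/
def shift (n : ℕ) (l : List ℤ) : List ℤ := List.replicate n 0 ++ l

/-- The product of two coefficient lists. -/
def mul : List ℤ → List ℤ → List ℤ
  | [], _ => []
  | a :: l, m => plus (smul a m) (0 :: mul l m)

/-- A partial reduction modulo `1 + X ^ 81 + X ^ 162`. -/
def reduce (l : List ℤ) : List ℤ :=
  plus (l.take 162) (smul (-1) (plus (l.drop 162) (shift 81 (l.drop 162))))

/-- The coefficient list of `∑ c * (X ^ (j % 243) + X ^ (242 * j % 243))`, the sum being over the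
entries `(j, c)` of a list. -/
def ofComb (l : List (ℕ × ℤ)) : List ℤ :=
  l.foldr (fun x s => plus (smul x.2 (plus (shift (x.1 % 243) [1]) (shift (242 * x.1 % 243) [1]))) s)
    []

section
variable {R : Type*} [CommRing R] (z : R)

@[simp] theorem eval_nil : eval z [] = 0 := rfl

@[simp] theorem eval_cons (a : ℤ) (l : List ℤ) : eval z (a :: l) = a + z * eval z l := rfl

@[simp] theorem eval_plus (l m : List ℤ) : eval z (plus l m) = eval z l + eval z m := by
  induction l generalizing m with
  | nil => simp [plus]
  | cons a l ih =>
    cases m with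
    | nil => simp [plus]
    | cons b m => simp [plus, ih]; ring

@[simp] theorem eval_smul (c : ℤ) (l : List ℤ) : eval z (smul c l) = c * eval z l := by
  induction l with
  | nil => simp [smul]
  | cons a l ih =>
    rw [smul] at ih ⊢
    simp [ih]
    ring

@[simp] theorem eval_shift (n : ℕ) (l : List ℤ) : eval z (shift n l) = z ^ n * eval z l := by
  induction n with
  | zero => simp [shift]
  | succ n ih =>
    rw [shift] at ih ⊢
    simp [List.replicate_succ, ih]
    ring

@[simp] theorem eval_mul (l m : List ℤ) : eval z (mul l m) = eval z l * eval z m := by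
  induction l with
  | nil => simp [mul]
  | cons a l ih => simp [mul, ih]; ring

theorem eval_append (l m : List ℤ) : eval z (l ++ m) = eval z l + z ^ l.length * eval z m := by
  induction l with
  | nil => simp
  | cons a l ih => simp [ih]; ring

theorem eval_reduce (hz : 1 + z ^ 81 + z ^ 162 = 0) (l : List ℤ) :
    eval z (reduce l) = eval z l := by
  have h : eval z l = eval z (l.take 162) + z ^ 162 * eval z (l.drop 162) := by
    rcases le_total l.length 162 with hl | hl
    · simp [List.take_of_length_le hl, List.drop_of_length_le hl]
    · conv_lhs => rw [← List.take_append_drop 162 l, eval_append, List.length_take, min_eq_left hl]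
  rw [h]
  simp [reduce]
  linear_combination - eval z (l.drop 162) * hz

theorem eval_eq_zero_of_all {l : List ℤ} (hl : l.all (· == 0)) : eval z l = 0 := by
  induction l with
  | nil => rfl
  | cons a l ih =>
    simp only [List.all_cons, Bool.and_eq_true, beq_iff_eq] at hl
    simp [hl.1, ih hl.2]

end

/-- The linear combination of the `θ j` given by a list of pairs `(j, c)`. -/
def comb {R : Type*} [CommRing R] (θ : ℕ → R) (l : List (ℕ × ℤ)) : R :=
  (l.map fun x => (x.2 : R) * θ x.1).sum

theorem map_comb {R S : Type*} [CommRing R] [CommRing S] (f : R →+* S) (θ : ℕ → R)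
    (l : List (ℕ × ℤ)) : f (comb θ l) = comb (fun j => f (θ j)) l := by
  simp [comb, map_list_sum, Function.comp_def]

theorem pow_mod_of_pow_eq_one {R : Type*} [Monoid R] {z : R} {n : ℕ} (hz : z ^ n = 1) (m : ℕ) :
    z ^ (m % n) = z ^ m := by
  conv_rhs => rw [← Nat.mod_add_div m n, pow_add, pow_mul, hz, one_pow, mul_one]

theorem pow_eq_one_of_isRoot {R : Type*} [CommRing R] {z : R} (hz : 1 + z ^ 81 + z ^ 162 = 0) :
    z ^ 243 = 1 := by
  linear_combination (z ^ 81 - 1) * hz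

theorem eval_ofComb {R : Type*} [CommRing R] {z : R} (hz : 1 + z ^ 81 + z ^ 162 = 0)
    (l : List (ℕ × ℤ)) : eval z (ofComb l) = comb (fun j => z ^ j + z ^ (242 * j)) l := by
  have hz' := pow_eq_one_of_isRoot hz
  induction l with
  | nil => rfl
  | cons a l ih =>
    rw [ofComb] at ih ⊢
    rw [comb] at ih ⊢
    simp [ih, pow_mod_of_pow_eq_one hz']

theorem comb_mul_comb {R S : Type*} [CommRing R] [CommRing S] {f : R →+* S}
    (hf : Function.Injective f) {z : S} (hz : 1 + z ^ 81 + z ^ 162 = 0) {θ : ℕ → R}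
    (hθ : ∀ j, f (θ j) = z ^ j + z ^ (242 * j)) (A B : List (ℕ × ℤ)) (n : ℤ)
    (h : (reduce^[4] (plus (mul (ofComb A) (ofComb B)) [-n])).all (· == 0)) :
    comb θ A * comb θ B = n := by
  apply hf
  have h' := eval_eq_zero_of_all z h
  simp only [Function.iterate_succ, Function.iterate_zero, Function.comp_apply, id_eq,
    eval_reduce z hz, eval_plus, eval_mul, eval_ofComb hz] at h'
  simp only [map_mul, map_comb, hθ, map_intCast]
  simp at h'
  linear_combination h'

end ListPoly

section

open ListPoly

/-- An element of norm a power of `238627`, as a combination of the `ζ ^ j + ζ ^ (-j)`. -/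
def alphaList : List (ℕ × ℤ) := [(12, 1), (37, -1), (57, 1), (74, 1)]

/-- The complementary divisor of `238627`. -/
def alphaCompl : List (ℕ × ℤ) := (List.range' 41 81).zip
  [2151665, -1345603, 712660, -145827, -623286, 1189023, -1362348, 1363180, -1362840, 1235102,
  -948180, 672973, -360603, -12563, 492004, -1422222, 2263760, -2148091, 1592350, -1108114, 79688,
  956889, -1320729, 1278284, -1347488, 1370207, -1174924, 660279, -331154, 84709, 367844, -852424,
  1374097, -1802475, 1894839, -1753365, 1305629, -165667, -927616, 1284663, -1593539, 1824387,
  -1603236, 927448, -396332, 139544, 185826, -685233, 814203, -1064713, 1529213, -1790488, 1691369,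
  -1113413, 6006, 856471, -1415459, 1911448, -2063849, 1561901, -1030013, 589164, -132023, -688732,
  1047009, -908416, 962701, -1367791, 1337317, -1258862, 998957, -212732, -691137, 1527082,
  -2237545, 2119315, -1635705, 1183875, -606947, -286217, 1006431]

theorem alpha_mul_compl {R S : Type*} [CommRing R] [CommRing S] {f : R →+* S}
    (hf : Function.Injective f) {z : S} (hz : 1 + z ^ 81 + z ^ 162 = 0) {θ : ℕ → R}
    (hθ : ∀ j, f (θ j) = z ^ j + z ^ (242 * j)) :
    comb θ alphaList * comb θ alphaCompl = 238627 :=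
  mod_cast comb_mul_comb hf hz hθ alphaList alphaCompl 238627 (by decide +kernel)

theorem theta_mul_inv {R S : Type*} [CommRing R] [CommRing S] {f : R →+* S}
    (hf : Function.Injective f) {z : S} (hz : 1 + z ^ 81 + z ^ 162 = 0) {θ : ℕ → R}
    (hθ : ∀ j, f (θ j) = z ^ j + z ^ (242 * j)) : IsUnit (θ 1) := by
  have h := comb_mul_comb hf hz hθ [(1, 1)] ((List.range 61).map fun i => (4 * i + 1, 1)) 1
    (by decide +kernel)
  refine IsUnit.of_mul_eq_one (comb θ ((List.range 61).map fun i => (4 * i + 1, 1))) ?_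
  simpa [comb] using h

instance fact_prime_238627 : Fact (Nat.Prime 238627) := ⟨by norm_num⟩

theorem prime_579863611 : Nat.Prime 579863611 := by
  have h3 : (3 : ZMod 579863611) ^ 579863610 = 1 := by reduce_mod_char
  refine lucas_primality _ 3 h3 fun q hq hdvd => ?_
  rw [show 579863611 - 1 = 2 * 3 ^ 5 * 5 * 238627 by norm_num] at hdvd ⊢
  have hq' : q = 2 ∨ q = 3 ∨ q = 5 ∨ q = 238627 := by
    rcases hq.dvd_mul.mp hdvd with h | h
    · rcases hq.dvd_mul.mp h with h | h
      · rcases hq.dvd_mul.mp h with h | h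
        · exact .inl ((Nat.prime_dvd_prime_iff_eq hq (by norm_num)).mp h)
        · exact .inr (.inl ((Nat.prime_dvd_prime_iff_eq hq (by norm_num)).mp (hq.dvd_of_dvd_pow h)))
      · exact .inr (.inr (.inl ((Nat.prime_dvd_prime_iff_eq hq (by norm_num)).mp h)))
    · exact .inr (.inr (.inr ((Nat.prime_dvd_prime_iff_eq hq (by norm_num)).mp h)))
  rcases hq' with rfl | rfl | rfl | rfl
  all_goals
    norm_num only
    reduce_mod_char
    decide +kernel

instance fact_prime_579863611 : Fact (Nat.Prime 579863611) := ⟨prime_579863611⟩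

theorem PadicInt.exists_root_near {p : ℕ} [hp : Fact p.Prime] {n t : ℕ} (e : ℕ) (hn : ¬ p ∣ n)
    (hpn : p ^ e ≡ 1 [MOD n]) (ht : t ^ n ≡ 1 [MOD p ^ (e + 1)]) :
    ∃ T : ℤ_[p], T ^ n = 1 ∧ (p : ℤ_[p]) ^ (e + 1) ∣ T - t := by
  have hn0 : n ≠ 0 := by rintro rfl; simp at hn
  have hdvd : (p : ℤ_[p]) ^ (e + 1) ∣ (t : ℤ_[p]) ^ n - 1 := by
    have := map_dvd (Int.castRingHom ℤ_[p]) (Nat.modEq_iff_dvd.mp ht.symm)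
    simpa using this
  have hpt : p.Coprime t := by
    refine ((Nat.Prime.coprime_iff_not_dvd hp.out).mpr fun h => ?_)
    have h1 := (ht.of_dvd (dvd_pow_self p e.succ_ne_zero)).symm
    have h2 : p ∣ 1 := (h1.dvd_iff dvd_rfl).mpr (dvd_pow h hn0)
    exact hp.out.one_lt.ne' (Nat.dvd_one.mp h2)
  have hpn' : p.Coprime n := (Nat.Prime.coprime_iff_not_dvd hp.out).mpr hn
  have hder : ‖(Polynomial.X ^ n - 1 : Polynomial ℤ_[p]).derivative.aeval (t : ℤ_[p])‖ = 1 := by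
    simp only [Polynomial.derivative_sub, map_pow, Polynomial.aeval_X,
      Polynomial.derivative_X_pow, Polynomial.derivative_one, sub_zero, map_mul, map_natCast,
      norm_mul, norm_pow, PadicInt.norm_natCast_eq_one_iff.mpr hpt,
      PadicInt.norm_natCast_eq_one_iff.mpr hpn', one_pow, mul_one]
  obtain ⟨T, hT, hTt, -⟩ := hensels_lemma (R := ℤ_[p]) (F := Polynomial.X ^ n - 1)
      (a := (t : ℤ_[p])) (by
    rw [hder, one_pow, PadicInt.norm_lt_one_iff_dvd]
    simpa using (dvd_pow_self _ e.succ_ne_zero).trans hdvd)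
  rw [hder, PadicInt.norm_lt_one_iff_dvd] at hTt
  have hT1 : T ^ n = 1 := by simpa [sub_eq_zero] using hT
  refine ⟨T, hT1, ?_⟩
  have h1 := dvd_sub_pow_of_dvd_sub hTt e
  have hT2 : T ^ p ^ e = T := by
    rw [← pow_mod_of_pow_eq_one hT1, hpn, pow_mod_of_pow_eq_one hT1, pow_one]
  have ht2 : (p : ℤ_[p]) ^ (e + 1) ∣ (t : ℤ_[p]) ^ p ^ e - t := by
    have hle : 1 ≤ p ^ e := Nat.one_le_pow _ _ hp.out.pos
    obtain ⟨m, hm⟩ := (Nat.modEq_iff_dvd' hle).mp hpn.symm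
    rw [show p ^ e = n * m + 1 by lia, pow_succ (t : ℤ_[p]), pow_mul]
    have h2 := (hdvd.trans (sub_dvd_pow_sub_pow ((t : ℤ_[p]) ^ n) 1 m)).mul_right (t : ℤ_[p])
    rwa [one_pow, sub_mul, one_mul] at h2
  rw [hT2] at h1
  simpa using dvd_add h1 ht2

/-- The residue of `t ^ j + t ^ (-j)` modulo `N`, for `t ^ 243 = 1`. -/
def thetaMod (N t j : ℕ) : ℕ := (t ^ (j % 243) + t ^ (242 * j % 243)) % N

theorem thetaMod_cast {N t : ℕ} (ht : (t : ZMod N) ^ 243 = 1) (j : ℕ) :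
    (thetaMod N t j : ZMod N) = (t : ZMod N) ^ j + (t : ZMod N) ^ (242 * j) := by
  simp [thetaMod, pow_mod_of_pow_eq_one ht]

/-- The discrete logarithms of the `2430`-th powers of the `t ^ 2 ^ k + t ^ (-2 ^ k)` modulo
`579863611`, where `t = 87736155`. -/
def thetaLog : List ℕ :=
  [168264, 28666, 209018, 137397, 7638, 203536, 15175, 124444, 201166, 55422, 114695, 114599,
  90650, 140506, 140444, 163700, 184377, 178945, 224946, 97421, 118913, 184793, 42117, 37148,
  41990, 73025, 128733, 71310, 31427, 112183, 180616, 91171, 119330, 29670, 228659, 180814,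
  120964, 79669, 103656, 119095, 64402, 36477, 33559, 79918, 68899, 16160, 138502, 160790,
  114652, 146677, 33254, 89091, 11160, 90698, 188531, 121747, 48916, 32308, 87135, 103207,
  222878, 56681, 105207, 216570, 10190, 103127, 15124, 234726, 118260, 126777, 52258, 41262,
  221217, 34450, 153991, 224125, 91458, 168424, 42490, 162438, 65171]

/-- The power `m ^ 238626` modulo `238627 ^ 2`. -/
def fermatPow (m : ℕ) : ℕ := (m ^ 486 % 238627 ^ 2) ^ 491 % 238627 ^ 2

/-- The image of `m ^ 238626` under `1 + 238627 * a ↦ a`. -/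
def fermatQuot (m : ℕ) : ℕ := fermatPow m / 238627

/-- The residue modulo `238627 ^ 3` of the `k`-th conjugate of the element given by
`alphaList`. -/
def alphaMod (k : ℕ) : ℕ :=
  (thetaMod (238627 ^ 3) 1270466375612716 (2 ^ k * 12) +
    (238627 ^ 3 - 1) * thetaMod (238627 ^ 3) 1270466375612716 (2 ^ k * 37) +
    thetaMod (238627 ^ 3) 1270466375612716 (2 ^ k * 57) +
    thetaMod (238627 ^ 3) 1270466375612716 (2 ^ k * 74)) % 238627 ^ 3

theorem thetaMod_pow_eq : ∀ k < 81, thetaMod 579863611 87736155 (2 ^ k) ^ 2430 % 579863611 =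
    ((91997557 ^ 512 % 579863611) ^ (thetaLog.getD k 0 / 512) *
      91997557 ^ (thetaLog.getD k 0 % 512)) % 579863611 := by
  decide +kernel

theorem sum_thetaLog_ne_zero : ∀ i ∈ Finset.Ico 1 81, (∑ k ∈ Finset.range 81,
    17730 ^ (i * k % 81) * thetaLog.getD k 0) % 238627 ≠ 0 := by
  decide +kernel

theorem thetaMod_injOn : ∀ j < 81, ∀ k < 81, j ≠ k →
    thetaMod (238627 ^ 3) 1270466375612716 (2 ^ j) % 238627 ≠
      thetaMod (238627 ^ 3) 1270466375612716 (2 ^ k) % 238627 := by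
  decide +kernel

theorem fermatPow_thetaMod : ∀ k < 81,
    fermatPow (thetaMod (238627 ^ 3) 1270466375612716 (2 ^ k)) % 238627 = 1 := by
  decide +kernel

theorem sum_fermatQuot_thetaMod : (∑ k ∈ Finset.range 81,
    17730 ^ k * fermatQuot (thetaMod (238627 ^ 3) 1270466375612716 (2 ^ k))) % 238627 = 0 := by
  decide +kernel

theorem fermatPow_alphaMod : ∀ k < 81,
    fermatPow (alphaMod k / 238627 ^ (if k = 0 then 1 else 0)) % 238627 = 1 := by
  decide +kernel

theorem alphaMod_div_mul : ∀ k < 81,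
    238627 ^ (if k = 0 then 1 else 0) * (alphaMod k / 238627 ^ (if k = 0 then 1 else 0)) =
      alphaMod k := by
  decide +kernel

theorem alphaMod_ne_zero : ∀ k < 81, alphaMod k % 238627 ^ 3 ≠ 0 := by
  decide +kernel

theorem sum_fermatQuot_alphaMod : (∑ k ∈ Finset.range 81,
    17730 ^ k * fermatQuot (alphaMod k / 238627 ^ (if k = 0 then 1 else 0))) % 238627 ≠ 0 := by
  decide +kernel

theorem isPrimitiveRoot_17730 : IsPrimitiveRoot (17730 : ZMod 238627) 81 := by
  have h : orderOf (17730 : ZMod 238627) = 3 ^ (3 + 1) :=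
    orderOf_eq_prime_pow (by decide +kernel) (by decide +kernel)
  exact IsPrimitiveRoot.iff_orderOf.mpr h

theorem exists_discreteLog_unitsHom {A : Type*} [CommRing A] {ℓ p m : ℕ} [hℓ : Fact ℓ.Prime]
    [hp : Fact p.Prime] (hm : ℓ - 1 = m * p) (f : A →+* ZMod ℓ) {g : ZMod ℓ} (hg : g ^ p = 1)
    (hg1 : g ≠ 1) :
    ∃ D : Additive Aˣ →+ ZMod p, ∀ (u : Aˣ) (d : ℕ), f u ^ m = g ^ d → D (.ofMul u) = d := by
  obtain ⟨g, rfl⟩ : IsUnit g := .of_pow_eq_one hg hp.out.ne_zero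
  have hord : orderOf g = p := orderOf_eq_prime (Units.ext (by simpa using hg))
    fun h => hg1 (by simp [h])
  obtain ⟨L, hL, hLg⟩ := exists_discreteLog hord
  have hpow : ∀ x : (ZMod ℓ)ˣ, (x ^ m) ^ p = 1 := fun x => by
    rw [← pow_mul, ← hm, ZMod.units_pow_card_sub_one_eq_one]
  refine ⟨AddMonoidHom.mk' (fun u => L (Units.map f u.toMul ^ m)) fun u v => ?_, fun u d h => ?_⟩
  · rw [toMul_add, map_mul, mul_pow, hL _ _ (hpow _) (hpow _)]
  · rw [← hLg]
    exact congrArg L (Units.ext (by simpa using h))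

theorem exists_thetaLog_hom {A : Type} [CommRing A] {θ : ℕ → A}
    (hf : ∀ (R : Type) [CommRing R] (t : R), 1 + t ^ 81 + t ^ 162 = 0 →
      ∃ f : A →+* R, ∀ j, f (θ j) = t ^ j + t ^ (242 * j)) :
    ∃ D : Additive Aˣ →+ ZMod 238627,
      ∀ u : Aˣ, ∀ k < 81, (u : A) = θ (2 ^ k) → D (.ofMul u) = thetaLog.getD k 0 := by
  have ht : 1 + ((87736155 : ℕ) : ZMod 579863611) ^ 81 + ((87736155 : ℕ) : ZMod 579863611) ^ 162 = 0 := by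
    reduce_mod_char
  obtain ⟨f, hf⟩ := hf _ _ ht
  obtain ⟨D, hD⟩ := exists_discreteLog_unitsHom (ℓ := 579863611) (p := 238627) (m := 2430)
    (by norm_num) f (g := ((91997557 : ℕ) : ZMod 579863611)) (by reduce_mod_char)
    (by decide +kernel)
  refine ⟨D, fun u k hk hu => hD _ _ ?_⟩
  rw [hu, hf, ← thetaMod_cast (pow_eq_one_of_isRoot ht), ← Nat.cast_pow, ← Nat.cast_pow,
    ZMod.natCast_eq_natCast_iff', thetaMod_pow_eq k hk]
  conv_rhs => rw [← Nat.div_add_mod (thetaLog.getD k 0) 512, pow_add, pow_mul]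
  rw [Nat.mul_mod, Nat.pow_mod, Nat.mod_mod, ← Nat.pow_mod, ← Nat.mul_mod]

theorem exists_padic_hom {A : Type} [CommRing A] {θ : ℕ → A}
    (hf : ∀ (R : Type) [CommRing R] (t : R), 1 + t ^ 81 + t ^ 162 = 0 →
      ∃ f : A →+* R, ∀ j, f (θ j) = t ^ j + t ^ (242 * j)) :
    ∃ f : A →+* ℤ_[238627], ∀ x : A, ∀ a : ℕ, (∀ g : A →+* ZMod (238627 ^ 3),
      (∀ j, g (θ j) = ((1270466375612716 : ℕ) : ZMod (238627 ^ 3)) ^ j +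
        ((1270466375612716 : ℕ) : ZMod (238627 ^ 3)) ^ (242 * j)) → g x = a) →
      (238627 : ℤ_[238627]) ^ 3 ∣ f x - a := by
  obtain ⟨T, hT1, hT⟩ := PadicInt.exists_root_near (p := 238627) (n := 243)
    (t := 1270466375612716) 2 (by norm_num) (by decide +kernel) (by decide +kernel)
  have hdvd : ∀ x : ℤ_[238627], (238627 : ℤ_[238627]) ^ 3 ∣ x ↔ PadicInt.toZModPow 3 x = 0 := by
    intro x
    rw [← RingHom.mem_ker, PadicInt.ker_toZModPow, Ideal.mem_span_singleton]
    norm_num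
  have hTt : PadicInt.toZModPow 3 T = ((1270466375612716 : ℕ) : ZMod (238627 ^ 3)) := by
    have h := (hdvd (T - (1270466375612716 : ℕ))).mp (by simpa using hT)
    rwa [map_sub, map_natCast, sub_eq_zero] at h
  have hroot : 1 + T ^ 81 + T ^ 162 = 0 := by
    have h : (T ^ 81 - 1) * (1 + T ^ 81 + T ^ 162) = 0 := by linear_combination hT1
    refine (mul_eq_zero.mp h).resolve_left fun h0 => ?_
    have h1 := congrArg (PadicInt.toZModPow 3) h0
    rw [map_sub, map_pow, map_one, map_zero, hTt] at h1
    revert h1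
    decide +kernel
  obtain ⟨f, hf⟩ := hf _ T hroot
  refine ⟨f, fun x a h => ?_⟩
  rw [hdvd, map_sub, map_natCast, sub_eq_zero]
  refine h ((PadicInt.toZModPow 3).comp f) fun j => ?_
  rw [RingHom.comp_apply, hf, map_add, map_pow, map_pow, hTt]

theorem pow_mul_modEq_pow_mod (m N a b : ℕ) : m ^ (a * b) ≡ (m ^ a % N) ^ b % N [MOD N] := by
  rw [pow_mul]
  exact ((Nat.mod_modEq _ _).trans ((Nat.mod_modEq _ _).pow b)).symm

theorem not_dvd_of_pow_modEq {m n N p v : ℕ} (h : m ^ n ≡ v [MOD N]) (hp : p ∣ N) (hn : n ≠ 0)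
    (hv : ¬ p ∣ v) : ¬ p ∣ m := fun hm =>
  hv (((h.of_dvd hp).dvd_iff dvd_rfl).mp (dvd_pow hm hn))

theorem fermatQuot_spec {m : ℕ} (hm : fermatPow m % 238627 = 1) :
    ¬ 238627 ∣ m ∧ m ^ (238627 - 1) ≡ 1 + 238627 * fermatQuot m [MOD 238627 ^ 2] := by
  have h : 1 + 238627 * fermatQuot m = fermatPow m := by
    rw [fermatQuot, ← hm, Nat.mod_add_div]
  have key : m ^ (238627 - 1) ≡ fermatPow m [MOD 238627 ^ 2] := by
    rw [show 238627 - 1 = 486 * 491 by norm_num]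
    exact pow_mul_modEq_pow_mod m (238627 ^ 2) 486 491
  exact ⟨not_dvd_of_pow_modEq key (dvd_pow_self _ two_ne_zero) (Nat.sub_ne_zero_of_lt (by simp))
    (by lia), h ▸ key⟩

theorem NumberField.RingOfIntegers.natCast_dvd_of_algebraMap_dvd {F M : Type*} [Field F]
    [NumberField F] [Field M] [NumberField M] [Algebra F M] {n : ℕ} (hn : n ≠ 0) {x : 𝓞 F}
    (h : (n : 𝓞 M) ∣ algebraMap (𝓞 F) (𝓞 M) x) : (n : 𝓞 F) ∣ x := by
  obtain ⟨c, hc⟩ := h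
  have hnF : (n : F) ≠ 0 := Nat.cast_ne_zero.mpr hn
  have hnM : (n : M) ≠ 0 := Nat.cast_ne_zero.mpr hn
  have h1 : algebraMap F M (x / n) = c := by
    rw [map_div₀, map_natCast, div_eq_iff hnM, mul_comm]
    have := congrArg (algebraMap (𝓞 M) M) hc
    rw [map_mul, map_natCast] at this
    rw [← this]
    rfl
  have h2 : IsIntegral ℤ ((x : F) / n) := by
    rw [← isIntegral_algebraMap_iff (algebraMap F M).injective, h1]
    exact RingOfIntegers.isIntegral_coe c
  obtain ⟨d, hd⟩ := (IsIntegralClosure.isIntegral_iff (A := 𝓞 F)).mp h2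
  refine ⟨d, RingOfIntegers.ext ?_⟩
  rw [RingOfIntegers.coe_eq_algebraMap ((n : 𝓞 F) * d), map_mul, map_natCast, hd]
  exact (mul_div_cancel₀ _ hnF).symm

theorem natCast_dvd_add_pow_sub_add {R : Type*} [CommRing R] {p : ℕ} (hp : p.Prime) {x y : R}
    (hx : (p : R) ∣ x ^ p - x) (hy : (p : R) ∣ y ^ p - y) : (p : R) ∣ (x + y) ^ p - (x + y) := by
  obtain ⟨r, hr⟩ := exists_add_pow_prime_eq hp x y
  obtain ⟨a, ha⟩ := hx
  obtain ⟨b, hb⟩ := hy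
  refine ⟨a + b + x * y * r, ?_⟩
  linear_combination hr + ha + hb

theorem isCoprime_of_mul_eq_natCast {R : Type*} [CommRing R] [IsDomain R] {p : ℕ} (hp : 2 ≤ p)
    {a b : R} (hab : a * b = p) (hpR : (p : R) ≠ 0) (h : (p : R) ∣ a ^ p - a) : IsCoprime a b := by
  obtain ⟨c, hc⟩ := h
  obtain ⟨m, rfl⟩ := Nat.exists_eq_add_of_le' hp
  refine ⟨a ^ m, -c, mul_left_cancel₀ (left_ne_zero_of_mul (hab ▸ hpR)) ?_⟩
  linear_combination hc - c * hab

theorem isCoprime_alpha {F M : Type*} [Field F] [NumberField F] [Field M] [NumberField M]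
    [Algebra F M] {p : ℕ} (hp : p.Prime) (hp243 : p % 243 = 1) {z : 𝓞 M}
    (hz : 1 + z ^ 81 + z ^ 162 = 0) {θ : ℕ → 𝓞 F}
    (hθ : ∀ j, algebraMap (𝓞 F) (𝓞 M) (θ j) = z ^ j + z ^ (242 * j)) {b : 𝓞 F}
    (hb : comb θ alphaList * b = p) : IsCoprime (comb θ alphaList) b := by
  have hp0 : (p : 𝓞 F) ≠ 0 := Nat.cast_ne_zero.mpr hp.ne_zero
  refine isCoprime_of_mul_eq_natCast hp.two_le hb hp0
    (RingOfIntegers.natCast_dvd_of_algebraMap_dvd (M := M) hp.ne_zero ?_)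
  have hzp : z ^ p = z := by
    rw [← pow_mod_of_pow_eq_one (pow_eq_one_of_isRoot hz), hp243, pow_one]
  have hpow : ∀ j, (p : 𝓞 M) ∣ (z ^ j) ^ p - z ^ j := fun j => by
    rw [← pow_mul, mul_comm, pow_mul, hzp, sub_self]
    exact dvd_zero _
  have h1 : ∀ j, (p : 𝓞 M) ∣ (z ^ j + z ^ (242 * j)) ^ p - (z ^ j + z ^ (242 * j)) := fun j =>
    natCast_dvd_add_pow_sub_add hp (hpow _) (hpow _)
  have hodd : Odd p := by
    refine hp.odd_of_ne_two ?_
    rintro rfl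
    norm_num at hp243
  have hneg : ∀ x : 𝓞 M, (p : 𝓞 M) ∣ x ^ p - x → (p : 𝓞 M) ∣ (-x) ^ p - -x := fun x hx => by
    rw [hodd.neg_pow, neg_sub_neg, ← dvd_neg, neg_sub]
    exact hx
  rw [map_sub, map_pow, map_comb]
  simp only [hθ, comb, alphaList, List.map_cons, List.map_nil, List.sum_cons, List.sum_nil,
    Int.cast_one, one_mul, Int.cast_neg, neg_mul, add_zero]
  exact natCast_dvd_add_pow_sub_add hp (h1 _) (natCast_dvd_add_pow_sub_add hp (hneg _ (h1 _))
    (natCast_dvd_add_pow_sub_add hp (h1 _) (h1 _)))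

theorem exists_span_alpha_eq_pow {F K L M₁ M₂ : Type*} [Field F] [NumberField F] [Field K]
    [NumberField K] [Field L] [NumberField L] [Field M₁] [NumberField M₁] [Field M₂]
    [NumberField M₂] [Algebra F M₁] [Algebra F L] [Algebra K M₂] [Algebra K L] {p : ℕ}
    [hp : Fact p.Prime] (hp243 : p % 243 = 1) [IsCyclotomicExtension {p ^ 2} ℚ M₂] [IsGalois K M₂]
    (hK : Module.finrank ℚ K = p) {z : 𝓞 M₁} (hz : 1 + z ^ 81 + z ^ 162 = 0) {θ : ℕ → 𝓞 F}
    (hθ : ∀ j, algebraMap (𝓞 F) (𝓞 M₁) (θ j) = z ^ j + z ^ (242 * j)) {b : 𝓞 F}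
    (hb : comb θ alphaList * b = p) :
    ∃ Q : Ideal (𝓞 L), Ideal.span {algebraMap (𝓞 F) (𝓞 L) (comb θ alphaList)} = Q ^ p := by
  obtain ⟨P, hP⟩ := exists_associated_pow_finrank (K := K) (M := M₂) p 1
  rw [hK] at hP
  have hcop := (isCoprime_alpha hp.out hp243 hz hθ hb).map (algebraMap (𝓞 F) (𝓞 L))
  refine Ideal.exists_span_singleton_eq_pow hcop (P := algebraMap (𝓞 K) (𝓞 L) P) ?_
  rw [← map_mul, hb, map_natCast, ← map_pow]
  simpa using (hP.map (algebraMap (𝓞 K) (𝓞 L))).symm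

theorem alphaMod_cast {A : Type*} [CommRing A] {θ : ℕ → A} (k : ℕ)
    (g : A →+* ZMod (238627 ^ 3))
    (ht : ((1270466375612716 : ℕ) : ZMod (238627 ^ 3)) ^ 243 = 1)
    (hg : ∀ j, g (θ j) = ((1270466375612716 : ℕ) : ZMod (238627 ^ 3)) ^ j +
      ((1270466375612716 : ℕ) : ZMod (238627 ^ 3)) ^ (242 * j)) :
    g (comb (fun j => θ (2 ^ k * j)) alphaList) = alphaMod k := by
  have hneg : ((238627 ^ 3 - 1 : ℕ) : ZMod (238627 ^ 3)) = -1 := by decide +kernel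
  simp only [map_comb, hg, ← thetaMod_cast ht, alphaMod, ZMod.natCast_mod, Nat.cast_add,
    Nat.cast_mul, hneg]
  simp only [comb, alphaList, List.map_cons, List.map_nil, List.sum_cons, List.sum_nil,
    Int.cast_one, one_mul, Int.cast_neg, neg_mul, add_zero]
  ring

theorem dvd_classNumber_abstract {F K L M₁ M₂ : Type} [Field F] [NumberField F] [Field K]
    [NumberField K] [Field L] [NumberField L] [Field M₁] [NumberField M₁] [Field M₂]
    [NumberField M₂] [Algebra F M₁] [Algebra F L] [Algebra K M₂] [Algebra K L]
    [IsCyclotomicExtension {3 ^ 5} ℚ M₁] [IsCyclotomicExtension {238627 ^ 2} ℚ M₂]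
    [IsGalois F L] (hF : Module.finrank ℚ F = 3 ^ 4) (hK : Module.finrank ℚ K = 238627)
    (hFL : Module.finrank F L = 238627) : 238627 ∣ Nat.card (ClassGroup (𝓞 L)) := by
  have : NeZero (3 ^ 5) := ⟨by norm_num⟩
  have : NeZero (238627 ^ 2) := ⟨by norm_num⟩
  have hM₁ : Module.finrank ℚ M₁ = 162 := by
    rw [IsCyclotomicExtension.Rat.finrank (3 ^ 5) M₁, Nat.totient_prime_pow_succ Nat.prime_three]
    norm_num
  have hM₂ : Module.finrank ℚ M₂ = 238627 * (238627 - 1) := by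
    rw [IsCyclotomicExtension.Rat.finrank (238627 ^ 2) M₂,
      Nat.totient_prime_pow_succ (Fact.out : Nat.Prime 238627), pow_one]
  have hFM : Module.finrank F M₁ = 2 := by
    have := Module.finrank_mul_finrank ℚ F M₁
    rw [hF, hM₁] at this
    lia
  have hKM : Module.finrank K M₂ = 238627 - 1 := by
    have := Module.finrank_mul_finrank ℚ K M₂
    rw [hK, hM₂] at this
    exact Nat.eq_of_mul_eq_mul_left (by norm_num) this
  have : IsGalois ℚ M₂ := IsCyclotomicExtension.isGalois {238627 ^ 2} ℚ M₂
  have : IsGalois K M₂ := .tower_top_of_isGalois ℚ K M₂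
  obtain ⟨z, θ, σ, hz, hθ, hσθ, hσ, hnorm, hhom⟩ :=
    exists_real_cyclotomic_integers F M₁ hFM hF
  have hinj : Function.Injective (algebraMap (𝓞 F) (𝓞 M₁)) :=
    FaithfulSMul.algebraMap_injective _ _
  obtain ⟨η, hη⟩ := theta_mul_inv hinj hz hθ
  obtain ⟨Q, hQ⟩ := exists_span_alpha_eq_pow (K := K) (L := L) (M₂ := M₂) (p := 238627)
    (by norm_num) hK hz hθ (b := comb θ alphaCompl) (mod_cast alpha_mul_compl hinj hz hθ)
  obtain ⟨D, hD⟩ := exists_thetaLog_hom hhom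
  obtain ⟨τ, hτ⟩ := exists_padic_hom hhom
  obtain ⟨q, hqmul, hq⟩ := exists_fermatQuotient 238627 (by norm_num)
  have ht : ((1270466375612716 : ℕ) : ZMod (238627 ^ 3)) ^ 243 = 1 := by
    reduce_mod_char
  have hση : ∀ k, (σ ^ k) η = θ (2 ^ k) := fun k => by rw [hη, hσθ, mul_one]
  have hσα : ∀ k, (σ ^ k) (comb θ alphaList) = comb (fun j => θ (2 ^ k * j)) alphaList :=
    fun k => by simp only [map_comb, hσθ]
  have hτθ : ∀ k, (238627 : ℤ_[238627]) ^ 3 ∣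
      τ (θ (2 ^ k)) - thetaMod (238627 ^ 3) 1270466375612716 (2 ^ k) := fun k =>
    hτ _ _ fun g hg => by rw [hg, thetaMod_cast ht]
  have hτα : ∀ k, (238627 : ℤ_[238627]) ^ 3 ∣ τ ((σ ^ k) (comb θ alphaList)) - alphaMod k :=
    fun k => hτ _ _ fun g hg => by rw [hσα, alphaMod_cast k g ht hg]
  have hqθ : ∀ k ∈ Finset.range 81, q (τ ((σ ^ k) η)) =
      fermatQuot (thetaMod (238627 ^ 3) 1270466375612716 (2 ^ k)) := fun k hk => by
    obtain ⟨h1, h2⟩ := fermatQuot_spec (fermatPow_thetaMod k (Finset.mem_range.mp hk))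
    refine hq _ 0 _ _ h1 h2 ?_
    rw [hση, pow_zero, one_mul]
    exact (pow_dvd_pow _ (by norm_num)).trans (hτθ k)
  have hqα : ∀ k ∈ Finset.range 81, q (τ ((σ ^ k) (comb θ alphaList))) =
      fermatQuot (alphaMod k / 238627 ^ (if k = 0 then 1 else 0)) := fun k hk => by
    obtain ⟨h1, h2⟩ := fermatQuot_spec (fermatPow_alphaMod k (Finset.mem_range.mp hk))
    refine hq _ (if k = 0 then 1 else 0) _ _ h1 h2 ?_
    have h3 := congrArg (Nat.cast (R := ℤ_[238627]))
      (alphaMod_div_mul k (Finset.mem_range.mp hk))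
    rw [Nat.cast_mul, Nat.cast_pow] at h3
    rw [h3]
    exact (pow_dvd_pow _ (by split_ifs <;> norm_num)).trans (hτα k)
  refine dvd_card_classGroup 238627 (by norm_num) (n := 81) (by decide) hF hFL
    (exists_natAbs_norm_eq 238627 (IsCyclotomicExtension.zeta_spec (238627 ^ 2) ℚ M₂) hKM)
    σ hσ hnorm τ η ?_ q hqmul hq isPrimitiveRoot_17730 (i₀ := 1) (by decide) D η ?_ ?_
    (comb θ alphaList) ?_ hQ ?_
  · intro j hj k hk hjk h
    rw [hση, hση] at h
    have hzero : ∀ x : ℤ_[238627], (238627 : ℤ_[238627]) ∣ x → PadicInt.toZMod x = 0 := by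
      rintro _ ⟨y, rfl⟩
      rw [map_mul, map_ofNat, show (OfNat.ofNat 238627 : ZMod 238627) = 0 by decide, zero_mul]
    have hmod : ∀ k, PadicInt.toZMod (τ (θ (2 ^ k))) =
        thetaMod (238627 ^ 3) 1270466375612716 (2 ^ k) := fun k => by
      have := hzero _ ((dvd_pow_self _ three_ne_zero).trans (hτθ k))
      rwa [map_sub, map_natCast, sub_eq_zero] at this
    have h1 := hzero _ h
    rw [map_sub, hmod, hmod, sub_eq_zero, ZMod.natCast_eq_natCast_iff'] at h1
    exact thetaMod_injOn j hj k hk hjk h1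
  · intro i hi h
    refine sum_thetaLog_ne_zero i hi ?_
    rw [← Nat.dvd_iff_mod_eq_zero, ← ZMod.natCast_eq_zero_iff, ← h, Nat.cast_sum]
    refine Finset.sum_congr rfl fun k hk => ?_
    rw [hD _ k (Finset.mem_range.mp hk) (hση k), Nat.cast_mul, Nat.cast_pow,
      Nat.cast_ofNat, pow_mod_of_pow_eq_one isPrimitiveRoot_17730.pow_eq_one, pow_mul]
  · rw [Finset.sum_congr rfl fun k hk => by rw [hqθ k hk, pow_one]]
    have h := (ZMod.natCast_eq_zero_iff _ _).mpr
      (Nat.dvd_of_mod_eq_zero sum_fermatQuot_thetaMod)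
    simpa only [Nat.cast_sum, Nat.cast_mul, Nat.cast_pow, Nat.cast_ofNat] using h
  · intro k hk h
    have h1 := hτα k
    rw [h, zero_sub, dvd_neg] at h1
    have h2 := (PadicInt.pow_p_dvd_int_iff (p := 238627) 3 (alphaMod k)).mp (mod_cast h1)
    exact alphaMod_ne_zero k hk (Nat.mod_eq_zero_of_dvd (mod_cast h2))
  · rw [Finset.sum_congr rfl fun k hk => by rw [hqα k hk, pow_one]]
    intro h
    refine sum_fermatQuot_alphaMod (Nat.mod_eq_zero_of_dvd
      ((ZMod.natCast_eq_zero_iff _ _).mp ?_))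
    simpa only [Nat.cast_sum, Nat.cast_mul, Nat.cast_pow, Nat.cast_ofNat] using h

end

theorem IsPrimitiveRoot.adjoin_isCyclotomicExtension_rat {n : ℕ} [NeZero n] {ζ : ℂ}
    (hζ : IsPrimitiveRoot ζ n) :
    IsCyclotomicExtension {n} ℚ (IntermediateField.adjoin ℚ {ζ}) := by
  change IsCyclotomicExtension {n} ℚ (IntermediateField.adjoin ℚ {ζ}).toSubalgebra
  rw [IntermediateField.adjoin_simple_toSubalgebra_of_isAlgebraic
    ((hζ.isIntegral (NeZero.pos n)).tower_top : IsIntegral ℚ ζ).isAlgebraic]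
  exact hζ.adjoin_isCyclotomicExtension ℚ

theorem IsPrimitiveRoot.isAbelianGalois_of_le_adjoin {n : ℕ} [NeZero n] {ζ : ℂ}
    (hζ : IsPrimitiveRoot ζ n) {K : IntermediateField ℚ ℂ}
    (hK : K ≤ IntermediateField.adjoin ℚ {ζ}) : IsAbelianGalois ℚ K := by
  have := hζ.adjoin_isCyclotomicExtension_rat
  have h : IsAbelianGalois ℚ (IntermediateField.adjoin ℚ {ζ}) :=
    IsCyclotomicExtension.isAbelianGalois {n} ℚ _
  exact @IsAbelianGalois.of_algHom _ _ _ _ _ _ _ _ (IntermediateField.inclusion hK) h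

/-- `238627` divides the class number of the compositum `ℚ(3⁴)·ℚ(238627)`, where `ℚ(3⁴)` is the
unique subfield of degree `81` of `ℚ(ζ_{3⁵})` (the `4`-th layer of the cyclotomic
`ℤ₃`-extension of `ℚ`) and `ℚ(238627)` is the unique degree-`238627` subfield of `ℚ(ζ_{238627²})`,
the compositum being taken inside `ℂ`. -/
theorem p238627_dvd_classNumber
    (K₁ K₂ : IntermediateField ℚ ℂ)
    (ζ : ℂ) (hζ : IsPrimitiveRoot ζ (3 ^ 5))
    (hK₁sub : K₁ ≤ IntermediateField.adjoin ℚ {ζ})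
    (hK₁deg : Module.finrank ℚ K₁ = 3 ^ 4)
    (ξ : ℂ) (hξ : IsPrimitiveRoot ξ (238627 ^ 2))
    (hK₂sub : K₂ ≤ IntermediateField.adjoin ℚ {ξ})
    (hK₂deg : Module.finrank ℚ K₂ = 238627) :
    238627 ∣ Nat.card (ClassGroup (𝓞 ↥(K₁ ⊔ K₂))) := by
  have : NeZero (3 ^ 5) := ⟨by norm_num⟩
  have : NeZero (238627 ^ 2) := ⟨by norm_num⟩
  have := hζ.adjoin_isCyclotomicExtension_rat
  have := hξ.adjoin_isCyclotomicExtension_rat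
  have : NumberField (IntermediateField.adjoin ℚ {ζ}) :=
    IsCyclotomicExtension.numberField {3 ^ 5} ℚ _
  have : NumberField (IntermediateField.adjoin ℚ {ξ}) :=
    IsCyclotomicExtension.numberField {238627 ^ 2} ℚ _
  have : FiniteDimensional ℚ K₁ := .of_finrank_pos (by rw [hK₁deg]; norm_num)
  have : FiniteDimensional ℚ K₂ := .of_finrank_pos (by rw [hK₂deg]; norm_num)
  have : NumberField K₁ := {}
  have : NumberField K₂ := {}
  have : NumberField ↥(K₁ ⊔ K₂) := {}
  have : Normal ℚ K₁ := (hζ.isAbelianGalois_of_le_adjoin hK₁sub).toIsGalois.to_normal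
  have : Normal ℚ K₂ := (hξ.isAbelianGalois_of_le_adjoin hK₂sub).toIsGalois.to_normal
  have : Normal ℚ ↥(K₁ ⊔ K₂) := @IntermediateField.normal_sup ℚ ℂ _ _ _ K₁ K₂ ‹_› ‹_›
  have : IsGalois ℚ ↥(K₁ ⊔ K₂) := {}
  let _ : Algebra K₁ (IntermediateField.adjoin ℚ {ζ}) :=
    (IntermediateField.inclusion hK₁sub).toRingHom.toAlgebra
  let _ : Algebra K₂ (IntermediateField.adjoin ℚ {ξ}) :=
    (IntermediateField.inclusion hK₂sub).toRingHom.toAlgebra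
  let _ : Algebra K₁ ↥(K₁ ⊔ K₂) :=
    (IntermediateField.inclusion (le_sup_left : K₁ ≤ K₁ ⊔ K₂)).toRingHom.toAlgebra
  let _ : Algebra K₂ ↥(K₁ ⊔ K₂) :=
    (IntermediateField.inclusion (le_sup_right : K₂ ≤ K₁ ⊔ K₂)).toRingHom.toAlgebra
  have : IsGalois K₁ ↥(K₁ ⊔ K₂) := .tower_top_of_isGalois ℚ _ _
  have hdisj : K₁.LinearDisjoint K₂ :=
    .of_finrank_coprime (by rw [hK₁deg, hK₂deg]; norm_num)
  have hdeg := hdisj.finrank_sup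
  rw [hK₁deg, hK₂deg, ← Module.finrank_mul_finrank ℚ K₁ ↥(K₁ ⊔ K₂), hK₁deg] at hdeg
  exact dvd_classNumber_abstract (F := K₁) (K := K₂) (M₁ := IntermediateField.adjoin ℚ {ζ})
    (M₂ := IntermediateField.adjoin ℚ {ξ}) hK₁deg hK₂deg
    (Nat.eq_of_mul_eq_mul_left (by norm_num) hdeg)
end
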